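/- Let λ ∈ ℝ. The family of all signed graphs whose smallest eigenvalue is at least −λ (with the convention that the signed graph with no vertices belongs to the family) has a finite forbidden subgraph characterization if and only if λ < λ*. -/

import Mathlib

open Classical

/-- An eigenvalue of a real matrix indexed by a finite type. -/
def IsEigenvalue {V : Type*} [Fintype V] (A : Matrix V V ℝ) (μ : ℝ) : Prop :=
  ∃ v : V → ℝ, v ≠ 0 ∧ A.mulVec v = μ • v

/-- A signed graph on `n` vertices, given by its signed adjacency matrix: a symmetric real
matrix with zero diagonal and off-diagonal entries in `{-1, 0, 1}`. -/
structure SignedGraph (n : ℕ) where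
  mat : Matrix (Fin n) (Fin n) ℝ
  isSymm : mat.IsSymm
  diag_zero : ∀ i, mat i i = 0
  entries : ∀ i j, mat i j = -1 ∨ mat i j = 0 ∨ mat i j = 1

/-- `F` embeds into `G` as an induced signed subgraph. -/
def SignedEmbeds {m n : ℕ} (F : SignedGraph m) (G : SignedGraph n) : Prop :=
  ∃ f : Fin m → Fin n, Function.Injective f ∧ ∀ i j, F.mat i j = G.mat (f i) (f j)

/-- A family of signed graphs has a finite forbidden (induced) subgraph characterization. -/
def HasFiniteForbiddenCharacterizationSigned (P : ∀ n : ℕ, SignedGraph n → Prop) : Prop :=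
  ∃ (k : ℕ) (N : Fin k → ℕ) (F : ∀ i : Fin k, SignedGraph (N i)),
    ∀ (n : ℕ) (G : SignedGraph n), P n G ↔ ∀ i : Fin k, ¬ SignedEmbeds (F i) G

open scoped Topology


/-- A symmetric matrix with zero diagonal and entries in `{-1, 0, 1}`, over the integers. -/
structure IsSignedAdj {V : Type*} (A : V → V → ℤ) : Prop where
  symm : ∀ x y, A x y = A y x
  diag : ∀ x, A x x = 0
  entries : ∀ x y, A x y = -1 ∨ A x y = 0 ∨ A x y = 1

section Forms

variable {V : Type*} [Fintype V]

/-- The bilinear form of the matrix `lam + A`. -/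
noncomputable def shiftBilin (A : V → V → ℤ) (lam : ℝ) (x y : V → ℝ) : ℝ :=
  lam * ∑ v, x v * y v + ∑ v, ∑ w, (A v w : ℝ) * x v * y w

/-- The quadratic form of `lam + A - kap • s sᵀ` is nonnegative on vectors supported in `F`. -/
def RootGood (A : V → V → ℤ) (lam kap : ℝ) (F : Finset V) (s : V → ℤ) : Prop :=
  ∀ x : V → ℝ, (∀ v, v ∉ F → x v = 0) → kap * (∑ v, (s v : ℝ) * x v) ^ 2 ≤ shiftBilin A lam x x

/-- The quadratic form of `lam + A` is nonnegative on vectors supported in `F`. -/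
def Good (A : V → V → ℤ) (lam : ℝ) (F : Finset V) : Prop :=
  ∀ x : V → ℝ, (∀ v, v ∉ F → x v = 0) → 0 ≤ shiftBilin A lam x x

variable {A : V → V → ℤ} {lam lam' kap kap' : ℝ} {F F' : Finset V} {s s' : V → ℤ}

lemma shiftBilin_add_left (x y z : V → ℝ) :
    shiftBilin A lam (x + y) z = shiftBilin A lam x z + shiftBilin A lam y z := by
  simp only [shiftBilin, Pi.add_apply, add_mul, mul_add, Finset.sum_add_distrib]; ring

lemma shiftBilin_smul_left (c : ℝ) (x y : V → ℝ) :
    shiftBilin A lam (c • x) y = c * shiftBilin A lam x y := by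
  simp only [shiftBilin, Pi.smul_apply, smul_eq_mul, mul_add, Finset.mul_sum]
  congr 1
  · exact Finset.sum_congr rfl fun _ _ => by ring
  · exact Finset.sum_congr rfl fun _ _ => Finset.sum_congr rfl fun _ _ => by ring

lemma shiftBilin_comm (hA : IsSignedAdj A) (x y : V → ℝ) :
    shiftBilin A lam x y = shiftBilin A lam y x := by
  simp only [shiftBilin]
  congr 1
  · simp only [mul_comm]
  · rw [Finset.sum_comm]
    exact Finset.sum_congr rfl fun v _ => Finset.sum_congr rfl fun w _ => by
      rw [hA.symm w v]; ring

lemma shiftBilin_add_right (x y z : V → ℝ) :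
    shiftBilin A lam x (y + z) = shiftBilin A lam x y + shiftBilin A lam x z := by
  simp only [shiftBilin, Pi.add_apply, mul_add, Finset.sum_add_distrib]; ring

lemma shiftBilin_smul_right (c : ℝ) (x y : V → ℝ) :
    shiftBilin A lam x (c • y) = c * shiftBilin A lam x y := by
  simp only [shiftBilin, Pi.smul_apply, smul_eq_mul, mul_add, Finset.mul_sum]
  congr 1
  · exact Finset.sum_congr rfl fun _ _ => by ring
  · exact Finset.sum_congr rfl fun _ _ => Finset.sum_congr rfl fun _ _ => by ring

lemma shiftBilin_single_left (w : V) (x : V → ℝ) :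
    shiftBilin A lam (Pi.single w 1) x = lam * x w + ∑ v, (A w v : ℝ) * x v := by
  simp only [shiftBilin, Pi.single_apply]
  simp

lemma shiftBilin_single_single (v w : V) :
    shiftBilin A lam (Pi.single v 1) (Pi.single w 1) = (if v = w then lam else 0) + A v w := by
  rw [shiftBilin_single_left]
  simp [Pi.single_apply]

lemma shiftBilin_sum_left {ι : Type*} (t : Finset ι) (f : ι → V → ℝ) (y : V → ℝ) :
    shiftBilin A lam (∑ i ∈ t, f i) y = ∑ i ∈ t, shiftBilin A lam (f i) y := by
  induction t using Finset.induction_on with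
  | empty => simp [shiftBilin]
  | insert a t ha ih => rw [Finset.sum_insert ha, Finset.sum_insert ha, shiftBilin_add_left, ih]

lemma shiftBilin_sum_right {ι : Type*} (t : Finset ι) (f : ι → V → ℝ) (y : V → ℝ) :
    shiftBilin A lam y (∑ i ∈ t, f i) = ∑ i ∈ t, shiftBilin A lam y (f i) := by
  induction t using Finset.induction_on with
  | empty => simp [shiftBilin]
  | insert a t ha ih => rw [Finset.sum_insert ha, Finset.sum_insert ha, shiftBilin_add_right, ih]

lemma RootGood.mono (h : RootGood A lam kap F s) (hF : F' ⊆ F) : RootGood A lam kap F' s :=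
  fun x hx => h x fun v hv => hx v fun h' => hv (hF h')

lemma Good.mono (h : Good A lam F) (hF : F' ⊆ F) : Good A lam F' :=
  fun x hx => h x fun v hv => hx v fun h' => hv (hF h')

lemma shiftBilin_mono (h : lam ≤ lam') (x : V → ℝ) :
    shiftBilin A lam x x ≤ shiftBilin A lam' x x := by
  have : 0 ≤ ∑ v, x v * x v := Finset.sum_nonneg fun v _ => mul_self_nonneg _
  simp only [shiftBilin]
  nlinarith

lemma Good.mono_lam (h : Good A lam F) (hl : lam ≤ lam') : Good A lam' F :=
  fun x hx => (h x hx).trans (shiftBilin_mono hl x)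

lemma RootGood.mono_param (h : RootGood A lam kap F s) (hl : lam ≤ lam') (hk : kap' ≤ kap) :
    RootGood A lam' kap' F s := fun x hx =>
  ((mul_le_mul_of_nonneg_right hk (sq_nonneg _)).trans (h x hx)).trans (shiftBilin_mono hl x)

lemma RootGood.congr (h : RootGood A lam kap F s) (hs : ∀ v ∈ F, s v = s' v) :
    RootGood A lam kap F s' := by
  intro x hx
  have : ∑ v, (s' v : ℝ) * x v = ∑ v, (s v : ℝ) * x v :=
    Finset.sum_congr rfl fun v _ => by
      by_cases hv : v ∈ F
      · rw [hs v hv]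
      · simp [hx v hv]
  rw [this]; exact h x hx

lemma Good.rootGood (h : Good A lam F) (s : V → ℤ) : RootGood A lam 0 F s :=
  fun x hx => by simpa using h x hx

lemma RootGood.good (h : RootGood A lam kap F s) (hk : 0 ≤ kap) : Good A lam F :=
  fun x hx => (mul_nonneg hk (sq_nonneg _)).trans (h x hx)

/-- Evaluation of the form on a combination of vertices. -/
lemma RootGood.apply_comb (h : RootGood A lam kap F s) {ι : Type*} [Fintype ι] (v : ι → V)
    (c : ι → ℝ) (hv : ∀ i, v i ∈ F) :
    kap * (∑ i, (s (v i) : ℝ) * c i) ^ 2 ≤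
      ∑ i, ∑ j, c j * (c i * ((if v i = v j then lam else 0) + A (v i) (v j))) := by
  have key := h (∑ i, c i • (Pi.single (v i) 1 : V → ℝ)) (by
    intro w hw
    rw [Finset.sum_apply]
    refine Finset.sum_eq_zero fun i _ => ?_
    have : w ≠ v i := fun e => hw (e ▸ hv i)
    simp [this])
  rw [shiftBilin_sum_left] at key
  simp only [shiftBilin_sum_right, shiftBilin_smul_left, shiftBilin_smul_right,
    shiftBilin_single_single] at key
  convert key using 3
  simp only [Finset.sum_apply, Pi.smul_apply, smul_eq_mul, Pi.single_apply, Finset.mul_sum]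
  rw [Finset.sum_comm]
  refine Finset.sum_congr rfl fun i _ => ?_
  simp

/-- Passing the root to a vertex `w` which separates the old root from `F'`. -/
lemma RootGood.absorb (hA : IsSignedAdj A) (h : RootGood A lam kap F s) (hk : kap < lam) {w : V}
    (hw : w ∈ F) (hsw : s w = -1 ∨ s w = 1) (hF : F' ⊆ F) (hwF : w ∉ F')
    (hs : ∀ x ∈ F', s x = 0) : RootGood A lam (1 / (lam - kap)) F' (A w) := by
  intro x hx
  have hd : 0 < lam - kap := sub_pos.2 hk
  set T : ℝ := ∑ v, (A w v : ℝ) * x v with hT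
  have hxw : x w = 0 := hx w hwF
  have hsx : ∑ v, (s v : ℝ) * x v = 0 := Finset.sum_eq_zero fun v _ => by
    by_cases hv : v ∈ F'
    · simp [hs v hv]
    · simp [hx v hv]
  have key := h (x + (-T / (lam - kap)) • Pi.single w 1) (by
    intro v hv
    have h1 : v ≠ w := fun e => hv (e ▸ hw)
    have h2 : x v = 0 := hx v fun h' => hv (hF h')
    simp [h1, h2])
  have e1 : ∑ v, (s v : ℝ) * (x + (-T / (lam - kap)) • (Pi.single w 1 : V → ℝ)) v
      = s w * (-T / (lam - kap)) := by
    simp only [Pi.add_apply, mul_add, Finset.sum_add_distrib, hsx]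
    simp [Pi.single_apply]
  have hsq : (s w : ℝ) ^ 2 = 1 := by rcases hsw with h | h <;> simp [h]
  rw [e1, shiftBilin_add_left, shiftBilin_add_right, shiftBilin_add_right,
    shiftBilin_smul_right, shiftBilin_smul_left, shiftBilin_smul_left, shiftBilin_smul_right,
    shiftBilin_comm hA x (Pi.single w 1), shiftBilin_single_single, shiftBilin_single_left,
    hA.diag, hxw, ← hT, mul_pow, hsq] at key
  have e2 : 1 / (lam - kap) * T ^ 2 = T / (lam - kap) * T := by ring
  have e3 : T / (lam - kap) * (lam - kap) = T := by field_simp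
  rw [e2]
  set c := T / (lam - kap) with hc
  have e4 : -T / (lam - kap) = -c := by rw [hc]; ring
  rw [e4] at key
  simp only [if_true, Int.cast_zero] at key
  have e5 : c * (c * (lam - kap)) = c * T := by rw [e3]
  nlinarith

end Forms


section Bessel

variable {ι : Type*} [Fintype ι]

/-- Bessel's inequality for integer vectors. -/
lemma sum_sq_dotProduct_le (Z : ℕ → ι → ℤ) (n : ℕ) (h1 : ∀ j < n, Z j ⬝ᵥ Z j = 1)
    (h0 : ∀ j k, j < k → k < n → Z j ⬝ᵥ Z k = 0) (x : ι → ℤ) :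
    ∑ j ∈ Finset.range n, (x ⬝ᵥ Z j) ^ 2 ≤ x ⬝ᵥ x := by
  have key : ∀ m ≤ n, ∃ R : ι → ℤ,
      R ⬝ᵥ R = x ⬝ᵥ x - ∑ j ∈ Finset.range m, (x ⬝ᵥ Z j) ^ 2 ∧
      ∀ k, m ≤ k → k < n → R ⬝ᵥ Z k = x ⬝ᵥ Z k := by
    intro m
    induction m with
    | zero => exact fun _ => ⟨x, by simp, fun _ _ _ => rfl⟩
    | succ m ih =>
      intro hm
      obtain ⟨R, hR, hRk⟩ := ih (by omega)
      refine ⟨R - (x ⬝ᵥ Z m) • Z m, ?_, fun k hk hkn => ?_⟩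
      · rw [Finset.sum_range_succ, sub_dotProduct, dotProduct_sub, dotProduct_sub, dotProduct_smul,
          smul_dotProduct, smul_dotProduct, dotProduct_smul, h1 m (by omega),
          dotProduct_comm (Z m) R, hRk m le_rfl (by omega), hR]
        simp only [smul_eq_mul]
        ring
      · rw [sub_dotProduct, smul_dotProduct, h0 m k (by omega) hkn, hRk k (by omega) hkn]
        simp
  obtain ⟨R, hR, -⟩ := key n le_rfl
  have : 0 ≤ R ⬝ᵥ R := Finset.sum_nonneg fun i _ => mul_self_nonneg _
  omega

/-- Partial sums of a path of integer vectors starting with a unit vector are orthonormal. -/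
lemma sum_sq_partial_le (v : ℕ → ι → ℤ) (r : ℕ) (h0 : v 0 ⬝ᵥ v 0 = 1)
    (h2 : ∀ i, 1 ≤ i → i ≤ r → v i ⬝ᵥ v i = 2) (h1 : ∀ i < r, v i ⬝ᵥ v (i + 1) = -1)
    (h3 : ∀ i j, i + 2 ≤ j → j ≤ r → v i ⬝ᵥ v j = 0) (x : ι → ℤ) :
    ∑ j ∈ Finset.range (r + 1), (∑ i ∈ Finset.range (j + 1), x ⬝ᵥ v i) ^ 2 ≤ x ⬝ᵥ x := by
  set Z : ℕ → ι → ℤ := fun j => ∑ i ∈ Finset.range (j + 1), v i with hZ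
  have Zs : ∀ j, Z (j + 1) = Z j + v (j + 1) := fun j => by
    simp only [hZ]; rw [Finset.sum_range_succ]
  have Zv : ∀ j k, j < k → k ≤ r → Z j ⬝ᵥ v k = if k = j + 1 then -1 else 0 := by
    intro j
    induction j with
    | zero =>
      intro k hk hkr
      simp only [hZ, zero_add, Finset.sum_range_one]
      split_ifs with h
      · subst h; exact h1 0 (by omega)
      · exact h3 0 k (by omega) hkr
    | succ j ih =>
      intro k hk hkr
      rw [Zs, add_dotProduct, ih k (by omega) hkr, if_neg (by omega), zero_add]
      split_ifs with h
      · subst h; exact h1 _ (by omega)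
      · exact h3 _ k (by omega) hkr
  have Z1 : ∀ j ≤ r, Z j ⬝ᵥ Z j = 1 := by
    intro j
    induction j with
    | zero => intro _; simpa [hZ] using h0
    | succ j ih =>
      intro hj
      rw [Zs, add_dotProduct, dotProduct_add, dotProduct_add, ih (by omega),
        dotProduct_comm (v (j + 1)) (Z j), Zv j (j + 1) (by omega) hj, if_pos rfl,
        h2 _ (by omega) hj]
      norm_num
  have Z0 : ∀ k j, j < k → k ≤ r → Z j ⬝ᵥ Z k = 0 := by
    intro k
    induction k with
    | zero => intro j hj; omega
    | succ k ih =>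
      intro j hj hk
      rw [Zs, dotProduct_add, Zv j (k + 1) hj hk]
      rcases (Nat.lt_succ_iff.1 hj).lt_or_eq with h | h
      · rw [ih j h (by omega), if_neg (by omega)]; rfl
      · subst h; rw [Z1 j (by omega), if_pos rfl]; rfl
  have := sum_sq_dotProduct_le Z (r + 1) (fun j hj => Z1 j (by omega))
    (fun j k hjk hk => Z0 k j hjk (by omega)) x
  simpa [hZ, dotProduct_sum] using this

end Bessel

section Core

variable {V : Type*}

/-- The Gram matrix `2 + A - s sᵀ`. -/
noncomputable def rootGram (A : V → V → ℤ) (s : V → ℤ) (x y : V) : ℤ :=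
  (if x = y then 2 else 0) + A x y - s x * s y

/-- `rootGram A s` restricted to `F` is the Gram matrix of integer vectors. -/
def RootRep (A : V → V → ℤ) (s : V → ℤ) (F : Finset V) : Prop :=
  ∃ (ι : Type) (_ : Fintype ι) (φ : V → ι → ℤ),
    ∀ x ∈ F, ∀ y ∈ F, φ x ⬝ᵥ φ y = rootGram A s x y

/-- Every union of connected components of `F` meets the support of `s`. -/
def RootConn (A : V → V → ℤ) (s : V → ℤ) (F : Finset V) : Prop :=
  ∀ Y ⊆ F, Y.Nonempty → (∀ y ∈ Y, ∀ z ∈ F, z ∉ Y → A y z = 0) → ∃ y ∈ Y, s y ≠ 0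

/-- An induced path `p 0, …, p (r + 1)` for `rootGram` meeting the support of `s` exactly in its
two ends, with signs `c` making all consecutive products equal to `-1`. -/
structure RootPath (A : V → V → ℤ) (s : V → ℤ) (F : Finset V) (r : ℕ) (p : ℕ → V) (c : ℕ → ℤ) :
    Prop where
  mem : ∀ i ≤ r + 1, p i ∈ F
  sq : ∀ i ≤ r + 1, c i ^ 2 = 1
  inj : ∀ i j, i < j → j ≤ r + 1 → p i ≠ p j
  first : s (p 0) ≠ 0
  last : s (p (r + 1)) ≠ 0
  mid : ∀ i, 1 ≤ i → i ≤ r → s (p i) = 0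
  edge : ∀ i ≤ r, c i * c (i + 1) * rootGram A s (p i) (p (i + 1)) = -1
  far : ∀ i j, i + 2 ≤ j → j ≤ r + 1 → rootGram A s (p i) (p j) = 0

/-- A class of rooted signed graphs, closed under restriction and under passing the root to a
vertex, in which the local consequences of positive semidefiniteness of `rootGram` hold. -/
structure RootClass (A : V → V → ℤ) (P : Finset V → (V → ℤ) → Prop) : Prop where
  entries : ∀ {F s}, P F s → ∀ x ∈ F, s x = -1 ∨ s x = 0 ∨ s x = 1
  mono : ∀ {F s F'}, P F s → F' ⊆ F → P F' s
  absorb : ∀ {F s F' w}, P F s → w ∈ F → s w ≠ 0 → F' ⊆ F → w ∉ F' → (∀ x ∈ F', s x = 0) →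
    P F' (A w)
  ne_two : ∀ {F s u v}, P F s → u ∈ F → v ∈ F → u ≠ v → s u ≠ 0 → s v ≠ 0 →
    A u v ≠ -(s u * s v)
  parallel : ∀ {F s u v w}, P F s → u ∈ F → v ∈ F → w ∈ F → u ≠ v → w ≠ u → w ≠ v →
    s u ≠ 0 → s v ≠ 0 → A u v = 0 → rootGram A s w u = -(s u * s v) * rootGram A s w v
  cycle : ∀ {F s r p c w}, P F s → RootPath A s F r p c → w ∈ F → (∀ i ≤ r + 1, w ≠ p i) →
    1 ≤ r → r ≤ 3 → ∑ i ∈ Finset.range (r + 2), c i * rootGram A s w (p i) = 0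

variable {A : V → V → ℤ} {s : V → ℤ} {F : Finset V} {P : Finset V → (V → ℤ) → Prop}

lemma rootGram_comm (hA : IsSignedAdj A) (x y : V) : rootGram A s x y = rootGram A s y x := by
  simp only [rootGram, hA.symm x y, eq_comm (a := x) (b := y), mul_comm (s x)]

lemma rootGram_self (hA : IsSignedAdj A) (x : V) : rootGram A s x x = 2 - s x * s x := by
  simp [rootGram, hA.diag]

lemma rootGram_of_ne {x y : V} (h : x ≠ y) (hs : s x = 0 ∨ s y = 0) :
    rootGram A s x y = A x y := by
  rcases hs with hs | hs <;> simp [rootGram, h, hs]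

lemma RootRep.mono (h : RootRep A s F) {F' : Finset V} (hF : F' ⊆ F) : RootRep A s F' := by
  obtain ⟨ι, i, φ, hφ⟩ := h
  exact ⟨ι, i, φ, fun x hx y hy => hφ x (hF hx) y (hF hy)⟩

/-- Representations of two orthogonal pieces combine. -/
lemma RootRep.union (hA : IsSignedAdj A) {Y : Finset V} (h1 : RootRep A s Y)
    (h2 : RootRep A s (F \ Y)) (h0 : ∀ y ∈ Y, ∀ z ∈ F, z ∉ Y → rootGram A s y z = 0) :
    RootRep A s F := by
  obtain ⟨ι, i, φ, hφ⟩ := h1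
  obtain ⟨κ, j, ψ, hψ⟩ := h2
  refine ⟨ι ⊕ κ, inferInstance, fun x => if x ∈ Y then Sum.elim (φ x) 0 else Sum.elim 0 (ψ x), ?_⟩
  intro x hx y hy
  by_cases hxY : x ∈ Y <;> by_cases hyY : y ∈ Y <;> simp only [hxY, hyY, if_true, if_false] <;>
    simp only [dotProduct, Fintype.sum_sum_type, Sum.elim_inl, Sum.elim_inr, Pi.zero_apply,
      mul_zero, zero_mul, Finset.sum_const_zero, add_zero, zero_add]
  · exact hφ x hxY y hyY
  · exact (h0 x hxY y hy hyY).symm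
  · rw [rootGram_comm hA]; exact (h0 y hyY x hx hxY).symm
  · exact hψ x (by simp [hx, hxY]) y (by simp [hy, hyY])

/-- Absorbing the only vertex adjacent to the root. -/
lemma RootRep.of_absorb (hA : IsSignedAdj A) {w : V} (hsw : s w = -1 ∨ s w = 1)
    (hs : ∀ x ∈ F, x ≠ w → s x = 0) (h : RootRep A (A w) (F.erase w)) : RootRep A s F := by
  obtain ⟨ι, i, φ, hφ⟩ := h
  refine ⟨Option ι, inferInstance,
    fun x => if x = w then fun o => o.elim 1 (fun _ => 0) else fun o => o.elim (A w x) (φ x), ?_⟩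
  have hsq : s w * s w = 1 := by rcases hsw with h | h <;> simp [h]
  intro x hx y hy
  by_cases hxw : x = w <;> by_cases hyw : y = w <;>
    simp only [hxw, hyw, if_true, if_false, dotProduct, Fintype.sum_option, Option.elim,
      zero_mul, mul_zero, Finset.sum_const_zero]
  · rw [rootGram_self hA, hsq]; rfl
  · rw [rootGram_of_ne (Ne.symm hyw) (Or.inr (hs y hy hyw))]; ring
  · rw [rootGram_of_ne hxw (Or.inl (hs x hx hxw)), hA.symm]; ring
  · have := hφ x (by simp [hx, hxw]) y (by simp [hy, hyw])
    simp only [dotProduct] at this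
    rw [this]
    simp only [rootGram, hs x hx hxw]
    ring

/-- A vertex whose Gram row is an integer combination of other rows can be added. -/
lemma RootRep.of_comb (hA : IsSignedAdj A) {u : V} {κ : Type*} (t : Finset κ) (q : κ → V)
    (c : κ → ℤ) (hq : ∀ k ∈ t, q k ∈ F.erase u)
    (hc : ∀ w ∈ F, rootGram A s w u = ∑ k ∈ t, c k * rootGram A s w (q k))
    (h : RootRep A s (F.erase u)) : RootRep A s F := by
  obtain ⟨ι, i, φ, hφ⟩ := h
  refine ⟨ι, i, fun x => if x = u then ∑ k ∈ t, c k • φ (q k) else φ x, ?_⟩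
  have key : ∀ w ∈ F.erase u, φ w ⬝ᵥ (∑ k ∈ t, c k • φ (q k)) = rootGram A s w u := by
    intro w hw
    rw [dotProduct_sum, hc w (Finset.mem_of_mem_erase hw)]
    exact Finset.sum_congr rfl fun k hk => by
      rw [dotProduct_smul, hφ w hw _ (hq k hk), smul_eq_mul]
  intro x hx y hy
  by_cases hxu : x = u <;> by_cases hyu : y = u <;> simp only [hxu, hyu, if_true, if_false]
  · rw [sum_dotProduct, hc u (hxu ▸ hx)]
    refine Finset.sum_congr rfl fun k hk => ?_
    rw [smul_dotProduct, key _ (hq k hk), smul_eq_mul, rootGram_comm hA]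
  · rw [dotProduct_comm, key y (by simp [hy, hyu]), rootGram_comm hA]
  · exact key x (by simp [hx, hxu])
  · exact hφ x (by simp [hx, hxu]) y (by simp [hy, hyu])

end Core


section CorePath

variable {V : Type*} {A : V → V → ℤ} {s : V → ℤ} {F : Finset V} {r : ℕ} {p : ℕ → V} {c : ℕ → ℤ}

lemma RootPath.reverse (hA : IsSignedAdj A) (h : RootPath A s F r p c) :
    RootPath A s F r (fun i => p (r + 1 - i)) (fun i => c (r + 1 - i)) where
  mem i _ := h.mem _ (by omega)
  sq i _ := h.sq _ (by omega)
  inj i j hij hj := (h.inj _ _ (by omega) (by omega)).symm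
  first := h.last
  last := by simpa using h.first
  mid i h1 h2 := h.mid _ (by omega) (by omega)
  edge i hi := by
    have := h.edge (r - i) (by omega)
    rw [show r + 1 - i = r - i + 1 by omega, show r + 1 - (i + 1) = r - i by omega,
      rootGram_comm hA, mul_comm (c _)]
    exact this
  far i j hij hj := by
    rw [rootGram_comm hA]; exact h.far _ _ (by omega) (by omega)

lemma RootPath.adj_ne_zero (h : RootPath A s F r p c) (hr : 1 ≤ r) {i : ℕ} (hi : i ≤ r) :
    A (p i) (p (i + 1)) ≠ 0 := by
  have h1 := h.edge i hi
  rw [rootGram_of_ne (h.inj i (i + 1) (by omega) (by omega))] at h1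
  · rintro h0
    simp [h0] at h1
  · rcases Nat.eq_zero_or_pos i with rfl | hi0
    · exact Or.inr (h.mid 1 le_rfl hr)
    · exact Or.inl (h.mid i hi0 hi)

lemma RootPath.gram_self (hA : IsSignedAdj A) (hs : ∀ x ∈ F, s x = -1 ∨ s x = 0 ∨ s x = 1)
    (h : RootPath A s F r p c) {i : ℕ} (hi : i ≤ r + 1) :
    rootGram A s (p i) (p i) = if i = 0 ∨ i = r + 1 then 1 else 2 := by
  rw [rootGram_self hA]
  split_ifs with h0
  · have : s (p i) ≠ 0 := by
      rcases h0 with rfl | rfl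
      exacts [h.first, h.last]
    rcases hs _ (h.mem i hi) with h1 | h1 | h1
    · simp [h1]
    · exact absurd h1 this
    · simp [h1]
  · rw [not_or] at h0
    rw [h.mid i (by omega) (by omega)]; rfl

lemma RootPath.bessel (hA : IsSignedAdj A) (hs : ∀ x ∈ F, s x = -1 ∨ s x = 0 ∨ s x = 1)
    (h : RootPath A s F r p c) (hr : 1 ≤ r) {w : V} (hw : w ∈ F) (hwp : ∀ i ≤ r + 1, w ≠ p i)
    (ih : ∀ F' ⊆ F.erase (p (r + 1)), RootConn A s F' → RootRep A s F') :
    ∑ j ∈ Finset.range (r + 1),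
      (∑ i ∈ Finset.range (j + 1), c i * rootGram A s w (p i)) ^ 2 ≤ 2 := by
  by_cases hz : ∀ i ≤ r, rootGram A s w (p i) = 0
  · rw [Finset.sum_eq_zero]
    · norm_num
    · intro j hj
      rw [Finset.sum_eq_zero]
      · norm_num
      · intro i hi
        rw [hz i (by simp at hi hj; omega), mul_zero]
  · set F' : Finset V := insert w ((Finset.range (r + 1)).image p) with hF'
    have hpF : ∀ i ≤ r, p i ∈ F' := fun i hi =>
      Finset.mem_insert_of_mem (Finset.mem_image_of_mem _ (Finset.mem_range.2 (by omega)))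
    have hwF : w ∈ F' := Finset.mem_insert_self _ _
    have hsub : F' ⊆ F.erase (p (r + 1)) := by
      intro x hx
      rcases Finset.mem_insert.1 hx with rfl | hx
      · exact Finset.mem_erase.2 ⟨hwp _ le_rfl, hw⟩
      · obtain ⟨i, hi, rfl⟩ := Finset.mem_image.1 hx
        have hi := Finset.mem_range.1 hi
        exact Finset.mem_erase.2 ⟨h.inj _ _ hi le_rfl, h.mem _ (by omega)⟩
    have hconn : RootConn A s F' := by
      intro Y hY hne hout
      by_contra! hsY
      have hno : ∀ i ≤ r, p i ∉ Y := by
        intro i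
        induction i with
        | zero => exact fun _ h0 => h.first (hsY _ h0)
        | succ i ihi =>
          intro hi hmem
          have := hout _ hmem _ (hpF i (by omega)) (ihi (by omega))
          rw [hA.symm] at this
          exact h.adj_ne_zero hr (i := i) (by omega) this
      have hYw : ∀ y ∈ Y, y = w := by
        intro y hy
        rcases Finset.mem_insert.1 (hY hy) with rfl | hx
        · rfl
        · obtain ⟨i, hi, rfl⟩ := Finset.mem_image.1 hx
          exact absurd hy (hno i (by simp at hi; omega))
      obtain ⟨y, hy⟩ := hne
      obtain rfl := hYw y hy
      refine hz fun i hi => ?_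
      rw [rootGram_of_ne (hwp i (by omega)) (Or.inl (hsY _ hy))]
      exact hout _ hy _ (hpF i hi) (hno i hi)
    obtain ⟨ι, _, φ, hφ⟩ := ih F' hsub hconn
    have hcc : ∀ i ≤ r + 1, c i * c i = 1 := fun i hi => by rw [← pow_two]; exact h.sq i hi
    have key := sum_sq_partial_le (fun i => c i • φ (p i)) r
      (by
        simp only [smul_dotProduct, dotProduct_smul, smul_eq_mul]
        rw [← mul_assoc, hcc 0 (by omega), hφ _ (hpF 0 (by omega)) _ (hpF 0 (by omega)),
          h.gram_self hA hs (by omega)]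
        simp)
      (fun i h1 h2 => by
        simp only [smul_dotProduct, dotProduct_smul, smul_eq_mul]
        rw [← mul_assoc, hcc i (by omega), hφ _ (hpF i h2) _ (hpF i h2),
          h.gram_self hA hs (by omega), if_neg (by omega)]
        norm_num)
      (fun i hi => by
        simp only [smul_dotProduct, dotProduct_smul, smul_eq_mul]
        rw [← mul_assoc, hφ _ (hpF i (by omega)) _ (hpF _ (by omega)), mul_comm (c (i + 1)),
          h.edge i (by omega)])
      (fun i j hij hj => by
        simp only [smul_dotProduct, dotProduct_smul, smul_eq_mul]
        rw [hφ _ (hpF i (by omega)) _ (hpF _ (by omega)), h.far i j hij (by omega)]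
        simp)
      (φ w)
    have e : ∑ j ∈ Finset.range (r + 1), (∑ i ∈ Finset.range (j + 1), φ w ⬝ᵥ (c i • φ (p i))) ^ 2
        = ∑ j ∈ Finset.range (r + 1),
          (∑ i ∈ Finset.range (j + 1), c i * rootGram A s w (p i)) ^ 2 := by
      refine Finset.sum_congr rfl fun j hj => ?_
      congr 1
      refine Finset.sum_congr rfl fun i hi => ?_
      rw [dotProduct_smul, hφ _ hwF _ (hpF i (by simp at hi hj; omega)), smul_eq_mul]
    rw [e, hφ _ hwF _ hwF, rootGram_self hA] at key
    nlinarith [mul_self_nonneg (s w)]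

/-- The alternating sum along a long root path is orthogonal to everything. -/
lemma RootPath.sum_eq_zero_of_le (hA : IsSignedAdj A)
    (hs : ∀ x ∈ F, s x = -1 ∨ s x = 0 ∨ s x = 1) (h : RootPath A s F r p c) (hr : 4 ≤ r) {w : V}
    (hw : w ∈ F) (hwp : ∀ i ≤ r + 1, w ≠ p i)
    (ih : ∀ F' ⊂ F, RootConn A s F' → RootRep A s F') :
    ∑ i ∈ Finset.range (r + 2), c i * rootGram A s w (p i) = 0 := by
  have ih' : ∀ i ≤ r + 1, ∀ F' ⊆ F.erase (p i), RootConn A s F' → RootRep A s F' :=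
    fun i hi F' hF' => ih F' (lt_of_le_of_lt hF' (Finset.erase_ssubset (h.mem i hi)))
  set f : ℕ → ℤ := fun i => c i * rootGram A s w (p i) with hf
  set D := ∑ i ∈ Finset.range (r + 2), f i with hD
  have b1 := h.bessel hA hs (by omega) hw hwp (ih' _ le_rfl)
  have b2 := (h.reverse hA).bessel hA hs (by omega) hw (fun i hi => hwp _ (by omega))
    (ih' _ (by omega))
  have e : ∀ j ≤ r, ∑ i ∈ Finset.range (j + 1), f (r + 1 - i)
      = D - ∑ i ∈ Finset.range (r - j + 1), f i := by
    intro j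
    induction j with
    | zero =>
      intro _
      rw [hD, Finset.sum_range_succ _ (r + 1)]
      simp
    | succ j ihj =>
      intro hj
      rw [Finset.sum_range_succ, ihj (by omega), show r - j + 1 = (r - (j + 1) + 1) + 1 by omega,
        Finset.sum_range_succ, show r + 1 - (j + 1) = r - (j + 1) + 1 by omega]
      ring
  by_contra hne
  have b2' : ∑ j ∈ Finset.range (r + 1), (D - ∑ i ∈ Finset.range (j + 1), f i) ^ 2 ≤ 2 := by
    rw [← Finset.sum_range_reflect]
    refine le_trans (le_of_eq ?_) b2
    refine Finset.sum_congr rfl fun j hj => ?_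
    have hj := Finset.mem_range.1 hj
    rw [show r + 1 - 1 - j = r - j by omega, ← e j (by omega)]
  have b3 : ∑ j ∈ Finset.range (r + 1), (1 : ℤ) ≤
      ∑ j ∈ Finset.range (r + 1), ((∑ i ∈ Finset.range (j + 1), f i) ^ 2 +
        (D - ∑ i ∈ Finset.range (j + 1), f i) ^ 2) := by
    refine Finset.sum_le_sum fun j _ => ?_
    by_contra! hlt
    have h1 := sq_nonneg (∑ i ∈ Finset.range (j + 1), f i)
    have h2 := sq_nonneg (D - ∑ i ∈ Finset.range (j + 1), f i)
    have h3 : (∑ i ∈ Finset.range (j + 1), f i) ^ 2 = 0 := by omega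
    have h4 : (D - ∑ i ∈ Finset.range (j + 1), f i) ^ 2 = 0 := by omega
    rw [sq_eq_zero_iff] at h3 h4
    exact hne (by omega)
  rw [Finset.sum_add_distrib] at b3
  simp only [Finset.sum_const, Finset.card_range] at b3
  have b1' : ∑ j ∈ Finset.range (r + 1), (∑ i ∈ Finset.range (j + 1), f i) ^ 2 ≤ 2 := b1
  have : ((r + 1 : ℕ) : ℤ) ≤ 4 := by
    simp only [nsmul_eq_mul, mul_one] at b3
    linarith
  push_cast at this
  omega

end CorePath


section ShortestPath

variable {V : Type*} {E : V → V → Prop} {S Q : V → Prop}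

/-- A walk between distinct points of `S` can be replaced by an induced path between distinct
points of `S` whose interior avoids `S`. -/
lemma exists_induced_path
    (h : ∃ (m : ℕ) (p : ℕ → V), S (p 0) ∧ S (p m) ∧ p 0 ≠ p m ∧ (∀ i ≤ m, Q (p i)) ∧
      ∀ i < m, E (p i) (p (i + 1))) :
    ∃ (m : ℕ) (p : ℕ → V), S (p 0) ∧ S (p m) ∧ p 0 ≠ p m ∧ (∀ i ≤ m, Q (p i)) ∧
      (∀ i < m, E (p i) (p (i + 1))) ∧ (∀ i, 0 < i → i < m → ¬ S (p i)) ∧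
      (∀ i j, i < j → j ≤ m → p i ≠ p j) ∧ (∀ i j, i + 2 ≤ j → j ≤ m → ¬ E (p i) (p j)) := by
  obtain ⟨p, hS0, hSm, hne, hQ, hE⟩ := Nat.find_spec h
  have hmin := fun k (hk : k < Nat.find h) => Nat.find_min h hk
  set m := Nat.find h
  have cut : ∀ i d, 1 ≤ d → i + d ≤ m →
      (i + d < m → E (p i) (p (i + d + 1))) → (i + d = m → p i = p m) → False := by
    intro i d hd him hEd hend
    refine hmin (m - d) (by omega)
      ⟨fun k => if k ≤ i then p k else p (k + d), ?_, ?_, ?_, ?_, ?_⟩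
    · simpa using hS0
    · by_cases hk : m - d ≤ i
      · have e : m - d = i := by omega
        simp only [e, le_refl, if_true]
        rw [hend (by omega)]; exact hSm
      · simp only [hk, if_false]
        rw [show m - d + d = m by omega]; exact hSm
    · by_cases hk : m - d ≤ i
      · have e : m - d = i := by omega
        simp only [e, le_refl, if_true, Nat.zero_le]
        rw [hend (by omega)]; exact hne
      · simp only [hk, if_false, Nat.zero_le, if_true]
        rw [show m - d + d = m by omega]; exact hne
    · intro k hk
      dsimp only
      split_ifs
      · exact hQ _ (by omega)
      · exact hQ _ (by omega)
    · intro k hk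
      dsimp only
      by_cases h1 : k + 1 ≤ i
      · rw [if_pos (by omega), if_pos h1]; exact hE k (by omega)
      · by_cases h2 : k ≤ i
        · obtain rfl : k = i := by omega
          rw [if_pos le_rfl, if_neg h1, show k + 1 + d = k + d + 1 by omega]
          exact hEd (by omega)
        · rw [if_neg h2, if_neg h1, show k + 1 + d = k + d + 1 by omega]
          exact hE _ (by omega)
  have hinj : ∀ i j, i < j → j ≤ m → p i ≠ p j := by
    intro i j hij hj he
    have hj' : i + (j - i) = j := by omega
    refine cut i (j - i) (by omega) (by omega) (fun hlt => ?_) (fun hm => ?_)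
    · rw [hj', he]; exact hE j (by omega)
    · rw [he, ← hm, hj']
  refine ⟨m, p, hS0, hSm, hne, hQ, hE, fun i h0 him hSi => ?_, hinj, fun i j hij hj hEij => ?_⟩
  · exact hmin i him ⟨p, hS0, hSi, hinj 0 i h0 him.le, fun k hk => hQ k (by omega),
      fun k hk => hE k (by omega)⟩
  · refine cut i (j - i - 1) (by omega) (by omega) (fun _ => ?_) (fun hm => by omega)
    rwa [show i + (j - i - 1) + 1 = j by omega]

end ShortestPath

section CoreMain

variable {V : Type*} {A : V → V → ℤ} {s : V → ℤ} {F : Finset V} {r : ℕ} {p : ℕ → V} {c : ℕ → ℤ}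
  {P : Finset V → (V → ℤ) → Prop}

lemma RootPath.sum_eq_zero_self (hA : IsSignedAdj A)
    (hs : ∀ x ∈ F, s x = -1 ∨ s x = 0 ∨ s x = 1) (h : RootPath A s F r p c) {j : ℕ}
    (hj : j ≤ r + 1) : ∑ i ∈ Finset.range (r + 2), c i * rootGram A s (p j) (p i) = 0 := by
  have hcj : c j ≠ 0 := fun h0 => by have := h.sq j hj; simp [h0] at this
  refine (mul_eq_zero.1 ?_).resolve_left hcj
  have e : c j * ∑ i ∈ Finset.range (r + 2), c i * rootGram A s (p j) (p i) =
      ∑ i ∈ Finset.range (r + 2), ((if i = j then (if j = 0 ∨ j = r + 1 then 1 else 2) else 0) +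
        (if i = j + 1 then -1 else 0) + (if i + 1 = j then -1 else 0)) := by
    rw [Finset.mul_sum]
    refine Finset.sum_congr rfl fun i hi => ?_
    have hi := Finset.mem_range.1 hi
    rcases lt_trichotomy i j with hij | rfl | hij
    · by_cases h1 : i + 1 = j
      · subst h1
        have := h.edge i (by omega)
        rw [rootGram_comm hA] at this
        simp only [if_true]
        rw [if_neg (by omega), if_neg (by omega)]
        linarith
      · rw [if_neg (by omega), if_neg (by omega), if_neg h1, rootGram_comm hA,
          h.far i j (by omega) hj]
        simp
    · have e2 := h.sq i hj
      simp only [h.gram_self hA hs hj, if_true, show ¬ i = i + 1 by omega,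
        show ¬ i + 1 = i by omega, if_false]
      rw [← mul_assoc, ← pow_two, e2]
      ring
    · by_cases h1 : i = j + 1
      · subst h1
        have := h.edge j (by omega)
        rw [if_neg (by omega), if_pos rfl, if_neg (by omega)]
        linarith
      · rw [if_neg (by omega), if_neg h1, if_neg (by omega),
          h.far j i (by omega) (by omega)]
        simp
  rw [e, Finset.sum_add_distrib, Finset.sum_add_distrib, Finset.sum_ite_eq', Finset.sum_ite_eq',
    if_pos (Finset.mem_range.2 (by omega))]
  have e3 : ∑ i ∈ Finset.range (r + 2), (if i + 1 = j then (-1 : ℤ) else 0)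
      = if j = 0 then 0 else -1 := by
    rcases j with _ | j
    · simp
    · simp only [add_left_inj, Nat.succ_ne_zero, if_false]
      rw [Finset.sum_ite_eq', if_pos (Finset.mem_range.2 (by omega))]
  rw [e3]
  simp only [Finset.mem_range]
  split_ifs <;> omega

lemma RootPath.sum_eq_zero (hA : IsSignedAdj A) (hP : RootClass A P) (hF : P F s)
    (h : RootPath A s F r p c) (hr : 1 ≤ r) {w : V} (hw : w ∈ F)
    (ih : ∀ F' ⊂ F, RootConn A s F' → RootRep A s F') :
    ∑ i ∈ Finset.range (r + 2), c i * rootGram A s w (p i) = 0 := by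
  by_cases hwp : ∀ i ≤ r + 1, w ≠ p i
  · rcases Nat.lt_or_ge r 4 with h4 | h4
    · exact hP.cycle hF h hw hwp hr (by omega)
    · exact h.sum_eq_zero_of_le hA (hP.entries hF) h4 hw hwp ih
  · push Not at hwp
    obtain ⟨j, hj, rfl⟩ := hwp
    exact h.sum_eq_zero_self hA (hP.entries hF) hj

/-- Removing the first vertex of a root path. -/
lemma RootPath.rootRep (hA : IsSignedAdj A) (hP : RootClass A P) (hF : P F s)
    (hconn : RootConn A s F) (h : RootPath A s F r p c) (hr : 1 ≤ r)
    (ih : ∀ F' ⊂ F, RootConn A s F' → RootRep A s F') : RootRep A s F := by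
  have hD := fun w (hw : w ∈ F) => h.sum_eq_zero hA hP hF hr hw ih
  have hpF : ∀ i ≤ r, p (i + 1) ∈ F.erase (p 0) := fun i hi =>
    Finset.mem_erase.2 ⟨(h.inj 0 (i + 1) (by omega) (by omega)).symm, h.mem _ (by omega)⟩
  have hc0 : c 0 * c 0 = 1 := by rw [← pow_two]; exact h.sq 0 (by omega)
  have hu : ∀ w ∈ F, rootGram A s w (p 0) =
      ∑ i ∈ Finset.range (r + 1), -(c 0 * c (i + 1)) * rootGram A s w (p (i + 1)) := by
    intro w hw
    have := hD w hw
    rw [Finset.sum_range_succ'] at this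
    have e : ∑ i ∈ Finset.range (r + 1), -(c 0 * c (i + 1)) * rootGram A s w (p (i + 1))
        = -c 0 * ∑ i ∈ Finset.range (r + 1), c (i + 1) * rootGram A s w (p (i + 1)) := by
      rw [Finset.mul_sum]
      exact Finset.sum_congr rfl fun i _ => by ring
    rw [e]
    linear_combination (-rootGram A s w (p 0)) * hc0 + c 0 * this
  refine RootRep.of_comb hA (u := p 0) (Finset.range (r + 1)) (fun i => p (i + 1))
    (fun i => -(c 0 * c (i + 1))) (fun i hi => hpF i (by simp at hi; omega)) hu ?_
  refine ih _ (Finset.erase_ssubset (h.mem 0 (by omega))) ?_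
  intro Y hY hne hout
  by_contra! hsY
  have hstep : ∀ i ≤ r, p (i + 1) ∉ Y := by
    intro i hi hmem
    have : ∀ k, i + k ≤ r → p (i + k + 1) ∈ Y := by
      intro k
      induction k with
      | zero => exact fun _ => hmem
      | succ k ihk =>
        intro hk
        by_contra hno
        exact h.adj_ne_zero hr (i := i + k + 1) (by omega)
          (hout _ (ihk (by omega)) _ (hpF (i + k + 1) (by omega)) hno)
    have h1 := this (r - i) (by omega)
    rw [show i + (r - i) + 1 = r + 1 by omega] at h1
    exact h.last (hsY _ h1)
  have hF' : Y ⊆ F := hY.trans (Finset.erase_subset _ _)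
  obtain ⟨y, hy, hsy⟩ := hconn Y hF' hne (by
    intro y hy z hz hzY
    by_cases hzu : z = p 0
    · subst hzu
      have hyu : y ≠ p 0 := fun e => hzY (e ▸ hy)
      rw [← rootGram_of_ne (A := A) hyu (Or.inl (hsY y hy)), hu y (hF' hy)]
      refine Finset.sum_eq_zero fun i hi => ?_
      have hi := Finset.mem_range.1 hi
      have hyp : y ≠ p (i + 1) := fun e => hstep i (by omega) (e ▸ hy)
      rw [rootGram_of_ne hyp (Or.inl (hsY y hy)),
        hout y hy _ (hpF i (by omega)) (hstep i (by omega)), mul_zero]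
    · exact hout y hy z (Finset.mem_erase.2 ⟨hzu, hz⟩) hzY)
  exact hsy (hsY y hy)

/-- Splitting along the components of `rootGram`. -/
lemma rootRep_of_split (hA : IsSignedAdj A) (hconn : RootConn A s F) {Y : Finset V} (hY : Y ⊂ F)
    (hne : Y.Nonempty) (h0 : ∀ y ∈ Y, ∀ z ∈ F, z ∉ Y → rootGram A s y z = 0)
    (ih : ∀ F' ⊂ F, RootConn A s F' → RootRep A s F') : RootRep A s F := by
  have hside : ∀ Y' ⊆ F, (∀ y ∈ Y', ∀ z ∈ F, z ∉ Y' → rootGram A s y z = 0) →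
      RootConn A s Y' := by
    intro Y' hY' h0' Z hZ hZne hout
    by_contra! hsZ
    obtain ⟨y, hy, hsy⟩ := hconn Z (hZ.trans hY') hZne (by
      intro y hy z hz hzZ
      by_cases hzY : z ∈ Y'
      · exact hout y hy z hzY hzZ
      · have hyz : y ≠ z := fun e => hzZ (e ▸ hy)
        rw [← rootGram_of_ne (A := A) hyz (Or.inl (hsZ y hy))]
        exact h0' y (hZ hy) z hz hzY)
    exact hsy (hsZ y hy)
  refine RootRep.union hA (ih Y hY (hside Y hY.1 h0)) (ih _ ?_ (hside _ Finset.sdiff_subset ?_)) h0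
  · exact Finset.sdiff_ssubset hY.1 hne
  · intro y hy z hz hzY
    have hy := Finset.mem_sdiff.1 hy
    have : z ∈ Y := by
      by_contra h'
      exact hzY (Finset.mem_sdiff.2 ⟨hz, h'⟩)
    rw [rootGram_comm hA]
    exact h0 z this y hy.1 hy.2

lemma rootRep_of_parallel (hA : IsSignedAdj A) (hP : RootClass A P) (hF : P F s)
    (hconn : RootConn A s F) {u v : V} (hu : u ∈ F) (hv : v ∈ F) (huv : u ≠ v) (hsu : s u ≠ 0)
    (hsv : s v ≠ 0) (h0 : A u v = 0) (ih : ∀ F' ⊂ F, RootConn A s F' → RootRep A s F') :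
    RootRep A s F := by
  have sq1 : ∀ x ∈ F, s x ≠ 0 → s x * s x = 1 := fun x hx h => by
    rcases hP.entries hF x hx with h1 | h1 | h1
    · simp [h1]
    · exact absurd h1 h
    · simp [h1]
  have huF : u ∈ F.erase v := Finset.mem_erase.2 ⟨huv, hu⟩
  have hcomb : ∀ w ∈ F, rootGram A s w v = -(s u * s v) * rootGram A s w u := by
    intro w hw
    by_cases hwu : w = u
    · subst hwu
      rw [rootGram_self hA, sq1 w hu hsu]
      simp [rootGram, huv, h0]
    · by_cases hwv : w = v
      · subst hwv
        rw [rootGram_self hA, sq1 w hv hsv]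
        simp only [rootGram, hwu, if_false, hA.symm w u, h0]
        linear_combination (-(s w * s w)) * sq1 u hu hsu - sq1 w hv hsv
      · rw [hP.parallel hF hv hu hw huv.symm hwv hwu hsv hsu (by rw [hA.symm, h0]),
          mul_comm (s v)]
  refine RootRep.of_comb hA (u := v) {()} (fun _ => u) (fun _ => -(s u * s v))
    (fun _ _ => huF) (fun w hw => by simpa using hcomb w hw) (ih _ (Finset.erase_ssubset hv) ?_)
  intro Y hY hne hout
  by_contra! hsY
  have hF' : Y ⊆ F := hY.trans (Finset.erase_subset _ _)
  obtain ⟨y, hy, hsy⟩ := hconn Y hF' hne (by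
    intro y hy z hz hzY
    by_cases hzv : z = v
    · subst hzv
      have hyz : y ≠ z := fun e => hzY (e ▸ hy)
      have hyu : y ≠ u := fun e => hsu (hsY u (e ▸ hy))
      have huY : u ∉ Y := fun h => hsu (hsY u h)
      rw [← rootGram_of_ne (A := A) hyz (Or.inl (hsY y hy)), hcomb y (hF' hy),
        rootGram_of_ne hyu (Or.inl (hsY y hy)), hout y hy u huF huY, mul_zero]
    · exact hout y hy z (Finset.mem_erase.2 ⟨hzv, hz⟩) hzY)
  exact hsy (hsY y hy)

/-- Rooted signed graphs in a root class whose components all meet the root are represented by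
integer vectors. -/
theorem RootClass.rootRep (hA : IsSignedAdj A) (hP : RootClass A P) (hF : P F s)
    (hconn : RootConn A s F) : RootRep A s F := by
  induction hn : F.card using Nat.strong_induction_on generalizing F s with
  | _ n ihn =>
  have ih : ∀ F' ⊂ F, ∀ s', P F' s' → RootConn A s' F' → RootRep A s' F' :=
    fun F' hF' s' h1 h2 => ihn _ (hn ▸ Finset.card_lt_card hF') h1 h2 rfl
  have ih' : ∀ F' ⊂ F, RootConn A s F' → RootRep A s F' :=
    fun F' hF' h2 => ih F' hF' s (hP.mono hF hF'.1) h2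
  rcases F.eq_empty_or_nonempty with rfl | hne
  · exact ⟨Empty, inferInstance, fun _ _ => 0, by simp⟩
  obtain ⟨u, hu, hsu⟩ := hconn F subset_rfl hne (fun y _ z hz hzF => absurd hz hzF)
  by_cases hone : ∀ x ∈ F, x ≠ u → s x = 0
  · have hpm : s u = -1 ∨ s u = 1 := by
      rcases hP.entries hF u hu with h | h | h
      exacts [Or.inl h, absurd h hsu, Or.inr h]
    have hss := Finset.erase_ssubset hu
    refine RootRep.of_absorb hA hpm hone (ih _ hss _ (hP.absorb hF hu hsu hss.1 (by simp)
      fun x hx => hone x (Finset.mem_of_mem_erase hx) (Finset.ne_of_mem_erase hx)) ?_)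
    intro Y hY hYne hout
    by_contra! hAY
    obtain ⟨y, hy, hsy⟩ := hconn Y (hY.trans hss.1) hYne (by
      intro y hy z hz hzY
      by_cases hzu : z = u
      · subst hzu
        rw [hA.symm]; exact hAY y hy
      · exact hout y hy z (Finset.mem_erase.2 ⟨hzu, hz⟩) hzY)
    have := Finset.mem_erase.1 (hY hy)
    exact hsy (hone y this.2 this.1)
  push Not at hone
  obtain ⟨v, hv, hvu, hsv⟩ := hone
  by_cases hpar : ∃ a ∈ F, ∃ b ∈ F, a ≠ b ∧ s a ≠ 0 ∧ s b ≠ 0 ∧ A a b = 0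
  · obtain ⟨a, ha, b, hb, hab, hsa, hsb, h0⟩ := hpar
    exact rootRep_of_parallel hA hP hF hconn ha hb hab hsa hsb h0 ih'
  push Not at hpar
  have horth : ∀ a ∈ F, ∀ b ∈ F, a ≠ b → s a ≠ 0 → s b ≠ 0 → rootGram A s a b = 0 := by
    intro a ha b hb hab hsa hsb
    have h1 := hP.ne_two hF ha hb hab hsa hsb
    have h2 := hpar a ha b hb hab hsa hsb
    simp only [rootGram, hab, if_false]
    rcases hP.entries hF a ha with ea | ea | ea <;> rcases hP.entries hF b hb with eb | eb | eb <;>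
      rcases hA.entries a b with e | e | e <;> simp_all
  set E : V → V → Prop := fun x y => x ≠ y ∧ rootGram A s x y ≠ 0 with hE
  by_cases hpath : ∃ (m : ℕ) (p : ℕ → V), s (p 0) ≠ 0 ∧ s (p m) ≠ 0 ∧ p 0 ≠ p m ∧
      (∀ i ≤ m, p i ∈ F) ∧ ∀ i < m, E (p i) (p (i + 1))
  · obtain ⟨m, p, h0, hm, hne0, hpF, hpE, hmid, hinj, hfar⟩ :=
      exists_induced_path (S := fun x => s x ≠ 0) (Q := fun x => x ∈ F) (E := E) hpath
    obtain ⟨r, rfl⟩ : ∃ r, m = r + 1 := by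
      rcases m with _ | m
      · exact absurd rfl hne0
      · exact ⟨m, rfl⟩
    have hr : 1 ≤ r := by
      by_contra hr
      obtain rfl : r = 0 := by omega
      exact (hpE 0 (by omega)).2
        (horth _ (hpF 0 (by omega)) _ (hpF 1 (by omega)) hne0 h0 hm)
    have hmid' : ∀ i, 1 ≤ i → i ≤ r → s (p i) = 0 := fun i h1 h2 => by
      by_contra hc
      exact hmid i (by omega) (by omega) hc
    set c : ℕ → ℤ := fun i => Nat.rec 1 (fun i ci => -ci * rootGram A s (p i) (p (i + 1))) i
      with hc
    have hcs : ∀ i, c (i + 1) = -c i * rootGram A s (p i) (p (i + 1)) := fun i => rfl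
    have hsqR : ∀ i ≤ r, rootGram A s (p i) (p (i + 1)) ^ 2 = 1 := by
      intro i hi
      have hEi := hpE i (by omega)
      have : s (p i) = 0 ∨ s (p (i + 1)) = 0 := by
        rcases Nat.eq_zero_or_pos i with rfl | hi0
        · exact Or.inr (hmid' 1 le_rfl hr)
        · exact Or.inl (hmid' i hi0 hi)
      rw [rootGram_of_ne hEi.1 this]
      have h2 := hEi.2
      rw [rootGram_of_ne hEi.1 this] at h2
      rcases hA.entries (p i) (p (i + 1)) with e | e | e
      · simp [e]
      · exact absurd e h2
      · simp [e]
    have hsq : ∀ i ≤ r + 1, c i ^ 2 = 1 := by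
      intro i
      induction i with
      | zero => intro _; rfl
      | succ i ihi =>
        intro hi
        rw [hcs, mul_pow, neg_sq, ihi (by omega), hsqR i (by omega), one_mul]
    refine RootPath.rootRep (p := p) (c := c) (r := r) hA hP hF hconn
      ⟨hpF, hsq, hinj, h0, hm, hmid', fun i hi => ?_, fun i j hij hj => ?_⟩ hr ih'
    · rw [hcs]
      have h1 := hsqR i hi
      have h2 := hsq i (by omega)
      linear_combination (-rootGram A s (p i) (p (i + 1)) ^ 2) * h2 - h1
    · by_contra hne'
      exact hfar i j hij hj ⟨hinj i j (by omega) hj, hne'⟩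
  · set Y := F.filter fun x => ∃ (m : ℕ) (p : ℕ → V), p 0 = u ∧ p m = x ∧ (∀ i ≤ m, p i ∈ F) ∧
      ∀ i < m, E (p i) (p (i + 1)) with hYdef
    have huY : u ∈ Y := Finset.mem_filter.2 ⟨hu, 0, fun _ => u, rfl, rfl, fun _ _ => hu,
      fun i hi => by omega⟩
    have hvY : v ∉ Y := by
      intro hvY
      obtain ⟨-, m, p, h0, hm, hpF, hpE⟩ := Finset.mem_filter.1 hvY
      exact hpath ⟨m, p, by rwa [h0], by rwa [hm], by rw [h0, hm]; exact hvu.symm, hpF, hpE⟩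
    refine rootRep_of_split hA hconn (Y := Y)
      ((Finset.ssubset_iff_of_subset (Finset.filter_subset _ _)).2 ⟨v, hv, hvY⟩) ⟨u, huY⟩ ?_ ih'
    intro y hy z hz hzY
    by_contra hne'
    obtain ⟨-, m, p, h0, hm, hpF, hpE⟩ := Finset.mem_filter.1 hy
    refine hzY (Finset.mem_filter.2 ⟨hz, m + 1, fun i => if i ≤ m then p i else z, ?_, ?_, ?_, ?_⟩)
    · simpa using h0
    · simp
    · intro i _
      dsimp only
      split_ifs with hi
      · exact hpF i hi
      · exact hz
    · intro i hi
      dsimp only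
      by_cases him : i + 1 ≤ m
      · rw [if_pos (by omega), if_pos him]; exact hpE i (by omega)
      · obtain rfl : i = m := by omega
        rw [if_pos le_rfl, if_neg him, hm]
        exact ⟨fun e => hzY (e ▸ hy), hne'⟩

end CoreMain


section LocalAux

/-- The form of a root path with a further vertex, at integer coordinates. -/
def cycle3Form (e f t b0 b1 b2 n0 n1 n2 m : ℤ) : ℤ :=
  201981 * (n0 * n0 + n1 * n1 + n2 * n2 + m * m) +
    200000 * (-(n0 * n1 + n1 * n2) + n0 * n2 * (e * f) +
      m * (n0 * b0 + n1 * b1 + n2 * b2)) -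
    86880 * ((n0 * e + n2 * f + m * t) * (n0 * e + n2 * f + m * t))

lemma cycle3_aux : ∀ e ∈ [(-1 : ℤ), 1], ∀ f ∈ [(-1 : ℤ), 1], ∀ t ∈ [(-1 : ℤ), 0, 1],
    ∀ b0 ∈ [(-1 : ℤ), 0, 1], ∀ b1 ∈ [(-1 : ℤ), 0, 1], ∀ b2 ∈ [(-1 : ℤ), 0, 1],
    b0 + b1 + b2 = t * (e + f) ∨
    cycle3Form e f t b0 b1 b2 5 6 5 3 < 0 ∨
    cycle3Form e f t b0 b1 b2 5 6 5 (-3) < 0 ∨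
    cycle3Form e f t b0 b1 b2 7 5 7 5 < 0 ∨
    cycle3Form e f t b0 b1 b2 7 5 7 (-5) < 0 ∨
    cycle3Form e f t b0 b1 b2 8 6 4 4 < 0 ∨
    cycle3Form e f t b0 b1 b2 5 4 3 (-3) < 0 ∨
    cycle3Form e f t b0 b1 b2 2 3 4 (-2) < 0 ∨
    cycle3Form e f t b0 b1 b2 4 5 6 3 < 0 := by
  decide +kernel

/-- The form of a root path with a further vertex, at integer coordinates. -/
def cycle4Form (e f t b0 b1 b2 b3 n0 n1 n2 n3 m : ℤ) : ℤ :=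
  201981 * (n0 * n0 + n1 * n1 + n2 * n2 + n3 * n3 + m * m) +
    200000 * (-(n0 * n1 + n1 * n2 + n2 * n3) + n0 * n3 * (e * f) +
      m * (n0 * b0 + n1 * b1 + n2 * b2 + n3 * b3)) -
    86880 * ((n0 * e + n3 * f + m * t) * (n0 * e + n3 * f + m * t))

lemma cycle4_aux : ∀ e ∈ [(-1 : ℤ), 1], ∀ f ∈ [(-1 : ℤ), 1], ∀ t ∈ [(-1 : ℤ), 0, 1],
    ∀ b0 ∈ [(-1 : ℤ), 0, 1], ∀ b1 ∈ [(-1 : ℤ), 0, 1], ∀ b2 ∈ [(-1 : ℤ), 0, 1],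
        ∀ b3 ∈ [(-1 : ℤ), 0, 1],
    b0 + b1 + b2 + b3 = t * (e + f) ∨
    cycle4Form e f t b0 b1 b2 b3 4 4 5 4 2 < 0 ∨
    cycle4Form e f t b0 b1 b2 b3 3 3 4 3 (-2) < 0 ∨
    cycle4Form e f t b0 b1 b2 b3 8 6 5 5 (-4) < 0 ∨
    cycle4Form e f t b0 b1 b2 b3 4 3 3 4 3 < 0 ∨
    cycle4Form e f t b0 b1 b2 b3 3 4 4 6 (-3) < 0 ∨
    cycle4Form e f t b0 b1 b2 b3 3 4 3 3 2 < 0 ∨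
    cycle4Form e f t b0 b1 b2 b3 2 2 3 4 2 < 0 ∨
    cycle4Form e f t b0 b1 b2 b3 6 4 4 3 3 < 0 ∨
    cycle4Form e f t b0 b1 b2 b3 6 4 4 6 (-5) < 0 ∨
    cycle4Form e f t b0 b1 b2 b3 3 4 3 3 (-2) < 0 ∨
    cycle4Form e f t b0 b1 b2 b3 4 5 8 7 6 < 0 := by
  decide +kernel

/-- The form of a root path with a further vertex, at integer coordinates. -/
def cycle5Form (e f t b0 b1 b2 b3 b4 n0 n1 n2 n3 n4 m : ℤ) : ℤ :=
  201981 * (n0 * n0 + n1 * n1 + n2 * n2 + n3 * n3 + n4 * n4 + m * m) +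
    200000 * (-(n0 * n1 + n1 * n2 + n2 * n3 + n3 * n4) + n0 * n4 * (e * f) +
      m * (n0 * b0 + n1 * b1 + n2 * b2 + n3 * b3 + n4 * b4)) -
    86880 * ((n0 * e + n4 * f + m * t) * (n0 * e + n4 * f + m * t))

lemma cycle5_aux : ∀ e ∈ [(-1 : ℤ), 1], ∀ f ∈ [(-1 : ℤ), 1], ∀ t ∈ [(-1 : ℤ), 0, 1],
    ∀ b0 ∈ [(-1 : ℤ), 0, 1], ∀ b1 ∈ [(-1 : ℤ), 0, 1], ∀ b2 ∈ [(-1 : ℤ), 0, 1],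
        ∀ b3 ∈ [(-1 : ℤ), 0, 1], ∀ b4 ∈ [(-1 : ℤ), 0, 1],
    b0 + b1 + b2 + b3 + b4 = t * (e + f) ∨
    cycle5Form e f t b0 b1 b2 b3 b4 3 3 4 3 3 2 < 0 ∨
    cycle5Form e f t b0 b1 b2 b3 b4 3 3 4 3 3 (-2) < 0 ∨
    cycle5Form e f t b0 b1 b2 b3 b4 3 3 2 3 3 (-2) < 0 ∨
    cycle5Form e f t b0 b1 b2 b3 b4 3 3 2 3 3 2 < 0 ∨
    cycle5Form e f t b0 b1 b2 b3 b4 7 6 2 (-1) (-5) (-6) < 0 ∨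
    cycle5Form e f t b0 b1 b2 b3 b4 5 1 (-2) (-6) (-7) 6 < 0 ∨
    cycle5Form e f t b0 b1 b2 b3 b4 6 4 4 4 6 (-5) < 0 ∨
    cycle5Form e f t b0 b1 b2 b3 b4 3 4 3 3 2 2 < 0 ∨
    cycle5Form e f t b0 b1 b2 b3 b4 2 2 2 3 4 2 < 0 ∨
    cycle5Form e f t b0 b1 b2 b3 b4 3 3 4 5 4 2 < 0 ∨
    cycle5Form e f t b0 b1 b2 b3 b4 3 4 3 2 2 (-2) < 0 ∨
    cycle5Form e f t b0 b1 b2 b3 b4 4 3 2 2 2 2 < 0 ∨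
    cycle5Form e f t b0 b1 b2 b3 b4 5 5 6 8 7 (-4) < 0 ∨
    cycle5Form e f t b0 b1 b2 b3 b4 3 4 3 1 3 3 < 0 ∨
    cycle5Form e f t b0 b1 b2 b3 b4 7 5 4 2 1 (-3) < 0 ∨
    cycle5Form e f t b0 b1 b2 b3 b4 3 3 3 4 6 (-3) < 0 := by
  decide +kernel

lemma parallel_aux {t a b : ℤ} (ht : t = -1 ∨ t = 0 ∨ t = 1) (ha : -1 ≤ a ∧ a ≤ 1)
    (hb : -1 ≤ b ∧ b ≤ 1) (htight : t = 0 → a * b = 0 → a = 0 ∧ b = 0)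
    (h : ∀ n0 n1 m : ℤ, 86880 * ((n0 + n1 + m * t) * (n0 + n1 + m * t)) ≤
      201981 * (n0 * n0 + n1 * n1 + m * m) + 200000 * (m * (n0 * a + n1 * b))) :
    a + b = 2 * t := by
  have g0 := h 1 1 1
  have g1 := h 1 1 (-1)
  have g2 := h 3 4 4
  have g3 := h 3 4 (-4)
  have g4 := h 4 3 4
  have g5 := h 4 3 (-4)
  have g6 := h 2 3 2
  have g7 := h 2 3 (-2)
  have g8 := h 3 2 2
  have g9 := h 3 2 (-2)
  clear h
  rcases ht with rfl | rfl | rfl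
  · omega
  · obtain ⟨ha1, ha2⟩ := ha
    obtain ⟨hb1, hb2⟩ := hb
    interval_cases a <;> interval_cases b <;> simp_all
  · omega

end LocalAux


section LocalClass

variable {V : Type*} [Fintype V] {A : V → V → ℤ} {s : V → ℤ} {F : Finset V} {lam kap : ℝ}

/-- The inequalities on the eigenvalue bound and on the root weight under which `rootGram` is
governed by vectors of norm at most two. -/
structure RootBound (lam kap : ℝ) : Prop where
  two_le : 2 ≤ lam
  lam_le : lam ≤ 201981 / 100000
  le_kap : 86880 / 100000 ≤ kap
  kap_le : kap ≤ 1
  unstable : kap * (lam - kap) < 1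
  tight : 1 < kap * (1 / lam + lam / (lam ^ 2 - 1))

lemma RootGood.comb (hb : RootBound lam kap) (h : RootGood A lam kap F s) {n : ℕ} (v : Fin n → V)
    (hv : ∀ i, v i ∈ F) (hinj : Function.Injective v) (c : Fin n → ℤ) :
    86880 * ((∑ i, s (v i) * c i) * (∑ i, s (v i) * c i)) ≤
      201981 * ∑ i, c i * c i + 100000 * ∑ i, ∑ j, c j * (c i * A (v i) (v j)) := by
  have h1 := (h.mono_param hb.lam_le hb.le_kap).apply_comb v (fun i => (c i : ℝ)) hv
  have e : ∑ i, ∑ j, (c j : ℝ) * (c i * ((if v i = v j then (201981 / 100000 : ℝ) else 0)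
      + A (v i) (v j))) = 201981 / 100000 * ∑ i, (c i : ℝ) * c i
      + ∑ i, ∑ j, (c j : ℝ) * (c i * A (v i) (v j)) := by
    simp only [mul_add, Finset.sum_add_distrib, hinj.eq_iff, mul_ite, mul_zero,
      Finset.sum_ite_eq, Finset.mem_univ, if_true]
    rw [Finset.mul_sum]
    congr 1
    exact Finset.sum_congr rfl fun i _ => by ring
  rw [e] at h1
  have h2 : (86880 : ℝ) * ((∑ i, (s (v i) : ℝ) * c i) * (∑ i, (s (v i) : ℝ) * c i)) ≤
      201981 * ∑ i, (c i : ℝ) * c i + 100000 * ∑ i, ∑ j, (c j : ℝ) * (c i * A (v i) (v j)) := by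
    nlinarith
  exact_mod_cast h2

lemma RootGood.ne_two (hA : IsSignedAdj A) (hb : RootBound lam kap) {u v : V}
    (h : RootGood A lam kap {u, v} s) (huv : u ≠ v) (hsu : s u = -1 ∨ s u = 1)
    (hsv : s v = -1 ∨ s v = 1) : A u v ≠ -(s u * s v) := by
  intro he
  have h1 := h.comb hb ![u, v] (by intro i; fin_cases i <;> simp)
    (by intro i j hij; fin_cases i <;> fin_cases j <;> simp_all [eq_comm]) ![s u, s v]
  simp [Fin.sum_univ_succ, hA.diag, hA.symm v u, he] at h1
  rcases hsu with e1 | e1 <;> rcases hsv with e2 | e2 <;> rw [e1, e2] at h1 <;> norm_num at h1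

lemma RootGood.not_tight (hA : IsSignedAdj A) (hb : RootBound lam kap) {u v w : V}
    (h : RootGood A lam kap {u, v, w} s) (huv : u ≠ v) (hwu : w ≠ u) (hwv : w ≠ v)
    (hsu : s u = -1 ∨ s u = 1) (hsv : s v = -1 ∨ s v = 1) (hsw : s w = 0) (h0 : A u v = 0)
    (hwu0 : A w u ≠ 0) (hwv0 : A w v = 0) : False := by
  have hl := hb.two_le
  have hl0 : lam ≠ 0 := by linarith
  have hl1 : lam ^ 2 - 1 ≠ 0 := by nlinarith
  have hpos : 0 < lam ^ 2 - 1 := by nlinarith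
  have h1 := h.apply_comb ![u, v, w] ![lam / (lam ^ 2 - 1) * s u, 1 / lam * s v,
    -(1 / (lam ^ 2 - 1)) * A w u * s u] (by intro i; fin_cases i <;> simp)
  have hu2 : (s u : ℝ) * s u = 1 := by rcases hsu with e | e <;> simp [e]
  have hv2 : (s v : ℝ) * s v = 1 := by rcases hsv with e | e <;> simp [e]
  have hw2 : (A w u : ℝ) * A w u = 1 := by
    rcases hA.entries w u with e | e | e
    · simp [e]
    · exact absurd e hwu0
    · simp [e]
  simp [Fin.sum_univ_succ, hA.diag, hA.symm v u, hA.symm u w, hA.symm v w, h0, hwv0, hsw, huv,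
    huv.symm, hwu, hwu.symm, hwv, hwv.symm] at h1
  set g : ℝ := 1 / lam + lam / (lam ^ 2 - 1) with hg
  have hg0 : 0 < g := by positivity
  have e1 : (s u : ℝ) * (lam / (lam ^ 2 - 1) * s u) + s v * (lam⁻¹ * s v) = g := by
    rw [hg]
    linear_combination (lam / (lam ^ 2 - 1)) * hu2 + lam⁻¹ * hv2 + (by simp : lam⁻¹ - 1 / lam = 0)
  rw [e1] at h1
  have e2 : g * g < kap * g ^ 2 * g := by
    have := hb.tight
    have h3 : 0 < g * g := by positivity
    nlinarith
  have e3 : kap * g ^ 2 ≤ g := by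
    refine h1.trans (le_of_eq ?_)
    rw [hg]
    have ha : (s u : ℝ) ^ 2 = 1 := by rw [pow_two, hu2]
    have hb' : (s v : ℝ) ^ 2 = 1 := by rw [pow_two, hv2]
    have hc : (A w u : ℝ) ^ 2 = 1 := by rw [pow_two, hw2]
    field_simp
    ring_nf
    simp only [ha, hb', hc]
    ring
  nlinarith


lemma RootGood.parallel (hA : IsSignedAdj A) (hb : RootBound lam kap) {u v w : V}
    (h : RootGood A lam kap {u, v, w} s) (huv : u ≠ v) (hwu : w ≠ u) (hwv : w ≠ v)
    (hsu : s u = -1 ∨ s u = 1) (hsv : s v = -1 ∨ s v = 1)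
    (hsw : s w = -1 ∨ s w = 0 ∨ s w = 1) (h0 : A u v = 0) :
    rootGram A s w u = -(s u * s v) * rootGram A s w v := by
  have hu2 : s u * s u = 1 := by rcases hsu with e | e <;> simp [e]
  have hv2 : s v * s v = 1 := by rcases hsv with e | e <;> simp [e]
  have hbd : ∀ x y z, (s x = -1 ∨ s x = 1) → -1 ≤ s x * A y z ∧ s x * A y z ≤ 1 := by
    intro x y z hx
    rcases hx with e | e <;> rcases hA.entries y z with e' | e' | e' <;> simp [e, e']
  have key := parallel_aux hsw (hbd u w u hsu) (hbd v w v hsv) (by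
    intro hw0 hprod
    have hprod : A w u = 0 ∨ A w v = 0 := by
      rcases mul_eq_zero.1 hprod with h' | h' <;> rcases mul_eq_zero.1 h' with h' | h'
      · simp [h'] at hu2
      · exact Or.inl h'
      · simp [h'] at hv2
      · exact Or.inr h'
    by_cases hu0 : A w u = 0
    · by_cases hv0 : A w v = 0
      · simp [hu0, hv0]
      · refine (RootGood.not_tight hA hb (h.mono ?_) huv.symm hwv hwu hsv hsu hw0
          (by rw [hA.symm, h0]) hv0 hu0).elim
        intro x; simp only [Finset.mem_insert, Finset.mem_singleton]; tauto
    · have hv0 := hprod.resolve_left hu0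
      exact (RootGood.not_tight hA hb h huv hwu hwv hsu hsv hw0 h0 hu0 hv0).elim) (by
    intro n0 n1 m
    have h1 := h.comb hb ![u, v, w] (by intro i; fin_cases i <;> simp)
      (by intro i j hij; fin_cases i <;> fin_cases j <;> simp_all [eq_comm])
      ![n0 * s u, n1 * s v, m]
    simp [Fin.sum_univ_succ, hA.diag, hA.symm v u, hA.symm u w, hA.symm v w, h0] at h1
    have e : s u * (n0 * s u) + (s v * (n1 * s v) + s w * m) = n0 + n1 + m * s w := by
      linear_combination n0 * hu2 + n1 * hv2
    rw [e] at h1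
    linear_combination h1 + 201981 * n0 ^ 2 * hu2 + 201981 * n1 ^ 2 * hv2)
  simp only [rootGram, hwu, hwv, if_false]
  linear_combination s u * key - (A w u) * hu2 - s w * s u * hv2 

lemma RootGood.cycle3 (hA : IsSignedAdj A) (hb : RootBound lam kap) {p : ℕ → V} {c : ℕ → ℤ}
    {w : V} (hs : ∀ x ∈ F, s x = -1 ∨ s x = 0 ∨ s x = 1) (hp : RootPath A s F 1 p c)
    (hw : w ∈ F) (hwp : ∀ i ≤ 2, w ≠ p i)
    (h : RootGood A lam kap {p 0, p 1, p 2, w} s) :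
    ∑ i ∈ Finset.range 3, c i * rootGram A s w (p i) = 0 := by
  have q0 : c 0 * c 0 = 1 := by rw [← pow_two]; exact hp.sq 0 (by norm_num)
  have q1 : c 1 * c 1 = 1 := by rw [← pow_two]; exact hp.sq 1 (by norm_num)
  have q2 : c 2 * c 2 = 1 := by rw [← pow_two]; exact hp.sq 2 (by norm_num)
  have z1 : s (p 1) = 0 := hp.mid 1 (by norm_num) (by norm_num)
  have d0 : c 0 * c 1 * A (p 0) (p 1) = -1 := by
    rw [← rootGram_of_ne (A := A) (hp.inj 0 1 (by norm_num) (by norm_num)) (Or.inr z1)]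
    exact hp.edge 0 (by norm_num)
  have d1 : c 1 * c 2 * A (p 1) (p 2) = -1 := by
    rw [← rootGram_of_ne (A := A) (hp.inj 1 2 (by norm_num) (by norm_num)) (Or.inl z1)]
    exact hp.edge 1 (by norm_num)
  have ae : A (p 0) (p 2) = s (p 0) * s (p 2) := by
    have := hp.far 0 2 (by norm_num) (by norm_num)
    simp only [rootGram, (hp.inj 0 2 (by norm_num) (by norm_num)), if_false] at this
    linarith
  have hpm : ∀ i ≤ 2, c i = -1 ∨ c i = 1 := fun i hi => by
    have := hp.sq i hi
    exact (mul_self_eq_one_iff.1 (by rwa [← pow_two])).symm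
  have hsp : ∀ i ≤ 2, s (p i) ≠ 0 → c i * s (p i) ∈ [(-1 : ℤ), 1] := fun i hi h0 => by
    rcases hpm i hi with e | e <;> rcases hs _ (hp.mem i hi) with e' | e' | e' <;>
      simp_all
  have hcA : ∀ i ≤ 2, c i * A w (p i) ∈ [(-1 : ℤ), 0, 1] := fun i hi => by
    rcases hpm i hi with e | e <;> rcases hA.entries w (p i) with e' | e' | e' <;> simp [e, e']
  have key : ∀ n0 n1 n2 m : ℤ, 0 ≤ cycle3Form (c 0 * s (p 0)) (c 2 * s (p 2)) (s w)
      (c 0 * A w (p 0)) (c 1 * A w (p 1)) (c 2 * A w (p 2)) n0 n1 n2 m := by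
    intro n0 n1 n2 m
    have h1 := h.comb hb ![p 0, p 1, p 2, w] (by intro i; fin_cases i <;> simp) (by
      rw [← List.nodup_ofFn]
      have k01 := hp.inj 0 1 (by norm_num) (by norm_num)
      have k02 := hp.inj 0 2 (by norm_num) (by norm_num)
      have k12 := hp.inj 1 2 (by norm_num) (by norm_num)
      have k0 := hwp 0 (by norm_num)
      have k1 := hwp 1 (by norm_num)
      have k2 := hwp 2 (by norm_num)
      simp [List.ofFn_succ, k01, k02, k12, k0.symm, k1.symm, k2.symm])
      ![n0 * c 0, n1 * c 1, n2 * c 2, m]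
    simp [Fin.sum_univ_succ, hA.diag, hA.symm (p 1) (p 0), hA.symm (p 2) (p 0),
        hA.symm (p 2) (p 1), hA.symm (p 0) w, hA.symm (p 1) w, hA.symm (p 2) w, ae, z1] at h1
    rw [cycle3Form]
    linear_combination h1 + 201981 * n0 ^ 2 * q0 + 201981 * n1 ^ 2 * q1 + 201981 * n2 ^ 2 * q2 +
        200000 * n0 * n1 * d0 + 200000 * n1 * n2 * d1
  have hsw := hs w hw
  have hcase := cycle3_aux _ (hsp 0 (by norm_num) hp.first) _ (hsp 2 le_rfl hp.last) (s w) (by simpa using hsw)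
    _ (hcA 0 (by norm_num)) _ (hcA 1 (by norm_num)) _ (hcA 2 (by norm_num))
  have hsum : c 0 * A w (p 0) + c 1 * A w (p 1) + c 2 * A w (p 2) =
      s w * (c 0 * s (p 0) + c 2 * s (p 2)) := by
    rcases hcase with h' | h'
    · exact h'
    · exfalso
      simp only [not_lt.2 (key _ _ _ _), or_self] at h'
  have hg : ∀ i ≤ 2, rootGram A s w (p i) = A w (p i) - s w * s (p i) := fun i hi => by
    simp [rootGram, hwp i hi]
  simp only [Finset.sum_range_succ, Finset.sum_range_zero, zero_add]
  rw [hg 0 (by norm_num), hg 1 (by norm_num), hg 2 (by norm_num), z1]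
  linear_combination hsum

lemma RootGood.cycle4 (hA : IsSignedAdj A) (hb : RootBound lam kap) {p : ℕ → V} {c : ℕ → ℤ}
    {w : V} (hs : ∀ x ∈ F, s x = -1 ∨ s x = 0 ∨ s x = 1) (hp : RootPath A s F 2 p c)
    (hw : w ∈ F) (hwp : ∀ i ≤ 3, w ≠ p i)
    (h : RootGood A lam kap {p 0, p 1, p 2, p 3, w} s) :
    ∑ i ∈ Finset.range 4, c i * rootGram A s w (p i) = 0 := by
  have q0 : c 0 * c 0 = 1 := by rw [← pow_two]; exact hp.sq 0 (by norm_num)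
  have q1 : c 1 * c 1 = 1 := by rw [← pow_two]; exact hp.sq 1 (by norm_num)
  have q2 : c 2 * c 2 = 1 := by rw [← pow_two]; exact hp.sq 2 (by norm_num)
  have q3 : c 3 * c 3 = 1 := by rw [← pow_two]; exact hp.sq 3 (by norm_num)
  have z1 : s (p 1) = 0 := hp.mid 1 (by norm_num) (by norm_num)
  have z2 : s (p 2) = 0 := hp.mid 2 (by norm_num) (by norm_num)
  have d0 : c 0 * c 1 * A (p 0) (p 1) = -1 := by
    rw [← rootGram_of_ne (A := A) (hp.inj 0 1 (by norm_num) (by norm_num)) (Or.inr z1)]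
    exact hp.edge 0 (by norm_num)
  have d1 : c 1 * c 2 * A (p 1) (p 2) = -1 := by
    rw [← rootGram_of_ne (A := A) (hp.inj 1 2 (by norm_num) (by norm_num)) (Or.inr z2)]
    exact hp.edge 1 (by norm_num)
  have d2 : c 2 * c 3 * A (p 2) (p 3) = -1 := by
    rw [← rootGram_of_ne (A := A) (hp.inj 2 3 (by norm_num) (by norm_num)) (Or.inl z2)]
    exact hp.edge 2 (by norm_num)
  have a02 : A (p 0) (p 2) = 0 := by
    rw [← rootGram_of_ne (A := A) (hp.inj 0 2 (by norm_num) (by norm_num)) (Or.inr z2)]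
    exact hp.far 0 2 (by norm_num) (by norm_num)
  have a13 : A (p 1) (p 3) = 0 := by
    rw [← rootGram_of_ne (A := A) (hp.inj 1 3 (by norm_num) (by norm_num)) (Or.inl z1)]
    exact hp.far 1 3 (by norm_num) (by norm_num)
  have ae : A (p 0) (p 3) = s (p 0) * s (p 3) := by
    have := hp.far 0 3 (by norm_num) (by norm_num)
    simp only [rootGram, (hp.inj 0 3 (by norm_num) (by norm_num)), if_false] at this
    linarith
  have hpm : ∀ i ≤ 3, c i = -1 ∨ c i = 1 := fun i hi => by
    have := hp.sq i hi
    exact (mul_self_eq_one_iff.1 (by rwa [← pow_two])).symm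
  have hsp : ∀ i ≤ 3, s (p i) ≠ 0 → c i * s (p i) ∈ [(-1 : ℤ), 1] := fun i hi h0 => by
    rcases hpm i hi with e | e <;> rcases hs _ (hp.mem i hi) with e' | e' | e' <;>
      simp_all
  have hcA : ∀ i ≤ 3, c i * A w (p i) ∈ [(-1 : ℤ), 0, 1] := fun i hi => by
    rcases hpm i hi with e | e <;> rcases hA.entries w (p i) with e' | e' | e' <;> simp [e, e']
  have key : ∀ n0 n1 n2 n3 m : ℤ, 0 ≤ cycle4Form (c 0 * s (p 0)) (c 3 * s (p 3)) (s w)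
      (c 0 * A w (p 0)) (c 1 * A w (p 1)) (c 2 * A w (p 2)) (c 3 * A w (p 3)) n0 n1 n2 n3 m := by
    intro n0 n1 n2 n3 m
    have h1 := h.comb hb ![p 0, p 1, p 2, p 3, w] (by intro i; fin_cases i <;> simp) (by
      rw [← List.nodup_ofFn]
      have k01 := hp.inj 0 1 (by norm_num) (by norm_num)
      have k02 := hp.inj 0 2 (by norm_num) (by norm_num)
      have k03 := hp.inj 0 3 (by norm_num) (by norm_num)
      have k12 := hp.inj 1 2 (by norm_num) (by norm_num)
      have k13 := hp.inj 1 3 (by norm_num) (by norm_num)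
      have k23 := hp.inj 2 3 (by norm_num) (by norm_num)
      have k0 := hwp 0 (by norm_num)
      have k1 := hwp 1 (by norm_num)
      have k2 := hwp 2 (by norm_num)
      have k3 := hwp 3 (by norm_num)
      simp [List.ofFn_succ, k01, k02, k03, k12, k13, k23, k0.symm, k1.symm, k2.symm, k3.symm])
      ![n0 * c 0, n1 * c 1, n2 * c 2, n3 * c 3, m]
    simp [Fin.sum_univ_succ, hA.diag, hA.symm (p 1) (p 0), hA.symm (p 2) (p 0),
        hA.symm (p 3) (p 0), hA.symm (p 2) (p 1), hA.symm (p 3) (p 1), hA.symm (p 3) (p 2),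
        hA.symm (p 0) w, hA.symm (p 1) w, hA.symm (p 2) w, hA.symm (p 3) w, a02, a13, ae, z1,
        z2] at h1
    rw [cycle4Form]
    linear_combination h1 + 201981 * n0 ^ 2 * q0 + 201981 * n1 ^ 2 * q1 + 201981 * n2 ^ 2 * q2 +
        201981 * n3 ^ 2 * q3 + 200000 * n0 * n1 * d0 + 200000 * n1 * n2 * d1 + 200000 * n2 * n3 * d2
  have hsw := hs w hw
  have hcase := cycle4_aux _ (hsp 0 (by norm_num) hp.first) _ (hsp 3 le_rfl hp.last) (s w) (by simpa using hsw)
    _ (hcA 0 (by norm_num)) _ (hcA 1 (by norm_num)) _ (hcA 2 (by norm_num)) _ (hcA 3 (by norm_num))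
  have hsum : c 0 * A w (p 0) + c 1 * A w (p 1) + c 2 * A w (p 2) + c 3 * A w (p 3) =
      s w * (c 0 * s (p 0) + c 3 * s (p 3)) := by
    rcases hcase with h' | h'
    · exact h'
    · exfalso
      simp only [not_lt.2 (key _ _ _ _ _), or_self] at h'
  have hg : ∀ i ≤ 3, rootGram A s w (p i) = A w (p i) - s w * s (p i) := fun i hi => by
    simp [rootGram, hwp i hi]
  simp only [Finset.sum_range_succ, Finset.sum_range_zero, zero_add]
  rw [hg 0 (by norm_num), hg 1 (by norm_num), hg 2 (by norm_num), hg 3 (by norm_num), z1, z2]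
  linear_combination hsum

lemma RootGood.cycle5 (hA : IsSignedAdj A) (hb : RootBound lam kap) {p : ℕ → V} {c : ℕ → ℤ}
    {w : V} (hs : ∀ x ∈ F, s x = -1 ∨ s x = 0 ∨ s x = 1) (hp : RootPath A s F 3 p c)
    (hw : w ∈ F) (hwp : ∀ i ≤ 4, w ≠ p i)
    (h : RootGood A lam kap {p 0, p 1, p 2, p 3, p 4, w} s) :
    ∑ i ∈ Finset.range 5, c i * rootGram A s w (p i) = 0 := by
  have q0 : c 0 * c 0 = 1 := by rw [← pow_two]; exact hp.sq 0 (by norm_num)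
  have q1 : c 1 * c 1 = 1 := by rw [← pow_two]; exact hp.sq 1 (by norm_num)
  have q2 : c 2 * c 2 = 1 := by rw [← pow_two]; exact hp.sq 2 (by norm_num)
  have q3 : c 3 * c 3 = 1 := by rw [← pow_two]; exact hp.sq 3 (by norm_num)
  have q4 : c 4 * c 4 = 1 := by rw [← pow_two]; exact hp.sq 4 (by norm_num)
  have z1 : s (p 1) = 0 := hp.mid 1 (by norm_num) (by norm_num)
  have z2 : s (p 2) = 0 := hp.mid 2 (by norm_num) (by norm_num)
  have z3 : s (p 3) = 0 := hp.mid 3 (by norm_num) (by norm_num)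
  have d0 : c 0 * c 1 * A (p 0) (p 1) = -1 := by
    rw [← rootGram_of_ne (A := A) (hp.inj 0 1 (by norm_num) (by norm_num)) (Or.inr z1)]
    exact hp.edge 0 (by norm_num)
  have d1 : c 1 * c 2 * A (p 1) (p 2) = -1 := by
    rw [← rootGram_of_ne (A := A) (hp.inj 1 2 (by norm_num) (by norm_num)) (Or.inr z2)]
    exact hp.edge 1 (by norm_num)
  have d2 : c 2 * c 3 * A (p 2) (p 3) = -1 := by
    rw [← rootGram_of_ne (A := A) (hp.inj 2 3 (by norm_num) (by norm_num)) (Or.inr z3)]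
    exact hp.edge 2 (by norm_num)
  have d3 : c 3 * c 4 * A (p 3) (p 4) = -1 := by
    rw [← rootGram_of_ne (A := A) (hp.inj 3 4 (by norm_num) (by norm_num)) (Or.inl z3)]
    exact hp.edge 3 (by norm_num)
  have a02 : A (p 0) (p 2) = 0 := by
    rw [← rootGram_of_ne (A := A) (hp.inj 0 2 (by norm_num) (by norm_num)) (Or.inr z2)]
    exact hp.far 0 2 (by norm_num) (by norm_num)
  have a03 : A (p 0) (p 3) = 0 := by
    rw [← rootGram_of_ne (A := A) (hp.inj 0 3 (by norm_num) (by norm_num)) (Or.inr z3)]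
    exact hp.far 0 3 (by norm_num) (by norm_num)
  have a13 : A (p 1) (p 3) = 0 := by
    rw [← rootGram_of_ne (A := A) (hp.inj 1 3 (by norm_num) (by norm_num)) (Or.inl z1)]
    exact hp.far 1 3 (by norm_num) (by norm_num)
  have a14 : A (p 1) (p 4) = 0 := by
    rw [← rootGram_of_ne (A := A) (hp.inj 1 4 (by norm_num) (by norm_num)) (Or.inl z1)]
    exact hp.far 1 4 (by norm_num) (by norm_num)
  have a24 : A (p 2) (p 4) = 0 := by
    rw [← rootGram_of_ne (A := A) (hp.inj 2 4 (by norm_num) (by norm_num)) (Or.inl z2)]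
    exact hp.far 2 4 (by norm_num) (by norm_num)
  have ae : A (p 0) (p 4) = s (p 0) * s (p 4) := by
    have := hp.far 0 4 (by norm_num) (by norm_num)
    simp only [rootGram, (hp.inj 0 4 (by norm_num) (by norm_num)), if_false] at this
    linarith
  have hpm : ∀ i ≤ 4, c i = -1 ∨ c i = 1 := fun i hi => by
    have := hp.sq i hi
    exact (mul_self_eq_one_iff.1 (by rwa [← pow_two])).symm
  have hsp : ∀ i ≤ 4, s (p i) ≠ 0 → c i * s (p i) ∈ [(-1 : ℤ), 1] := fun i hi h0 => by
    rcases hpm i hi with e | e <;> rcases hs _ (hp.mem i hi) with e' | e' | e' <;>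
      simp_all
  have hcA : ∀ i ≤ 4, c i * A w (p i) ∈ [(-1 : ℤ), 0, 1] := fun i hi => by
    rcases hpm i hi with e | e <;> rcases hA.entries w (p i) with e' | e' | e' <;> simp [e, e']
  have key : ∀ n0 n1 n2 n3 n4 m : ℤ, 0 ≤ cycle5Form (c 0 * s (p 0)) (c 4 * s (p 4)) (s w)
      (c 0 * A w (p 0)) (c 1 * A w (p 1)) (c 2 * A w (p 2)) (c 3 * A w (p 3)) (c 4 * A w (p 4)) n0 n1 n2 n3 n4 m := by
    intro n0 n1 n2 n3 n4 m
    have h1 := h.comb hb ![p 0, p 1, p 2, p 3, p 4, w] (by intro i; fin_cases i <;> simp) (by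
      rw [← List.nodup_ofFn]
      have k01 := hp.inj 0 1 (by norm_num) (by norm_num)
      have k02 := hp.inj 0 2 (by norm_num) (by norm_num)
      have k03 := hp.inj 0 3 (by norm_num) (by norm_num)
      have k04 := hp.inj 0 4 (by norm_num) (by norm_num)
      have k12 := hp.inj 1 2 (by norm_num) (by norm_num)
      have k13 := hp.inj 1 3 (by norm_num) (by norm_num)
      have k14 := hp.inj 1 4 (by norm_num) (by norm_num)
      have k23 := hp.inj 2 3 (by norm_num) (by norm_num)
      have k24 := hp.inj 2 4 (by norm_num) (by norm_num)
      have k34 := hp.inj 3 4 (by norm_num) (by norm_num)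
      have k0 := hwp 0 (by norm_num)
      have k1 := hwp 1 (by norm_num)
      have k2 := hwp 2 (by norm_num)
      have k3 := hwp 3 (by norm_num)
      have k4 := hwp 4 (by norm_num)
      simp [List.ofFn_succ, k01, k02, k03, k04, k12, k13, k14, k23, k24, k34, k0.symm, k1.symm,
          k2.symm, k3.symm, k4.symm])
      ![n0 * c 0, n1 * c 1, n2 * c 2, n3 * c 3, n4 * c 4, m]
    simp [Fin.sum_univ_succ, hA.diag, hA.symm (p 1) (p 0), hA.symm (p 2) (p 0),
        hA.symm (p 3) (p 0), hA.symm (p 4) (p 0), hA.symm (p 2) (p 1), hA.symm (p 3) (p 1),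
        hA.symm (p 4) (p 1), hA.symm (p 3) (p 2), hA.symm (p 4) (p 2), hA.symm (p 4) (p 3),
        hA.symm (p 0) w, hA.symm (p 1) w, hA.symm (p 2) w, hA.symm (p 3) w, hA.symm (p 4) w, a02,
        a03, a13, a14, a24, ae, z1, z2, z3] at h1
    rw [cycle5Form]
    linear_combination h1 + 201981 * n0 ^ 2 * q0 + 201981 * n1 ^ 2 * q1 + 201981 * n2 ^ 2 * q2 +
        201981 * n3 ^ 2 * q3 + 201981 * n4 ^ 2 * q4 + 200000 * n0 * n1 * d0 +
        200000 * n1 * n2 * d1 + 200000 * n2 * n3 * d2 + 200000 * n3 * n4 * d3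
  have hsw := hs w hw
  have hcase := cycle5_aux _ (hsp 0 (by norm_num) hp.first) _ (hsp 4 le_rfl hp.last) (s w) (by simpa using hsw)
    _ (hcA 0 (by norm_num)) _ (hcA 1 (by norm_num)) _ (hcA 2 (by norm_num)) _ (hcA 3 (by norm_num)) _ (hcA 4 (by norm_num))
  have hsum : c 0 * A w (p 0) + c 1 * A w (p 1) + c 2 * A w (p 2) + c 3 * A w (p 3) +
      c 4 * A w (p 4) =
      s w * (c 0 * s (p 0) + c 4 * s (p 4)) := by
    rcases hcase with h' | h'
    · exact h'
    · exfalso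
      simp only [not_lt.2 (key _ _ _ _ _ _), or_self] at h'
  have hg : ∀ i ≤ 4, rootGram A s w (p i) = A w (p i) - s w * s (p i) := fun i hi => by
    simp [rootGram, hwp i hi]
  simp only [Finset.sum_range_succ, Finset.sum_range_zero, zero_add]
  rw [hg 0 (by norm_num), hg 1 (by norm_num), hg 2 (by norm_num), hg 3 (by norm_num),
      hg 4 (by norm_num), z1, z2, z3]
  linear_combination hsum

end LocalClass


section Threshold

/-- The root weights of paths of vertices attached to a root. -/
noncomputable def pathWeight (lam : ℝ) : ℕ → ℝ
  | 0 => 0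
  | k + 1 => 1 / (lam - pathWeight lam k)

lemma pathWeight_mem {lam : ℝ} (h : 2 ≤ lam) (k : ℕ) :
    0 ≤ pathWeight lam k ∧ pathWeight lam k ≤ 1 := by
  induction k with
  | zero => simp [pathWeight]
  | succ k ih =>
    have : 1 ≤ lam - pathWeight lam k := by linarith
    exact ⟨by rw [pathWeight]; positivity, by rw [pathWeight, div_le_one] <;> linarith⟩

lemma exists_le_pathWeight {lam kap : ℝ} (h : 2 ≤ lam) (hk : kap * (lam - kap) < 1)
    (hk1 : kap ≤ 1) : ∃ M, kap ≤ pathWeight lam M := by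
  by_contra! hlt
  set ε := (1 - kap * (lam - kap)) / lam with hε
  have hε0 : 0 < ε := by
    have : 0 < lam := by linarith
    have : 0 < 1 - kap * (lam - kap) := by linarith
    positivity
  have hstep : ∀ k, pathWeight lam k + ε ≤ pathWeight lam (k + 1) := by
    intro k
    obtain ⟨h0, h1⟩ := pathWeight_mem h k
    have h2 := hlt k
    set x := pathWeight lam k with hx
    have hd : 0 < lam - x := by linarith
    rw [pathWeight, ← hx, le_div_iff₀ hd]
    have h3 : ε * lam = 1 - kap * (lam - kap) := by
      rw [hε]; field_simp
    nlinarith [mul_nonneg hε0.le h0, mul_nonneg (sub_nonneg.2 h2.le) (by linarith : 0 ≤ lam - kap - x)]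
  have hlin : ∀ k : ℕ, k * ε ≤ pathWeight lam k := by
    intro k
    induction k with
    | zero => simp [pathWeight]
    | succ k ih => push_cast; linarith [hstep k]
  obtain ⟨n, hn⟩ := exists_nat_gt (1 / ε)
  have := hlin n
  rw [div_lt_iff₀ hε0] at hn
  linarith [(pathWeight_mem h n).2]

lemma mem_Ioo_of_cube_eq {b : ℝ} (hb : b ^ 3 = b + 1) :
    1324717 / 1000000 < b ∧ b < 1324718 / 1000000 := by
  constructor
  · by_contra! hc
    have h : 0 ≤ b ^ 2 + b * (1324717 / 1000000) + (1324717 / 1000000) ^ 2 - 1 := by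
      nlinarith [sq_nonneg (b + 1324717 / 2000000)]
    have := mul_nonneg (sub_nonneg.2 hc) h
    ring_nf at this
    linarith
  · by_contra! hc
    have h : 0 ≤ b ^ 2 + b * (1324718 / 1000000) + (1324718 / 1000000) ^ 2 - 1 := by
      nlinarith [sq_nonneg (b + 1324718 / 2000000)]
    have := mul_nonneg (sub_nonneg.2 hc) h
    ring_nf at this
    linarith

lemma sqrt_mem_of_cube_eq {b : ℝ} (hb : b ^ 3 = b + 1) :
    1150963 / 1000000 < Real.sqrt b ∧ Real.sqrt b < 1150964 / 1000000 := by
  obtain ⟨h1, h2⟩ := mem_Ioo_of_cube_eq hb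
  constructor
  · rw [Real.lt_sqrt (by norm_num)]; norm_num; norm_num at h1; linarith
  · rw [Real.sqrt_lt' (by norm_num)]; norm_num; norm_num at h2; linarith

lemma lamStar_mem {b L : ℝ} (hb : b ^ 3 = b + 1) (hL : L = Real.sqrt b + (Real.sqrt b)⁻¹) :
    201979 / 100000 < L ∧ L < 201981 / 100000 := by
  obtain ⟨h1, h2⟩ := sqrt_mem_of_cube_eq hb
  set q := Real.sqrt b
  have hq0 : 0 < q := by linarith
  have h3 : q⁻¹ < 868838 / 1000000 := by
    rw [inv_lt_comm₀ hq0 (by norm_num)]; norm_num; norm_num at h1; linarith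
  have h4 : 868836 / 1000000 < q⁻¹ := by
    rw [lt_inv_comm₀ (by norm_num) hq0]; norm_num; norm_num at h2; linarith
  rw [hL]
  constructor <;> linarith

lemma exists_add_eq_of_two_le {lam : ℝ} (h : 2 ≤ lam) :
    ∃ θ τ : ℝ, θ * τ = 1 ∧ θ + τ = lam ∧ 1 ≤ θ ∧ 0 < τ ∧ τ ≤ 1 := by
  set D := Real.sqrt (lam ^ 2 - 4) with hD
  have hDD : D * D = lam ^ 2 - 4 := Real.mul_self_sqrt (by nlinarith)
  have hD0 : 0 ≤ D := Real.sqrt_nonneg _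
  have h1 : (lam + D) / 2 * ((lam - D) / 2) = 1 := by linear_combination -hDD / 4
  have h2 : 1 ≤ (lam + D) / 2 := by linarith
  have h3 : 0 < (lam - D) / 2 := by
    by_contra! hc
    linarith [mul_nonneg (by linarith : 0 ≤ (lam + D) / 2) (neg_nonneg.2 hc)]
  refine ⟨(lam + D) / 2, (lam - D) / 2, h1, by ring, h2, h3, ?_⟩
  linarith [mul_nonneg (sub_nonneg.2 h2) h3.le]

lemma lt_of_add_inv_lt {θ τ q : ℝ} (hθτ : θ * τ = 1) (hθ : 1 ≤ θ) (hq : 1 < q)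
    (h : θ + τ < q + q⁻¹) : θ < q := by
  by_contra! hc
  have hq0 : 0 < q := by linarith
  have hqi : q * q⁻¹ = 1 := mul_inv_cancel₀ hq0.ne'
  have hθq : 0 < θ * q := by positivity
  have h1 : 1 ≤ θ * q := by
    have := mul_le_mul hθ hq.le zero_le_one (by linarith)
    linarith
  have h2 : 0 ≤ (θ - q) * (θ * q - 1) := mul_nonneg (by linarith) (by linarith)
  have h3 : (θ + τ - (q + q⁻¹)) * (θ * q) = (θ - q) * (θ * q - 1) := by
    linear_combination q * hθτ - θ * hqi
  have h4 := mul_pos (sub_pos.2 h) hθq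
  linarith

lemma one_lt_mul_of_cube_lt {θ τ : ℝ} (hθτ : θ * τ = 1) (hθ : 1 ≤ θ)
    (h : (θ * θ) ^ 3 < θ * θ + 1) :
    1 < τ * (1 / (θ + τ) + (θ + τ) / ((θ + τ) ^ 2 - 1)) := by
  have hθ0 : 0 < θ := by linarith
  have e3 : τ = 1 / θ := by rw [eq_div_iff hθ0.ne']; linarith
  set y := θ * θ with hy
  have hy0 : 0 < y := by positivity
  have hl : θ + τ = (y + 1) / θ := by rw [eq_div_iff hθ0.ne', hy]; linear_combination hθτ
  have hll : (θ + τ) ^ 2 - 1 = (y ^ 2 + y + 1) / y := by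
    rw [eq_div_iff hy0.ne', hl, hy]; field_simp; ring
  have hgy : τ * (1 / (θ + τ) + (θ + τ) / ((θ + τ) ^ 2 - 1)) =
      1 / (y + 1) + (y + 1) / (y ^ 2 + y + 1) := by
    rw [hll, hl, e3, hy]
    field_simp
  rw [hgy, div_add_div _ _ (by positivity) (by positivity), lt_div_iff₀ (by positivity)]
  linarith

lemma exists_rootBound {βs lamStar : ℝ} (hβs : βs ^ 3 = βs + 1)
    (hstar : lamStar = Real.sqrt βs + (Real.sqrt βs)⁻¹) {lam : ℝ} (h2 : 2 ≤ lam)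
    (hlt : lam < lamStar) : ∃ kap, RootBound lam kap := by
  have hβ := mem_Ioo_of_cube_eq hβs
  have hq := sqrt_mem_of_cube_eq hβs
  have hL := lamStar_mem hβs hstar
  have hqq : Real.sqrt βs * Real.sqrt βs = βs := Real.mul_self_sqrt (by linarith)
  set q := Real.sqrt βs
  obtain ⟨θ, τ, hθτ, hsum, hθ1, hτ0, hτ1⟩ := exists_add_eq_of_two_le h2
  have hθq : θ < q := lt_of_add_inv_lt hθτ hθ1 (by linarith) (by rw [hsum, ← hstar]; exact hlt)
  have hcub : (θ * θ) ^ 3 < θ * θ + 1 := by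
    have h1 : 1 ≤ θ * θ := by nlinarith
    have h2 : θ * θ < βs := by nlinarith
    have h3 : 0 < βs ^ 2 + βs * (θ * θ) + (θ * θ) ^ 2 - 1 := by nlinarith
    nlinarith [mul_pos (sub_pos.2 h2) h3]
  have hτg := one_lt_mul_of_cube_lt hθτ hθ1 hcub
  rw [hsum] at hτg
  have hl1 : 0 < lam ^ 2 - 1 := by nlinarith
  have hl0 : 0 < lam := by linarith
  set g := 1 / lam + lam / (lam ^ 2 - 1) with hg
  have hg0 : 0 < g := by positivity
  have hginv : g * (1 / g) = 1 := by field_simp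
  have hgτ : 1 / g < τ := by rw [div_lt_iff₀ hg0]; linarith
  have hτκ : 86880 / 100000 < τ := by
    have : τ = 1 / θ := by rw [eq_div_iff (by linarith)]; linarith
    rw [this, lt_div_iff₀ (by linarith)]
    linarith
  have h3 : τ * (lam - τ) = 1 := by rw [← hsum]; linear_combination hθτ
  have hκ : max (86880 / 100000) ((τ + 1 / g) / 2) < τ := max_lt hτκ (by linarith)
  have hκ' : (τ + 1 / g) / 2 ≤ max (86880 / 100000) ((τ + 1 / g) / 2) := le_max_right _ _
  refine ⟨max (86880 / 100000) ((τ + 1 / g) / 2), h2, by linarith, le_max_left _ _, by linarith,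
    ?_, ?_⟩
  · have hθ2 : lam - τ = θ := by linarith
    have h4 : max (86880 / 100000) ((τ + 1 / g) / 2) < θ := by linarith
    nlinarith [mul_pos (sub_pos.2 hκ) (sub_pos.2 h4)]
  · have h5 : 1 / g < (τ + 1 / g) / 2 := by linarith
    have := mul_lt_mul_of_pos_right (h5.trans_le hκ') hg0
    linarith

end Threshold

section LocalP

variable {V : Type*} {A : V → V → ℤ} {s : V → ℤ} {F : Finset V} {lam kap : ℝ}

/-- The rooted signed graph is obtained from an unrooted one by `k` times passing the root to a
vertex. -/
def RootChain (A : V → V → ℤ) : ℕ → Finset V → (V → ℤ) → Prop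
  | 0, _, _ => True
  | k + 1, F, s => ∃ (F' : Finset V) (w : V) (s' : V → ℤ), F ⊆ F' ∧ w ∈ F' ∧ w ∉ F ∧
      (s' w = -1 ∨ s' w = 1) ∧ (∀ x ∈ F, s' x = 0) ∧ (∀ x ∈ F, s x = A w x) ∧ RootChain A k F' s'

lemma RootChain.mono {F' : Finset V} {k : ℕ} (h : RootChain A k F s) (hF : F' ⊆ F) :
    RootChain A k F' s := by
  cases k with
  | zero => trivial
  | succ k =>
    obtain ⟨G, w, s', h1, h2, h3, h4, h5, h6, h7⟩ := h
    exact ⟨G, w, s', hF.trans h1, h2, fun h => h3 (hF h), h4, fun x hx => h5 x (hF hx),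
      fun x hx => h6 x (hF hx), h7⟩

lemma RootChain.of_succ {k : ℕ} (h : RootChain A (k + 1) F s) : RootChain A k F s := by
  induction k generalizing F s with
  | zero => trivial
  | succ k ih =>
    obtain ⟨G, w, s', h1, h2, h3, h4, h5, h6, h7⟩ := h
    exact ⟨G, w, s', h1, h2, h3, h4, h5, h6, ih h7⟩

lemma RootChain.of_le {k l : ℕ} (hkl : k ≤ l) (h : RootChain A l F s) : RootChain A k F s := by
  induction l, hkl using Nat.le_induction with
  | base => exact h
  | succ l _ ih => exact ih h.of_succ

variable [Fintype V]

lemma RootChain.rootGood (hA : IsSignedAdj A) (h2 : 2 ≤ lam) {R : ℕ}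
    (hgood : ∀ X : Finset V, X.card ≤ R → Good A lam X) {k : ℕ} (h : RootChain A k F s)
    {X : Finset V} (hX : X ⊆ F) (hc : X.card + k ≤ R) :
    RootGood A lam (pathWeight lam k) X s := by
  induction k generalizing F s X with
  | zero => exact (hgood X hc).rootGood s
  | succ k ih =>
    obtain ⟨G, w, s', h1, hw, h3, h4, h5, h6, h7⟩ := h
    have h8 : RootGood A lam (pathWeight lam k) (insert w X) s' :=
      ih h7 (Finset.insert_subset hw (hX.trans h1))
        (by have := Finset.card_insert_le w X; omega)
    exact (h8.absorb hA (by linarith [(pathWeight_mem h2 k).2]) (Finset.mem_insert_self _ _) h4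
      (Finset.subset_insert _ _) (fun h => h3 (hX h)) (fun x hx => h5 x (hX hx))).congr
      (fun x hx => (h6 x (hX hx)).symm)

/-- Rooted signed graphs all of whose small subgraphs are good at weight `kap`, with the meaning
of small depending on how often the root has been passed on. -/
def LocalRootGood (A : V → V → ℤ) (lam kap : ℝ) (R : ℕ) (F : Finset V) (s : V → ℤ) : Prop :=
  (∀ x ∈ F, s x = -1 ∨ s x = 0 ∨ s x = 1) ∧
  ∃ k, RootChain A k F s ∧ ∀ X ⊆ F, X.card + k ≤ R → RootGood A lam kap X s

lemma LocalRootGood.rootGood (hA : IsSignedAdj A) (hb : RootBound lam kap) {M R : ℕ}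
    (hM : kap ≤ pathWeight lam M) (hR : M + 6 ≤ R)
    (hgood : ∀ X : Finset V, X.card ≤ R → Good A lam X) (h : LocalRootGood A lam kap R F s)
    {X : Finset V} (hX : X ⊆ F) (hc : X.card ≤ 6) : RootGood A lam kap X s := by
  obtain ⟨-, k, hk, hX'⟩ := h
  rcases le_total k M with hkM | hkM
  · exact hX' X hX (by omega)
  · exact ((hk.of_le hkM).rootGood hA hb.two_le hgood hX (by omega)).mono_param le_rfl hM

theorem rootClass_localRootGood (hA : IsSignedAdj A) (hb : RootBound lam kap) {M R : ℕ}
    (hM : kap ≤ pathWeight lam M) (hR : M + 6 ≤ R)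
    (hgood : ∀ X : Finset V, X.card ≤ R → Good A lam X) :
    RootClass A (LocalRootGood A lam kap R) := by
  have hnz : ∀ {F s}, LocalRootGood A lam kap R F s → ∀ x ∈ F, s x ≠ 0 → s x = -1 ∨ s x = 1 := by
    intro F s h x hx h0
    rcases h.1 x hx with h' | h' | h'
    exacts [Or.inl h', absurd h' h0, Or.inr h']
  refine ⟨fun h => h.1, ?_, ?_, ?_, ?_, ?_⟩
  · rintro F s F' ⟨h1, k, h2, h3⟩ hF
    exact ⟨fun x hx => h1 x (hF hx), k, h2.mono hF, fun X hX => h3 X (hX.trans hF)⟩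
  · intro F s F' w h hw hsw hF hwF hs
    have hsw' := hnz h w hw hsw
    obtain ⟨h1, k, h2, h3⟩ := h
    refine ⟨fun x _ => hA.entries w x, k + 1, ⟨F, w, s, hF, hw, hwF, hsw', hs, fun _ _ => rfl, h2⟩,
      fun X hX hc => ?_⟩
    have h4 := h3 (insert w X) (Finset.insert_subset hw (hX.trans hF))
      (by have := Finset.card_insert_le w X; omega)
    have h0 : 0 < lam - kap := by linarith [hb.two_le, hb.kap_le]
    refine (h4.absorb hA (by linarith) (Finset.mem_insert_self _ _) hsw'
      (Finset.subset_insert _ _) (fun h => hwF (hX h)) (fun x hx => hs x (hX hx))).mono_param le_rfl ?_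
    rw [le_div_iff₀ h0]
    exact hb.unstable.le
  · intro F s u v h hu hv huv hsu hsv
    refine RootGood.ne_two hA hb (h.rootGood hA hb hM hR hgood ?_ ?_) huv (hnz h u hu hsu)
      (hnz h v hv hsv)
    · simp [Finset.insert_subset_iff, hu, hv]
    · exact Finset.card_le_two.trans (by norm_num)
  · intro F s u v w h hu hv hw huv hwu hwv hsu hsv h0
    refine RootGood.parallel hA hb (h.rootGood hA hb hM hR hgood ?_ ?_) huv hwu hwv
      (hnz h u hu hsu) (hnz h v hv hsv) (h.1 w hw) h0
    · simp [Finset.insert_subset_iff, hu, hv, hw]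
    · exact Finset.card_le_three.trans (by norm_num)
  · intro F s r p c w h hp hw hwp h1 h3
    have hm := hp.mem
    interval_cases r
    · refine RootGood.cycle3 hA hb h.1 hp hw hwp (h.rootGood hA hb hM hR hgood ?_ ?_)
      · simp [Finset.insert_subset_iff, hw, hm]
      · exact Finset.card_le_four.trans (by norm_num)
    · refine RootGood.cycle4 hA hb h.1 hp hw hwp (h.rootGood hA hb hM hR hgood ?_ ?_)
      · simp [Finset.insert_subset_iff, hw, hm]
      · exact Finset.card_le_five.trans (by norm_num)
    · refine RootGood.cycle5 hA hb h.1 hp hw hwp (h.rootGood hA hb hM hR hgood ?_ ?_)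
      · simp [Finset.insert_subset_iff, hw, hm]
      · exact Finset.card_le_six

end LocalP


section Layers

variable {V : Type*} {r : V → V → Prop} {F : Finset V}

/-- A finite set which is connected with respect to a relation. -/
def RelConn (r : V → V → Prop) (F : Finset V) : Prop :=
  ∀ Y ⊆ F, Y.Nonempty → (∀ y ∈ Y, ∀ z ∈ F, z ∉ Y → ¬ r y z) → Y = F

/-- To prove a property of all finite sets it suffices to treat connected ones and disjoint
unions of pieces without relations between them. -/
lemma relConn_induction {P : Finset V → Prop} (r : V → V → Prop) (F : Finset V) (h0 : P ∅)
    (hconn : ∀ G ⊆ F, G.Nonempty → RelConn r G → P G)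
    (hunion : ∀ Y G, Y ⊆ G → G ⊆ F → (∀ y ∈ Y, ∀ z ∈ G, z ∉ Y → ¬ r y z) → P Y → P (G \ Y) → P G) :
    P F := by
  suffices h : ∀ G ⊆ F, P G from h F subset_rfl
  intro G
  induction G using Finset.strongInduction with
  | H G ih =>
    intro hG
    rcases G.eq_empty_or_nonempty with rfl | hne
    · exact h0
    by_cases hc : RelConn r G
    · exact hconn G hG hne hc
    · simp only [RelConn, not_forall] at hc
      obtain ⟨Y, hY, hYne, hout, hYG⟩ := hc
      refine hunion Y G hY hG hout (ih Y (hY.ssubset_of_ne hYG) (hY.trans hG)) (ih _ ?_ ?_)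
      · exact Finset.sdiff_ssubset hY hYne
      · exact Finset.sdiff_subset.trans hG

lemma RelConn.insert_of_rel (h : RelConn r F) (hr : ∀ x y, r x y → r y x) {v w : V}
    (hv : v ∈ F) (hvw : r v w) : RelConn r (insert w F) := by
  intro Y hY hne hout
  by_cases hvY : v ∈ Y
  · have h1 : F ⊆ Y := by
      have := h (Y ∩ F) Finset.inter_subset_right ⟨v, by simp [hv, hvY]⟩ (by
        intro y hy z hz hzY
        exact hout y (Finset.mem_inter.1 hy).1 z (by simp [hz]) (fun h => hzY (by simp [h, hz])))
      rw [← this]; exact Finset.inter_subset_left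
    refine hY.antisymm (Finset.insert_subset ?_ h1)
    by_contra hw
    exact hout v hvY w (by simp) hw hvw
  · exfalso
    by_cases hw : w ∈ Y
    · exact hout w hw v (by simp [hv]) hvY (hr _ _ hvw)
    · have hYF : Y ⊆ F := fun y hy => (Finset.mem_insert.1 (hY hy)).resolve_left
        (fun e => hw (e ▸ hy))
      have := h Y hYF hne (fun y hy z hz => hout y hy z (by simp [hz]))
      exact hvY (this ▸ hv)

variable [Fintype V]

/-- The ball of radius `k` around `F`. -/
noncomputable def relBall (r : V → V → Prop) (F : Finset V) : ℕ → Finset V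
  | 0 => F
  | k + 1 => relBall r F k ∪ Finset.univ.filter fun z => ∃ y ∈ relBall r F k, r y z

lemma mem_relBall_succ {k : ℕ} {z : V} :
    z ∈ relBall r F (k + 1) ↔ z ∈ relBall r F k ∨ ∃ y ∈ relBall r F k, r y z := by
  simp [relBall]

lemma relBall_mono {k l : ℕ} (h : k ≤ l) : relBall r F k ⊆ relBall r F l := by
  induction l, h using Nat.le_induction with
  | base => exact subset_rfl
  | succ l _ ih => exact fun x hx => mem_relBall_succ.2 (Or.inl (ih hx))

lemma exists_geodesic {k : ℕ} {z : V} (hz : z ∈ relBall r F k) :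
    ∃ j ≤ k, ∃ w : ℕ → V, w 0 ∈ F ∧ w j = z ∧ ∀ i < j, r (w i) (w (i + 1)) ∧
      w (i + 1) ∈ relBall r F (i + 1) ∧ w (i + 1) ∉ relBall r F i := by
  induction k generalizing z with
  | zero => exact ⟨0, le_rfl, fun _ => z, hz, rfl, by simp⟩
  | succ k ih =>
    by_cases hzk : z ∈ relBall r F k
    · obtain ⟨j, hj, h⟩ := ih hzk
      exact ⟨j, by omega, h⟩
    obtain ⟨y, hy, hyz⟩ := (mem_relBall_succ.1 hz).resolve_left hzk
    obtain ⟨j, hj, w, h0, h1, h2⟩ := ih hy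
    have hyj : w j ∈ relBall r F j := by
      cases j with
      | zero => exact h0
      | succ j => exact (h2 j (by omega)).2.1
    have hjk : j = k := by
      by_contra hne
      have : z ∈ relBall r F (j + 1) := mem_relBall_succ.2 (Or.inr ⟨w j, hyj, h1 ▸ hyz⟩)
      exact hzk (relBall_mono (by omega) this)
    subst hjk
    refine ⟨j + 1, le_rfl, fun i => if i ≤ j then w i else z, by simpa using h0, by simp, ?_⟩
    intro i hi
    rcases (Nat.lt_succ_iff.1 hi).lt_or_eq with h | rfl
    · have e1 : i ≤ j := by omega
      have e2 : i + 1 ≤ j := by omega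
      simp only [e1, e2, if_true]
      exact h2 i h
    · simp only [le_refl, if_true, if_neg (show ¬ i + 1 ≤ i by omega)]
      exact ⟨h1 ▸ hyz, hz, hzk⟩

lemma card_relBall_succ_le {k D : ℕ}
    (hD : ∀ v ∈ relBall r F k, (Finset.univ.filter fun z => r v z).card ≤ D) :
    (relBall r F (k + 1)).card ≤ (D + 1) * (relBall r F k).card := by
  have h1 : (Finset.univ.filter fun z => ∃ y ∈ relBall r F k, r y z) ⊆
      (relBall r F k).biUnion fun y => Finset.univ.filter fun z => r y z := by
    intro z hz; simpa using hz
  have h2 := (Finset.card_le_card h1).trans (Finset.card_biUnion_le_card_mul _ _ D hD)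
  have h3 := Finset.card_union_le (relBall r F k)
    (Finset.univ.filter fun z => ∃ y ∈ relBall r F k, r y z)
  rw [relBall]
  linarith

/-- A large connected set has long geodesics from `F` or vertices of large degree near `F`. -/
lemma exists_geodesic_or_degree (hconn : RelConn r (Finset.univ : Finset V)) (hF : F.Nonempty)
    {M D : ℕ} (hcard : F.card * (D + 1) ^ M < Fintype.card V) :
    (∃ w : ℕ → V, w 0 ∈ F ∧ ∀ i < M, r (w i) (w (i + 1)) ∧
      w (i + 1) ∈ relBall r F (i + 1) ∧ w (i + 1) ∉ relBall r F i) ∨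
    ∃ v ∈ relBall r F M, D < (Finset.univ.filter fun z => r v z).card := by
  by_contra! h
  obtain ⟨h1, h2⟩ := h
  have hle : ∀ k ≤ M, (relBall r F k).card ≤ F.card * (D + 1) ^ k := by
    intro k
    induction k with
    | zero => simp [relBall]
    | succ k ih =>
      intro hk
      have h3 := card_relBall_succ_le (r := r) (F := F) (k := k) (D := D)
        (fun v hv => h2 v (relBall_mono (by omega) hv))
      calc _ ≤ _ := h3
        _ ≤ (D + 1) * (F.card * (D + 1) ^ k) := Nat.mul_le_mul_left _ (ih (by omega))
        _ = _ := by ring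
  have hne : relBall r F M ≠ Finset.univ := by
    intro e
    have := hle M le_rfl
    rw [e, Finset.card_univ] at this
    omega
  have hex : ∃ z ∈ relBall r F M, ∀ j < M, z ∉ relBall r F j := by
    rcases Nat.eq_zero_or_pos M with rfl | hM
    · obtain ⟨z, hz⟩ := hF
      exact ⟨z, hz, by simp⟩
    by_contra! hall
    have hsub : relBall r F M ⊆ relBall r F (M - 1) := fun z hz => by
      obtain ⟨j, hj, hzj⟩ := hall z hz
      exact relBall_mono (by omega) hzj
    refine hne (hconn _ (Finset.subset_univ _) (hF.mono (relBall_mono (Nat.zero_le _))) ?_)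
    intro y hy z _ hzn hyz
    refine hzn ?_
    have : z ∈ relBall r F (M - 1 + 1) := mem_relBall_succ.2 (Or.inr ⟨y, hsub hy, hyz⟩)
    rwa [Nat.sub_add_cancel hM] at this
  obtain ⟨z, hz, hzj⟩ := hex
  obtain ⟨j, hj, w, hw0, hwj, hw⟩ := exists_geodesic hz
  have hjM : j = M := by
    by_contra hjne
    refine hzj j (by omega) ?_
    cases j with
    | zero => exact hwj ▸ hw0
    | succ j => exact hwj ▸ (hw j (by omega)).2.1
  subst hjM
  obtain ⟨i, hi, h3⟩ := h1 w hw0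
  exact (hw i hi).2.2 (h3 (hw i hi).1 (hw i hi).2.1)

lemma RelConn.exists_mem (h : RelConn r F) (hr : ∀ x y, r x y → r y x) {k : ℕ} {v : V}
    (hv : v ∈ relBall r F k) : ∃ F', F ⊆ F' ∧ RelConn r F' ∧ v ∈ F' ∧ F'.card ≤ F.card + k := by
  induction k generalizing v with
  | zero => exact ⟨F, subset_rfl, h, hv, le_rfl⟩
  | succ k ih =>
    rcases mem_relBall_succ.1 hv with hv | ⟨y, hy, hyv⟩
    · obtain ⟨F', h1, h2, h3, h4⟩ := ih hv
      exact ⟨F', h1, h2, h3, by omega⟩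
    · obtain ⟨F', h1, h2, h3, h4⟩ := ih hy
      exact ⟨insert v F', h1.trans (Finset.subset_insert _ _), h2.insert_of_rel hr h3 hyv, by simp,
        (Finset.card_insert_le _ _).trans (by omega)⟩

end Layers


section Tails

variable {V : Type*} {A : V → V → ℤ} {s : V → ℤ} {F : Finset V} {lam kap : ℝ}

lemma RootRep.zero_root (h : RootRep A s F) : RootRep A 0 F := by
  obtain ⟨ι, i, φ, hφ⟩ := h
  refine ⟨Option ι, inferInstance, fun x o => o.elim (s x) (φ x), fun x hx y hy => ?_⟩
  have := hφ x hx y hy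
  simp only [dotProduct, rootGram] at this
  simp [dotProduct, Fintype.sum_option, rootGram, this]

variable [Fintype V]

/-- Averaging over many vertices with the same neighbourhood in `F` gives a second root. -/
lemma RootGood.add_root_of_many {p : V → ℤ} (hA : IsSignedAdj A) (hl : 0 ≤ lam) {U : Finset V} (hU : U.Nonempty)
    (hUF : Disjoint F U) (hs : ∀ u ∈ U, ∀ x ∈ F, A u x = s x) (hp : ∀ u ∈ U, p u = 0)
    (h : RootGood A lam kap (F ∪ U) p) {x : V → ℝ} (hx : ∀ v, v ∉ F → x v = 0) :
    kap * (∑ v, (p v : ℝ) * x v) ^ 2 + 1 / (1 + lam / U.card) * (∑ v, (s v : ℝ) * x v) ^ 2 ≤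
      shiftBilin A lam x x := by
  set m : ℝ := (U.card : ℝ) with hm
  have hm0 : 0 < m := by simpa [hm] using hU.card_pos
  set e : V → ℝ := ∑ u ∈ U, Pi.single u 1 with he
  have hxU : ∀ u ∈ U, x u = 0 := fun u hu => hx u fun h => Finset.disjoint_left.1 hUF h hu
  set T : ℝ := ∑ v, (s v : ℝ) * x v with hT
  have h1 : shiftBilin A lam e x = m * T := by
    rw [he, shiftBilin_sum_left, Finset.sum_congr rfl (g := fun _ => T), Finset.sum_const,
      nsmul_eq_mul]
    intro u hu
    rw [shiftBilin_single_left, hxU u hu, mul_zero, zero_add]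
    refine Finset.sum_congr rfl fun v _ => ?_
    by_cases hv : v ∈ F
    · rw [hs u hu v hv]
    · simp [hx v hv]
  have h2 : shiftBilin A lam e e ≤ lam * m + m ^ 2 := by
    rw [he, shiftBilin_sum_left]
    simp only [shiftBilin_sum_right, shiftBilin_single_single]
    have : ∀ u ∈ U, ∑ v ∈ U, ((if u = v then lam else 0) + (A u v : ℝ)) ≤ lam + m := by
      intro u hu
      rw [Finset.sum_add_distrib]
      refine add_le_add ?_ ?_
      · simp [hu]
      · calc _ ≤ ∑ v ∈ U, (1 : ℝ) := Finset.sum_le_sum fun v _ => by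
              rcases hA.entries u v with h | h | h <;> simp [h]
          _ = m := by simp [hm]
    calc _ ≤ ∑ u ∈ U, (lam + m) := Finset.sum_le_sum this
      _ = _ := by rw [Finset.sum_const, nsmul_eq_mul]; ring
  set c : ℝ := T / (lam + m) with hc
  have hlm : 0 < lam + m := by linarith
  have hcT : c * (lam + m) = T := by rw [hc]; field_simp
  have h3 := h (x + (-c) • e) (by
    intro v hv
    rw [Finset.mem_union, not_or] at hv
    have : e v = 0 := by
      rw [he, Finset.sum_apply]
      refine Finset.sum_eq_zero fun u hu => ?_
      have : v ≠ u := fun h => hv.2 (h ▸ hu)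
      simp [this]
    simp [hx v hv.1, this])
  have h0 : ∑ v, (p v : ℝ) * (x + (-c) • e) v = ∑ v, (p v : ℝ) * x v := by
    refine Finset.sum_congr rfl fun v _ => ?_
    by_cases hv : v ∈ U
    · simp [hp v hv]
    · have : e v = 0 := by
        rw [he, Finset.sum_apply]
        refine Finset.sum_eq_zero fun u hu => ?_
        have : v ≠ u := fun h => hv (h ▸ hu)
        simp [this]
      simp [this]
  rw [h0, shiftBilin_add_left, shiftBilin_add_right, shiftBilin_add_right, shiftBilin_smul_right,
    shiftBilin_smul_left, shiftBilin_smul_left, shiftBilin_smul_right, shiftBilin_comm hA x e,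
    h1] at h3
  have h4 : 1 / (1 + lam / m) * T ^ 2 = m * (c * T) := by
    rw [hc]; field_simp; ring
  rw [h4]
  have h5 : c ^ 2 * shiftBilin A lam e e ≤ c ^ 2 * (lam * m + m ^ 2) :=
    mul_le_mul_of_nonneg_left h2 (sq_nonneg c)
  have h6 : c ^ 2 * (lam * m + m ^ 2) = m * (c * T) := by rw [← hcT]; ring
  nlinarith

/-- Averaging over many vertices with the same neighbourhood in `F` gives a root. -/
lemma RootGood.of_many (hA : IsSignedAdj A) (hl : 0 ≤ lam) {U : Finset V} (hU : U.Nonempty)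
    (hUF : Disjoint F U) (hs : ∀ u ∈ U, ∀ x ∈ F, A u x = s x) (h : Good A lam (F ∪ U)) :
    RootGood A lam (1 / (1 + lam / U.card)) F s := by
  intro x hx
  simpa using RootGood.add_root_of_many (p := 0) hA hl hU hUF hs (fun _ _ => rfl)
    (h.rootGood 0) hx

/-- A root at the end of a path of length `M` leading away from `F`. -/
lemma rootGood_of_geodesic (hA : IsSignedAdj A) (h2 : 2 ≤ lam) {M R : ℕ} (hR : F.card + M ≤ R)
    (hgood : ∀ X : Finset V, X.card ≤ R → Good A lam X) {w : ℕ → V}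
    (hw : ∀ i < M + 1, A (w i) (w (i + 1)) ≠ 0 ∧
      w (i + 1) ∈ relBall (fun x y => A x y ≠ 0) F (i + 1) ∧
      w (i + 1) ∉ relBall (fun x y => A x y ≠ 0) F i) :
    RootGood A lam (pathWeight lam M) F (A (w 1)) := by
  set r : V → V → Prop := fun x y => A x y ≠ 0 with hr
  set G : ℕ → Finset V := fun j => F ∪ (Finset.range j).image fun i => w (i + 1) with hG
  have hGc : ∀ j, (G j).card ≤ F.card + j := fun j =>
    (Finset.card_union_le _ _).trans (Nat.add_le_add_left
      (Finset.card_image_le.trans (Finset.card_range j).le) _)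
  have hGb : ∀ j ≤ M, G j ⊆ relBall r F j := by
    intro j hj x hx
    rcases Finset.mem_union.1 hx with hx | hx
    · exact relBall_mono (Nat.zero_le j) hx
    · obtain ⟨i, hi, rfl⟩ := Finset.mem_image.1 hx
      rw [Finset.mem_range] at hi
      exact relBall_mono (by omega) (hw i (by omega)).2.1
  have hGm : ∀ j, G j ⊆ G (j + 1) := fun j =>
    Finset.union_subset_union_right (Finset.image_subset_image (by simp))
  have main : ∀ k j, j + k = M → RootGood A lam (pathWeight lam k) (G j) (A (w (j + 1))) := by
    intro k
    induction k with
    | zero =>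
      intro j hj
      exact (hgood _ ((hGc j).trans (by omega))).rootGood _
    | succ k ih =>
      intro j hj
      refine (ih (j + 1) (by omega)).absorb hA (by linarith [(pathWeight_mem h2 k).2])
        (w := w (j + 1)) ?_ ?_ (hGm j) ?_ ?_
      · exact Finset.mem_union_right _ (Finset.mem_image_of_mem _ (by simp))
      · have h := (hw (j + 1) (by omega)).1
        rw [hA.symm] at h
        rcases hA.entries (w (j + 1 + 1)) (w (j + 1)) with h' | h' | h'
        exacts [Or.inl h', absurd h' h, Or.inr h']
      · exact fun h => (hw j (by omega)).2.2 (hGb j (by omega) h)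
      · intro x hx
        by_contra hne
        refine (hw (j + 1) (by omega)).2.2 (mem_relBall_succ.2 (Or.inr ⟨x, hGb j (by omega) hx,
            ?_⟩))
        rw [hA.symm] at hne
        exact hne
  have := main M 0 (by simp)
  simpa [hG] using this

/-- A root from a vertex of large degree. -/
lemma exists_rootGood_of_degree (hA : IsSignedAdj A) (hl : 0 ≤ lam) {v : V}
    {m : ℕ} (hm : 0 < m)
    (hgood : ∀ X : Finset V, X.card ≤ F.card + m → Good A lam X)
    (hdeg : F.card + 3 ^ F.card * m < (Finset.univ.filter fun z => A v z ≠ 0).card) :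
    ∃ u, A u v ≠ 0 ∧ RootGood A lam (1 / (1 + lam / m)) F (A u) := by
  set S := (Finset.univ.filter fun z => A v z ≠ 0) \ F with hS
  have hSc : 3 ^ F.card * m < S.card := by
    have := Finset.le_card_sdiff F (Finset.univ.filter fun z => A v z ≠ 0)
    rw [← hS] at this
    omega
  set tys : Finset (F → ℤ) := Fintype.piFinset fun _ => {-1, 0, 1} with htys
  have htc : tys.card = 3 ^ F.card := by simp [htys]
  have hmap : ∀ u ∈ S, (fun x : F => A u x) ∈ tys := by
    intro u _
    rw [htys, Fintype.mem_piFinset]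
    intro x
    rcases hA.entries u x with h | h | h <;> simp [h]
  obtain ⟨t, -, ht⟩ := Finset.exists_lt_card_fiber_of_mul_lt_card_of_maps_to hmap
    (n := m) (by rw [htc]; exact hSc)
  obtain ⟨U, hU, hUc⟩ := Finset.exists_subset_card_eq ht.le
  have hUne : U.Nonempty := by rw [← Finset.card_pos]; omega
  obtain ⟨u, hu⟩ := hUne
  have hU' : ∀ u ∈ U, u ∈ S ∧ (fun x : F => A u x) = t := fun u hu => Finset.mem_filter.1 (hU hu)
  refine ⟨u, ?_, ?_⟩
  · have := (Finset.mem_sdiff.1 (hU' u hu).1).1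
    rw [hA.symm]
    exact (Finset.mem_filter.1 this).2
  · rw [← hUc]
    refine RootGood.of_many hA hl ⟨u, hu⟩ ?_ ?_ (hgood _ ?_)
    · exact Finset.disjoint_right.2 fun z hz => (Finset.mem_sdiff.1 (hU' z hz).1).2
    · intro z hz x hx
      have := congrFun ((hU' z hz).2.trans (hU' u hu).2.symm) ⟨x, hx⟩
      exact this
    · exact (Finset.card_union_le _ _).trans (by omega)

lemma RootBound.kap_lt_one (hb : RootBound lam kap) : kap < 1 := by
  rcases hb.kap_le.lt_or_eq with h | h
  · exact h
  · have := hb.unstable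
    rw [h] at this
    linarith [hb.two_le]

/-- In large connected signed graphs all of whose small subgraphs are good, small subgraphs are
represented by integer vectors. -/
theorem exists_rootRep_of_card (hb : RootBound lam kap) (R₀ : ℕ) :
    ∃ N R : ℕ, ∀ {V : Type} [Fintype V] {A : V → V → ℤ}, IsSignedAdj A →
      RelConn (fun x y => A x y ≠ 0) (Finset.univ : Finset V) → N ≤ Fintype.card V →
      (∀ X : Finset V, X.card ≤ R → Good A lam X) →
      ∀ F : Finset V, F.card ≤ R₀ → RootRep A 0 F := by
  obtain ⟨M, hM⟩ := exists_le_pathWeight hb.two_le hb.unstable hb.kap_le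
  obtain ⟨m, hm0, hm⟩ : ∃ m : ℕ, 0 < m ∧ kap ≤ 1 / (1 + lam / m) := by
    obtain ⟨n, hn⟩ := exists_nat_gt (lam / (1 - kap))
    have h1 : 0 < 1 - kap := by linarith [hb.kap_lt_one]
    have hl : 0 < lam := by linarith [hb.two_le]
    have hn0 : (0 : ℝ) < n := lt_trans (by positivity) hn
    refine ⟨n, by exact_mod_cast hn0, ?_⟩
    rw [div_lt_iff₀ h1] at hn
    have hk : 0 < kap := by linarith [hb.le_kap]
    rw [le_div_iff₀ (by positivity)]
    have e : lam / n * n = lam := by field_simp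
    have h2 : lam / n ≤ 1 - kap := by rw [div_le_iff₀ hn0]; linarith
    nlinarith [hb.kap_lt_one]
  set L := R₀ + (M + 1) with hL
  set D := L + 3 ^ L * m with hD
  refine ⟨(R₀ + 1) * (D + 1) ^ (M + 1), L + M + 6 + m, ?_⟩
  intro V _ A hA hconn hcard hgood F hF
  set r : V → V → Prop := fun x y => A x y ≠ 0 with hr
  have hrs : ∀ x y, r x y → r y x := fun x y h => by
    simp only [hr, hA.symm y x]; exact h
  have hP := rootClass_localRootGood hA hb (R := L + M + 6 + m) hM (by omega) hgood
  have hroot : ∀ {G : Finset V} {u : V}, RelConn r G → RootGood A lam kap G (A u) →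
      (∃ v ∈ G, A u v ≠ 0) → RootRep A 0 G := by
    intro G u hG hgd ⟨v, hv, huv⟩
    refine (RootClass.rootRep hA hP (s := A u) ⟨fun x _ => hA.entries u x, 0, trivial,
      fun X hX _ => hgd.mono hX⟩ ?_).zero_root
    intro Y hY hne hout
    rw [hG Y hY hne fun y hy z hz hzY h => h (hout y hy z hz hzY)]
    exact ⟨v, hv, huv⟩
  refine relConn_induction r F ⟨Empty, inferInstance, fun _ => 0, by simp⟩ ?_ ?_
  · intro G hGF hGne hG
    have hGc : G.card ≤ R₀ := (Finset.card_le_card hGF).trans hF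
    have hlt : G.card * (D + 1) ^ (M + 1) < Fintype.card V := by
      refine lt_of_lt_of_le ?_ hcard
      exact Nat.mul_lt_mul_of_pos_right (by omega) (by positivity)
    rcases exists_geodesic_or_degree hconn hGne hlt with ⟨w, hw0, hw⟩ | ⟨v, hv, hdeg⟩
    · have h1 := rootGood_of_geodesic hA hb.two_le (R := L + M + 6 + m) (by omega) hgood hw
      refine hroot hG (h1.mono_param le_rfl hM) ⟨w 0, hw0, ?_⟩
      rw [hA.symm]
      exact (hw 0 (by omega)).1
    · obtain ⟨G', h1, h2, h3, h4⟩ := hG.exists_mem hrs hv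
      have hG'L : G'.card ≤ L := by omega
      have h5 : G'.card + 3 ^ G'.card * m ≤ D := Nat.add_le_add hG'L
        (Nat.mul_le_mul_right _ (Nat.pow_le_pow_right (by norm_num) hG'L))
      have hdeg' : D < (Finset.univ.filter fun z => A v z ≠ 0).card := by convert hdeg
      obtain ⟨u, huv, hgd⟩ := exists_rootGood_of_degree hA (by linarith [hb.two_le]) (v := v) hm0
        (fun X hX => hgood X (by omega)) (h5.trans_lt hdeg')
      exact (hroot h2 (hgd.mono_param le_rfl hm) ⟨v, h3, huv⟩).mono h1
  · intro Y G hYG hGF hout h1 h2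
    refine RootRep.union hA h1 h2 fun y hy z hz hzY => ?_
    have hyz : y ≠ z := by rintro rfl; exact hzY hy
    rw [rootGram_of_ne (A := A) (s := 0) hyz (Or.inl rfl)]
    exact not_not.1 (hout y hy z hz hzY)

end Tails


section UnitVectors

variable {ι : Type*} [Fintype ι]

lemma dotProduct_self_nonneg_int (x : ι → ℤ) : 0 ≤ x ⬝ᵥ x :=
  Finset.sum_nonneg fun i _ => mul_self_nonneg (x i)

/-- An integer vector of norm two is the sum of two orthogonal unit vectors. -/
lemma exists_add_eq_of_dotProduct_self {v : ι → ℤ} (h : v ⬝ᵥ v = 2) :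
    ∃ f g : ι → ℤ, f ⬝ᵥ f = 1 ∧ g ⬝ᵥ g = 1 ∧ f ⬝ᵥ g = 0 ∧ v = f + g := by
  obtain ⟨k, hk⟩ : ∃ k, v k ≠ 0 := by
    by_contra! hv
    simp [dotProduct, hv] at h
  have hk1 : v k * v k = 1 := by
    have h1 : v k * v k ≤ 2 := by
      rw [← h]
      exact Finset.single_le_sum (f := fun i => v i * v i) (fun i _ => mul_self_nonneg (v i))
        (Finset.mem_univ k)
    have h2 : v k ≤ 1 := by nlinarith
    have h3 : -1 ≤ v k := by nlinarith
    generalize v k = t at *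
    interval_cases t <;> simp_all
  refine ⟨Pi.single k (v k), v - Pi.single k (v k), ?_, ?_, ?_, by simp⟩
  · simp [hk1]
  · simp [sub_dotProduct, dotProduct_sub, h, hk1]
  · simp [dotProduct_sub, hk1]

variable {a b c d x : ι → ℤ}

lemma bessel_two (ha : a ⬝ᵥ a = 1) (hb : b ⬝ᵥ b = 1) (hab : a ⬝ᵥ b = 0) :
    (x ⬝ᵥ a) ^ 2 + (x ⬝ᵥ b) ^ 2 ≤ x ⬝ᵥ x := by
  have := dotProduct_self_nonneg_int (x - (x ⬝ᵥ a) • a - (x ⬝ᵥ b) • b)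
  simp only [sub_dotProduct, dotProduct_sub, smul_dotProduct, dotProduct_smul, ha, hb, hab,
    dotProduct_comm b a, dotProduct_comm a x, dotProduct_comm b x, smul_eq_mul] at this
  linarith

lemma bessel_three (ha : a ⬝ᵥ a = 1) (hb : b ⬝ᵥ b = 1) (hc : c ⬝ᵥ c = 1) (hab : a ⬝ᵥ b = 0)
    (hac : a ⬝ᵥ c = 0) (hbc : b ⬝ᵥ c = 0) :
    (x ⬝ᵥ a) ^ 2 + (x ⬝ᵥ b) ^ 2 + (x ⬝ᵥ c) ^ 2 ≤ x ⬝ᵥ x := by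
  have := bessel_two (x := x - (x ⬝ᵥ c) • c) ha hb hab
  simp only [sub_dotProduct, dotProduct_sub, smul_dotProduct, dotProduct_smul, hc, hac, hbc,
    dotProduct_comm c a, dotProduct_comm c b, dotProduct_comm c x, smul_eq_mul] at this
  linarith

lemma bessel_four (ha : a ⬝ᵥ a = 1) (hb : b ⬝ᵥ b = 1) (hc : c ⬝ᵥ c = 1) (hd : d ⬝ᵥ d = 1)
    (hab : a ⬝ᵥ b = 0) (hac : a ⬝ᵥ c = 0) (hbc : b ⬝ᵥ c = 0) (had : a ⬝ᵥ d = 0)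
    (hbd : b ⬝ᵥ d = 0) (hcd : c ⬝ᵥ d = 0) :
    (x ⬝ᵥ a) ^ 2 + (x ⬝ᵥ b) ^ 2 + (x ⬝ᵥ c) ^ 2 + (x ⬝ᵥ d) ^ 2 ≤ x ⬝ᵥ x := by
  have := bessel_three (x := x - (x ⬝ᵥ d) • d) ha hb hc hab hac hbc
  simp only [sub_dotProduct, dotProduct_sub, smul_dotProduct, dotProduct_smul, hd, had, hbd, hcd,
    dotProduct_comm d a, dotProduct_comm d b, dotProduct_comm d c, dotProduct_comm d x,
    smul_eq_mul] at this
  linarith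

end UnitVectors

section CartanA

variable {ι : Type*} [Fintype ι]

/-- Simple roots of type `A₂` in `ℤⁿ` are differences of unit vectors. -/
lemma exists_sub_eq_two {v w : ι → ℤ} (hv : v ⬝ᵥ v = 2) (hw : w ⬝ᵥ w = 2) (hvw : w ⬝ᵥ v = -1) :
    ∃ a b d : ι → ℤ, a ⬝ᵥ a = 1 ∧ b ⬝ᵥ b = 1 ∧ d ⬝ᵥ d = 1 ∧ a ⬝ᵥ b = 0 ∧ a ⬝ᵥ d = 0 ∧
      b ⬝ᵥ d = 0 ∧ v = a - b ∧ w = b - d := by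
  obtain ⟨f, g, hf, hg, hfg, rfl⟩ := exists_add_eq_of_dotProduct_self hv
  suffices H : ∀ f g : ι → ℤ, f ⬝ᵥ f = 1 → g ⬝ᵥ g = 1 → f ⬝ᵥ g = 0 → w ⬝ᵥ f = 0 → w ⬝ᵥ g = -1 →
      ∃ a b d : ι → ℤ, a ⬝ᵥ a = 1 ∧ b ⬝ᵥ b = 1 ∧ d ⬝ᵥ d = 1 ∧ a ⬝ᵥ b = 0 ∧ a ⬝ᵥ d = 0 ∧
      b ⬝ᵥ d = 0 ∧ f + g = a - b ∧ w = b - d by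
    have hB := bessel_two (x := w) hf hg hfg
    rw [hw] at hB
    rw [dotProduct_add] at hvw
    have h1 : w ⬝ᵥ f ≤ 1 := by nlinarith
    have h2 : -2 < w ⬝ᵥ f := by nlinarith [sq_nonneg (w ⬝ᵥ g)]
    have h3 : w ⬝ᵥ g = -1 - w ⬝ᵥ f := by linarith
    rw [h3] at hB
    have h4 : w ⬝ᵥ f = 0 ∨ w ⬝ᵥ f = -1 := by
      generalize w ⬝ᵥ f = t at *
      interval_cases t <;> simp_all
    rcases h4 with h4 | h4
    · exact H f g hf hg hfg h4 (by omega)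
    · have := H g f hg hf (by rw [dotProduct_comm, hfg]) (by omega) h4
      rwa [add_comm] at this
  intro f g hf hg hfg h1 h2
  refine ⟨f, -g, -g - w, hf, by simp [hg], ?_, by simp [hfg], ?_, ?_, by abel, by abel⟩ <;>
  simp [sub_dotProduct, dotProduct_sub, hg, hfg, hw, h1, h2, dotProduct_comm g w,
    dotProduct_comm f w]

/-- Simple roots of type `A₄` in `ℤⁿ` are differences of unit vectors. -/
lemma exists_sub_eq_four {v : Fin 4 → ι → ℤ} (h : ∀ i j, v i ⬝ᵥ v j =
    if i = j then 2 else if (i : ℕ) + 1 = j ∨ (j : ℕ) + 1 = i then -1 else 0) :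
    ∃ e : Fin 5 → ι → ℤ, (∀ i j, e i ⬝ᵥ e j = if i = j then 1 else 0) ∧
      ∀ i : Fin 4, v i = e i.castSucc - e i.succ := by
  have h00 : v 0 ⬝ᵥ v 0 = 2 := by simp [h]
  have h11 : v 1 ⬝ᵥ v 1 = 2 := by simp [h]
  have h22 : v 2 ⬝ᵥ v 2 = 2 := by simp [h]
  have h33 : v 3 ⬝ᵥ v 3 = 2 := by simp [h]
  have h10 : v 1 ⬝ᵥ v 0 = -1 := by simp [h]
  have h20 : v 2 ⬝ᵥ v 0 = 0 := by simp [h]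
  have h21 : v 2 ⬝ᵥ v 1 = -1 := by simp [h]
  have h30 : v 3 ⬝ᵥ v 0 = 0 := by simp [h]
  have h31 : v 3 ⬝ᵥ v 1 = 0 := by simp [h]
  have h32 : v 3 ⬝ᵥ v 2 = -1 := by simp [h]
  obtain ⟨a, b, d, ha, hb, hd, hab, had, hbd, e0, e1⟩ := exists_sub_eq_two h00 h11 h10
  rw [e0, dotProduct_sub] at h20 h30
  rw [e1, dotProduct_sub] at h21 h31
  have hB2 := bessel_three (x := v 2) ha hb hd hab had hbd
  have hv2a : v 2 ⬝ᵥ a = 0 := by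
    by_contra hne
    have h1 : v 2 ⬝ᵥ a ≤ 0 := by nlinarith
    have h2 : -1 ≤ v 2 ⬝ᵥ a := by nlinarith
    have h3 : v 2 ⬝ᵥ a = -1 := by omega
    have h4 : v 2 = -a - b := by
      have : (v 2 + a + b) ⬝ᵥ (v 2 + a + b) = 0 := by
        simp only [add_dotProduct, dotProduct_add, ha, hb, hab, h22, dotProduct_comm a (v 2),
          dotProduct_comm b (v 2), dotProduct_comm b a]
        omega
      have := dotProduct_self_eq_zero.1 this
      rw [← sub_eq_zero, ← this]; abel
    rw [h4, dotProduct_sub, dotProduct_neg] at h32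
    omega
  have hv2b : v 2 ⬝ᵥ b = 0 := by omega
  have hv2d : v 2 ⬝ᵥ d = 1 := by omega
  obtain ⟨e, he⟩ : ∃ e, e = d - v 2 := ⟨_, rfl⟩
  have hee : e ⬝ᵥ e = 1 := by
    simp [he, sub_dotProduct, dotProduct_sub, hd, h22, hv2d, dotProduct_comm d (v 2)]
  have hae : a ⬝ᵥ e = 0 := by simp [he, dotProduct_sub, had, dotProduct_comm a (v 2), hv2a]
  have hbe : b ⬝ᵥ e = 0 := by simp [he, dotProduct_sub, hbd, dotProduct_comm b (v 2), hv2b]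
  have hde : d ⬝ᵥ e = 0 := by simp [he, dotProduct_sub, hd, dotProduct_comm d (v 2), hv2d]
  have e2 : v 2 = d - e := by rw [he]; abel
  rw [e2, dotProduct_sub] at h32
  have hB3 := bessel_four (x := v 3) ha hb hd hee hab had hbd hae hbe hde
  have hv3a : v 3 ⬝ᵥ a = 0 := by
    have h1 : v 3 ⬝ᵥ b = v 3 ⬝ᵥ a := by omega
    have h2 : v 3 ⬝ᵥ d = v 3 ⬝ᵥ a := by omega
    have h3 : v 3 ⬝ᵥ e = v 3 ⬝ᵥ a + 1 := by omega
    rw [h1, h2, h3, h33] at hB3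
    have h4 : v 3 ⬝ᵥ a ≤ 0 := by nlinarith
    have h5 : -1 < v 3 ⬝ᵥ a := by nlinarith
    omega
  have hv3b : v 3 ⬝ᵥ b = 0 := by omega
  have hv3d : v 3 ⬝ᵥ d = 0 := by omega
  have hv3e : v 3 ⬝ᵥ e = 1 := by omega
  obtain ⟨f, hf⟩ : ∃ f, f = e - v 3 := ⟨_, rfl⟩
  have hff : f ⬝ᵥ f = 1 := by
    simp [hf, sub_dotProduct, dotProduct_sub, hee, h33, hv3e, dotProduct_comm e (v 3)]
  have haf : a ⬝ᵥ f = 0 := by simp [hf, dotProduct_sub, hae, dotProduct_comm a (v 3), hv3a]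
  have hbf : b ⬝ᵥ f = 0 := by simp [hf, dotProduct_sub, hbe, dotProduct_comm b (v 3), hv3b]
  have hdf : d ⬝ᵥ f = 0 := by simp [hf, dotProduct_sub, hde, dotProduct_comm d (v 3), hv3d]
  have hef : e ⬝ᵥ f = 0 := by simp [hf, dotProduct_sub, hee, dotProduct_comm e (v 3), hv3e]
  have e3 : v 3 = e - f := by rw [hf]; abel
  refine ⟨![a, b, d, e, f], ?_, ?_⟩
  · have hsymm : ∀ x y : ι → ℤ, x ⬝ᵥ y = 0 → y ⬝ᵥ x = 0 := fun x y h => by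
      rw [dotProduct_comm, h]
    intro i j
    fin_cases i <;> fin_cases j <;> simp [ha, hb, hd, hee, hff, hab, had, hae, haf, hbd, hbe, hbf,
      hde, hdf, hef, hsymm _ _ hab, hsymm _ _ had, hsymm _ _ hae, hsymm _ _ haf, hsymm _ _ hbd,
      hsymm _ _ hbe, hsymm _ _ hbf, hsymm _ _ hde, hsymm _ _ hdf, hsymm _ _ hef]
  · intro i
    fin_cases i
    exacts [e0, e1, e2, e3]

/-- A vector with small entries is determined by its consecutive differences. -/
lemma eq_of_sub_eq {y z : Fin 5 → ℤ} (hy : ∑ i, y i ^ 2 ≤ 2) (hz : ∑ i, z i ^ 2 ≤ 2)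
    (h : ∀ i : Fin 4, y i.castSucc - y i.succ = z i.castSucc - z i.succ) : y = z := by
  have h0 := h 0
  have h1 := h 1
  have h2 := h 2
  have h3 := h 3
  simp only [Fin.castSucc_zero, Fin.succ_zero_eq_one, Fin.castSucc_one, Fin.succ_one_eq_two,
    Fin.reduceCastSucc, Fin.reduceSucc] at h0 h1 h2 h3
  have key : y 0 = z 0 := by
    by_contra hne
    have hne' : ∀ i, y i ≠ z i := by
      intro i
      fin_cases i <;> simp <;> omega
    have h4 : ∀ i, 1 ≤ y i ^ 2 + z i ^ 2 := by
      intro i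
      by_contra hc
      have h5 : y i ^ 2 + z i ^ 2 = 0 := le_antisymm (by omega) (by positivity)
      have h6 : y i = 0 := by nlinarith [sq_nonneg (y i), sq_nonneg (z i)]
      have h7 : z i = 0 := by nlinarith [sq_nonneg (y i), sq_nonneg (z i)]
      exact hne' i (h6.trans h7.symm)
    have h8 : ∑ i : Fin 5, (1 : ℤ) ≤ ∑ i, (y i ^ 2 + z i ^ 2) := Finset.sum_le_sum fun i _ => h4 i
    rw [Finset.sum_add_distrib] at h8
    simp at h8
    omega
  funext i
  fin_cases i <;> simp <;> omega

end CartanA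


section GlobalRep

variable {V : Type*} {A : V → V → ℤ} {F : Finset V} {lam kap : ℝ}

lemma sum_sq_fin_dotProduct_le {ι : Type*} [Fintype ι] {n : ℕ} {e : Fin n → ι → ℤ}
    (he : ∀ i j, e i ⬝ᵥ e j = if i = j then 1 else 0) (x : ι → ℤ) :
    ∑ i, (x ⬝ᵥ e i) ^ 2 ≤ x ⬝ᵥ x := by
  have := sum_sq_dotProduct_le (fun j => if h : j < n then e ⟨j, h⟩ else 0) n
    (fun j hj => by simp [hj, he])
    (fun j k hjk hk => by
      simp only [hjk.trans hk, hk, dif_pos, he]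
      rw [if_neg]; intro h; simp at h; omega) x
  rw [Finset.sum_range] at this
  simpa using this

lemma sum_of_unit {ι : Type*} [Fintype ι] {f : ι → ℤ} (hf : f ⬝ᵥ f = 1) :
    ∑ k, f k = 1 ∨ ∑ k, f k = -1 := by
  obtain ⟨k, hk⟩ : ∃ k, f k ≠ 0 := by
    by_contra! hv
    simp [dotProduct, hv] at hf
  have h1 : (f - Pi.single k (f k)) ⬝ᵥ (f - Pi.single k (f k)) = 1 - f k * f k := by
    simp [sub_dotProduct, dotProduct_sub, hf]
  have h2 := dotProduct_self_nonneg_int (f - Pi.single k (f k))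
  rw [h1] at h2
  have h3 : f k * f k = 1 := by nlinarith [mul_self_pos.2 hk]
  rw [h3, sub_self] at h1
  have h4 : f = Pi.single k (f k) := sub_eq_zero.1 (dotProduct_self_eq_zero.1 h1)
  have h5 : ∑ j, f j = f k := by
    rw [h4]; simp
  rw [h5]
  exact mul_self_eq_one_iff.1 h3

/-- Integer combinations of five vertices forming a simple system of type `A₄`. -/
def CartanBase (A : V → V → ℤ) (w : Fin 5 → V) (c : Fin 4 → Fin 5 → ℤ) : Prop :=
  ∀ i j, ∑ k, ∑ l, c i k * c j l * rootGram A 0 (w k) (w l) =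
    if i = j then 2 else if (i : ℕ) + 1 = j ∨ (j : ℕ) + 1 = i then -1 else 0

lemma exists_cartanBase_of_path (hA : IsSignedAdj A) {w : ℕ → V}
    (h1 : ∀ i < 3, A (w i) (w (i + 1)) ≠ 0)
    (h0 : ∀ i j, i + 2 ≤ j → j ≤ 3 → A (w i) (w j) = 0) (hne : ∀ i j, i < j → j ≤ 3 → w i ≠ w j) :
    ∃ w c, CartanBase A w c := by
  have hsq : ∀ i < 3, A (w i) (w (i + 1)) * A (w i) (w (i + 1)) = 1 := by
    intro i hi
    rcases hA.entries (w i) (w (i + 1)) with h | h | h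
    · rw [h]; rfl
    · exact absurd h (h1 i hi)
    · rw [h]; rfl
  set σ : Fin 4 → ℤ := ![1, -A (w 0) (w 1), A (w 0) (w 1) * A (w 1) (w 2),
    -(A (w 0) (w 1) * A (w 1) (w 2) * A (w 2) (w 3))] with hσ
  refine ⟨fun k => w k, fun i k => if k = i.castSucc then σ i else 0, ?_⟩
  intro i j
  have e : ∑ k : Fin 5, ∑ l : Fin 5, (if k = i.castSucc then σ i else 0) *
      (if l = j.castSucc then σ j else 0) * rootGram A 0 (w k) (w l) =
      σ i * σ j * rootGram A 0 (w i) (w j) := by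
    simp [ite_mul, mul_ite]
  rw [e]
  have g0 : ∀ i ≤ 3, rootGram A 0 (w i) (w i) = 2 := fun i _ => by simp [rootGram, hA.diag]
  have g1 : ∀ i j, i < j → j ≤ 3 → rootGram A 0 (w i) (w j) = A (w i) (w j) := fun i j h h' => by
    simp [rootGram, hne i j h h']
  have g2 : ∀ i j, i < j → j ≤ 3 → rootGram A 0 (w j) (w i) = A (w i) (w j) := fun i j h h' => by
    rw [rootGram_comm hA, g1 i j h h']
  have hpm : ∀ i < 3, A (w i) (w (i + 1)) = 1 ∨ A (w i) (w (i + 1)) = -1 := fun i hi =>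
    mul_self_eq_one_iff.1 (hsq i hi)
  have z02 := h0 0 2 (by norm_num) (by norm_num)
  have z03 := h0 0 3 (by norm_num) (by norm_num)
  have z13 := h0 1 3 (by norm_num) (by norm_num)
  have g02 := g1 0 2 (by norm_num) (by norm_num)
  have g03 := g1 0 3 (by norm_num) (by norm_num)
  have g13 := g1 1 3 (by norm_num) (by norm_num)
  have g01 := g1 0 1 (by norm_num) (by norm_num)
  have g12 := g1 1 2 (by norm_num) (by norm_num)
  have g23 := g1 2 3 (by norm_num) (by norm_num)
  have g20 := g2 0 2 (by norm_num) (by norm_num)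
  have g30 := g2 0 3 (by norm_num) (by norm_num)
  have g31 := g2 1 3 (by norm_num) (by norm_num)
  have g10 := g2 0 1 (by norm_num) (by norm_num)
  have g21 := g2 1 2 (by norm_num) (by norm_num)
  have g32 := g2 2 3 (by norm_num) (by norm_num)
  have g00 := g0 0 (by norm_num)
  have g11 := g0 1 (by norm_num)
  have g22 := g0 2 (by norm_num)
  have g33 := g0 3 (by norm_num)
  clear hsq g0 g1 g2 h0 h1 e
  rcases hpm 0 (by norm_num) with a01 | a01 <;> rcases hpm 1 (by norm_num) with a12 | a12 <;>
    rcases hpm 2 (by norm_num) with a23 | a23 <;>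
    simp only [zero_add, Nat.reduceAdd] at a01 a12 a23 <;>
    simp only [a01, a12, a23, z02, z03, z13] at * <;>
    fin_cases i <;> fin_cases j <;>
    simp [hσ, g00, g11, g22, g33, g01, g12, g23, g10, g21, g32, g02, g03, g13, g20, g30, g31]

lemma exists_cartanBase_of_clique {w : Fin 5 → V} {ε : Fin 5 → ℤ}
    (h : ∀ k l, ε k * ε l * rootGram A 0 (w k) (w l) = if k = l then 2 else 1) :
    ∃ w c, CartanBase A w c := by
  refine ⟨w, fun i k => (if k = i.castSucc then 1 else if k = i.succ then -1 else 0) * ε k, ?_⟩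
  intro i j
  have e : ∀ k l : Fin 5, ((if k = i.castSucc then 1 else if k = i.succ then -1 else 0) * ε k) *
      ((if l = j.castSucc then 1 else if l = j.succ then -1 else 0) * ε l) *
      rootGram A 0 (w k) (w l) = (if k = i.castSucc then 1 else if k = i.succ then -1 else 0) *
      (if l = j.castSucc then 1 else if l = j.succ then -1 else 0) * if k = l then 2 else 1 := by
    intro k l
    rw [← h]; ring
  simp only [e]
  clear e h
  revert i j
  decide

/-- A vertex of degree at least seventeen in a represented signed graph gives a simple system of
type `A₄`. -/
lemma exists_cartanBase_of_degree (hA : IsSignedAdj A) {v : V} {U : Finset V}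
    (hU : ∀ u ∈ U, A v u ≠ 0) (hc : 17 ≤ U.card) (h : RootRep A 0 (insert v U)) :
    ∃ w c, CartanBase A w c := by
  obtain ⟨ι, _, φ, hφ⟩ := h
  have hvU : v ∉ U := fun h => hU v h (hA.diag v)
  have hself : ∀ x ∈ insert v U, φ x ⬝ᵥ φ x = 2 := fun x hx => by
    rw [hφ x hx x hx]; simp [rootGram, hA.diag]
  have hdist : ∀ x ∈ insert v U, ∀ y ∈ insert v U, x ≠ y → φ x ⬝ᵥ φ y = A x y :=
    fun x hx y hy hxy => by rw [hφ x hx y hy]; simp [rootGram, hxy]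
  obtain ⟨a, b, ha, hb, hab, hv⟩ := exists_add_eq_of_dotProduct_self (hself v (by simp))
  have hcases : ∀ u ∈ U, ((φ u ⬝ᵥ a) * (φ u ⬝ᵥ a) = 1 ∨ (φ u ⬝ᵥ b) * (φ u ⬝ᵥ b) = 1) := by
    intro u hu
    have h1 := bessel_two (x := φ u) ha hb hab
    rw [hself u (by simp [hu])] at h1
    have h2 : φ u ⬝ᵥ a + φ u ⬝ᵥ b = A v u := by
      rw [← dotProduct_add, ← hv, dotProduct_comm, hdist v (by simp) u (by simp [hu])
        (fun e => hvU (e ▸ hu))]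
    have h3 := hU u hu
    have h4 : φ u ⬝ᵥ a ≠ 0 ∨ φ u ⬝ᵥ b ≠ 0 := by
      by_contra! hc
      rw [hc.1, hc.2] at h2
      exact h3 h2.symm
    have hu1 : ∀ x y : ℤ, x ^ 2 + y ^ 2 ≤ 2 → x ≠ 0 → x * x = 1 := by
      intro x y h hx
      have h5 : x ≤ 1 := by nlinarith [sq_nonneg y]
      have h6 : -1 ≤ x := by nlinarith [sq_nonneg y]
      interval_cases x <;> simp_all
    rcases h4 with h4 | h4
    · exact Or.inl (hu1 _ _ h1 h4)
    · exact Or.inr (hu1 (φ u ⬝ᵥ b) (φ u ⬝ᵥ a) (by linarith) h4)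
  have hpart : ∃ f : ι → ℤ, f ⬝ᵥ f = 1 ∧ ∃ U' ⊆ U, 9 ≤ U'.card ∧
      ∀ u ∈ U', (φ u ⬝ᵥ f) * (φ u ⬝ᵥ f) = 1 := by
    have h1 : U.card ≤ (U.filter fun u => (φ u ⬝ᵥ a) * (φ u ⬝ᵥ a) = 1).card +
        (U.filter fun u => (φ u ⬝ᵥ b) * (φ u ⬝ᵥ b) = 1).card := by
      refine le_trans (Finset.card_le_card ?_) (Finset.card_union_le _ _)
      intro u hu
      simp only [Finset.mem_union, Finset.mem_filter, hu, true_and]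
      exact hcases u hu
    by_cases h2 : 9 ≤ (U.filter fun u => (φ u ⬝ᵥ a) * (φ u ⬝ᵥ a) = 1).card
    · exact ⟨a, ha, _, Finset.filter_subset _ _, h2, fun u hu => (Finset.mem_filter.1 hu).2⟩
    · exact ⟨b, hb, _, Finset.filter_subset _ _, by omega, fun u hu => (Finset.mem_filter.1 hu).2⟩
  obtain ⟨f, hf, U', hU', hc', hUf⟩ := hpart
  set ε : V → ℤ := fun u => φ u ⬝ᵥ f with hε
  set θ : V → ι → ℤ := fun u => ε u • φ u - f with hθ
  have hθθ : ∀ u ∈ U', θ u ⬝ᵥ θ u = 1 := by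
    intro u hu
    have h1 := hself u (by simp [hU' hu])
    have h2 := hUf u hu
    simp only [hθ, sub_dotProduct, dotProduct_sub, smul_dotProduct, dotProduct_smul, h1, hf,
      dotProduct_comm f (φ u), smul_eq_mul]
    simp only [hε]
    linear_combination 0 * h2
  have hsum : ∀ u ∈ U', ∑ k, θ u k = 1 ∨ ∑ k, θ u k = -1 := fun u hu => sum_of_unit (hθθ u hu)
  have hgram : ∀ u ∈ U', ∀ u' ∈ U', u ≠ u' → ∑ k, θ u k = ∑ k, θ u' k →
      ε u * ε u' * A u u' = 1 := by
    intro u hu u' hu' hne hs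
    have h1 : ∀ u ∈ U', θ u ⬝ᵥ f = 0 := fun u hu => by
      have := hUf u hu
      simp only [hθ, sub_dotProduct, smul_dotProduct, hf, smul_eq_mul]
      simp only [hε]
      omega
    have h2 : ∀ u, ε u • φ u = f + θ u := fun u => by simp [hθ]
    have h3 : ε u * ε u' * A u u' = (ε u • φ u) ⬝ᵥ (ε u' • φ u') := by
      rw [smul_dotProduct, dotProduct_smul, hdist u (by simp [hU' hu]) u' (by simp [hU' hu']) hne,
        smul_eq_mul, smul_eq_mul, mul_assoc]
    have h4 : ε u * ε u' * A u u' = 1 + θ u ⬝ᵥ θ u' := by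
      rw [h3, h2, h2, add_dotProduct, dotProduct_add, dotProduct_add, hf, dotProduct_comm f (θ u'),
        h1 u hu, h1 u' hu']
      ring
    have h5 := bessel_two (x := θ u) (hθθ u' hu') hf (h1 u' hu')
    rw [h1 u hu, hθθ u hu] at h5
    have h6 : θ u ⬝ᵥ θ u' ≠ -1 := by
      intro h6
      have h7 : (θ u + θ u') ⬝ᵥ (θ u + θ u') = 0 := by
        rw [add_dotProduct, dotProduct_add, dotProduct_add, dotProduct_comm (θ u') (θ u), h6,
          hθθ u hu, hθθ u' hu']
        norm_num
      have h8 : ∑ k, (θ u + θ u') k = 0 := by rw [dotProduct_self_eq_zero.1 h7]; simp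
      simp only [Pi.add_apply, Finset.sum_add_distrib, ← hs] at h8
      rcases hsum u hu with h | h <;> omega
    have h7 : ε u = 1 ∨ ε u = -1 := mul_self_eq_one_iff.1 (hUf u hu)
    have h8 : ε u' = 1 ∨ ε u' = -1 := mul_self_eq_one_iff.1 (hUf u' hu')
    have h9 : -1 ≤ θ u ⬝ᵥ θ u' := by nlinarith
    have h10 : ε u * ε u' * A u u' ≤ 1 := by
      rcases h7 with h7 | h7 <;> rcases h8 with h8 | h8 <;>
        rcases hA.entries u u' with h | h | h <;> rw [h7, h8, h] <;> norm_num
    omega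
  obtain ⟨S, hS, hSc, hSs⟩ : ∃ S ⊆ U', S.card = 5 ∧
      ∀ u ∈ S, ∀ u' ∈ S, ∑ k, θ u k = ∑ k, θ u' k := by
    have h1 : U'.card ≤ (U'.filter fun u => ∑ k, θ u k = 1).card +
        (U'.filter fun u => ∑ k, θ u k = -1).card := by
      refine le_trans (Finset.card_le_card ?_) (Finset.card_union_le _ _)
      intro u hu
      simp only [Finset.mem_union, Finset.mem_filter, hu, true_and]
      exact hsum u hu
    have h2 : ∃ t, 5 ≤ (U'.filter fun u => ∑ k, θ u k = t).card := by
      by_cases h2 : 5 ≤ (U'.filter fun u => ∑ k, θ u k = 1).card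
      · exact ⟨1, h2⟩
      · exact ⟨-1, by omega⟩
    obtain ⟨t, ht⟩ := h2
    obtain ⟨S, hS, hSc⟩ := Finset.exists_subset_card_eq ht
    refine ⟨S, hS.trans (Finset.filter_subset _ _), hSc, fun u hu u' hu' => ?_⟩
    rw [(Finset.mem_filter.1 (hS hu)).2, (Finset.mem_filter.1 (hS hu')).2]
  set w : Fin 5 → V := fun k => ((S.equivFinOfCardEq hSc).symm k : V) with hw
  have hwS : ∀ k, w k ∈ S := fun k => ((S.equivFinOfCardEq hSc).symm k).2
  refine exists_cartanBase_of_clique (w := w) (ε := fun k => ε (w k)) fun k l => ?_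
  by_cases hkl : k = l
  · subst hkl
    rw [if_pos rfl, hUf _ (hS (hwS k))]
    simp [rootGram, hA.diag]
  · have hne : w k ≠ w l := fun e => hkl (by simpa [hw, Subtype.ext_iff] using e)
    rw [if_neg hkl, rootGram_of_ne (A := A) (s := 0) hne (Or.inl rfl)]
    exact hgram _ (hS (hwS k)) _ (hS (hwS l)) hne (hSs _ (hwS k) _ (hwS l))

end GlobalRep


section Form

variable {V : Type*} [Fintype V] {A : V → V → ℤ} {F : Finset V} {lam kap : ℝ}

/-- The form of `2 + A` is the norm in a representation by integer vectors. -/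
lemma shiftBilin_two_of_rep {ι : Type*} [Fintype ι] {φ : V → ι → ℤ}
    (hφ : ∀ x ∈ F, ∀ y ∈ F, φ x ⬝ᵥ φ y = rootGram A 0 x y) {x : V → ℝ}
    (hx : ∀ v, v ∉ F → x v = 0) :
    shiftBilin A 2 x x = ∑ k, (∑ v, x v * φ v k) ^ 2 := by
  have h1 : ∀ v w, x v * x w * ∑ k, (φ v k : ℝ) * φ w k =
      (if v = w then 2 * (x v * x w) else 0) + A v w * x v * x w := by
    intro v w
    by_cases hv : v ∈ F
    · by_cases hw : w ∈ F
      · have := hφ v hv w hw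
        simp only [dotProduct, rootGram] at this
        have h2 : ∑ k, (φ v k : ℝ) * φ w k = (if v = w then 2 else 0) + A v w := by
          have h3 := congrArg (Int.cast : ℤ → ℝ) this
          push_cast at h3
          rw [h3]; simp
        rw [h2]
        split_ifs <;> ring
      · simp [hx w hw]
    · simp [hx v hv]
  have h2 : ∀ k, (∑ v, x v * (φ v k : ℝ)) ^ 2 = ∑ v, ∑ w, x v * x w * (φ v k * φ w k) := by
    intro k
    rw [sq, Finset.sum_mul_sum]
    exact Finset.sum_congr rfl fun _ _ => Finset.sum_congr rfl fun _ _ => by ring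
  simp only [h2]
  rw [Finset.sum_comm]
  simp only [Finset.sum_comm (s := (Finset.univ : Finset ι))]
  simp only [← Finset.mul_sum, h1, Finset.sum_add_distrib, shiftBilin]
  simp [Finset.mul_sum]

lemma RootRep.good (h : RootRep A 0 F) (hl : 2 ≤ lam) : Good A lam F := by
  obtain ⟨ι, _, φ, hφ⟩ := h
  refine Good.mono_lam (lam := 2) (fun x hx => ?_) hl
  rw [shiftBilin_two_of_rep hφ hx]
  positivity

/-- A unit vector defines a root of a represented signed graph. -/
lemma rootGood_of_unit {ι : Type*} [Fintype ι] {φ : V → ι → ℤ}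
    (hφ : ∀ x ∈ F, ∀ y ∈ F, φ x ⬝ᵥ φ y = rootGram A 0 x y) {e : ι → ℤ} (he : e ⬝ᵥ e = 1)
    {s : V → ℤ} (hs : ∀ x ∈ F, s x = φ x ⬝ᵥ e) (hl : 2 ≤ lam) (hk : kap ≤ 1) :
    RootGood A lam kap F s := by
  refine RootGood.mono_param (lam := 2) (kap := 1) (fun x hx => ?_) hl hk
  rw [shiftBilin_two_of_rep hφ hx, one_mul]
  have h1 : ∑ v, (s v : ℝ) * x v = ∑ k, (∑ v, x v * φ v k) * (e k : ℝ) := by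
    simp only [Finset.sum_mul]
    rw [Finset.sum_comm]
    refine Finset.sum_congr rfl fun v _ => ?_
    by_cases hv : v ∈ F
    · rw [hs v hv, dotProduct]
      push_cast
      rw [Finset.sum_mul]
      exact Finset.sum_congr rfl fun _ _ => by ring
    · simp [hx v hv]
  have h2 : ∑ k, (e k : ℝ) ^ 2 = 1 := by
    have := congrArg (Int.cast : ℤ → ℝ) he
    simp only [dotProduct] at this
    push_cast at this
    simpa [sq] using this
  rw [h1]
  have := Finset.sum_mul_sq_le_sq_mul_sq Finset.univ (fun k => ∑ v, x v * (φ v k : ℝ))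
    (fun k => (e k : ℝ))
  rwa [h2, mul_one] at this

/-- A signed graph containing a simple system of type `A₄`, all of whose small subgraphs are
represented by integer vectors, is so represented. -/
theorem RootRep.of_cartanBase (hA : IsSignedAdj A) (hb : RootBound lam kap) {M : ℕ}
    (hM : kap ≤ pathWeight lam M)
    (hconn : RelConn (fun x y => A x y ≠ 0) (Finset.univ : Finset V))
    {w : Fin 5 → V} {c : Fin 4 → Fin 5 → ℤ} (hw : CartanBase A w c)
    (hrep : ∀ F : Finset V, F.card ≤ M + 11 → RootRep A 0 F) : RootRep A 0 Finset.univ := by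
  set B : Finset V := Finset.univ.image w with hB
  have hBc : B.card ≤ 5 := Finset.card_image_le.trans (by simp)
  have hwB : ∀ k, w k ∈ B := fun k => Finset.mem_image_of_mem w (Finset.mem_univ k)
  set P : V → (Fin 5 → ℤ) → Prop := fun x y =>
    (∀ i : Fin 4, y i.castSucc - y i.succ = ∑ k, c i k * rootGram A 0 x (w k)) ∧
      ∑ i, y i ^ 2 ≤ 2 with hP
  set s : V → ℤ := fun x => if h : ∃ y, P x y then h.choose 0 else 0 with hs
  have hsP : ∀ x y, P x y → s x = y 0 := by
    intro x y hy
    have h : ∃ y, P x y := ⟨y, hy⟩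
    simp only [hs, dif_pos h]
    rw [eq_of_sub_eq h.choose_spec.2 hy.2 fun i => by rw [h.choose_spec.1, hy.1]]
  have key : ∀ F : Finset V, F.card ≤ M + 11 → B ⊆ F → ∃ (ι : Type) (_ : Fintype ι)
      (φ : V → ι → ℤ) (e : Fin 5 → ι → ℤ), (∀ x ∈ F, ∀ y ∈ F, φ x ⬝ᵥ φ y = rootGram A 0 x y) ∧
      (∀ i j, e i ⬝ᵥ e j = if i = j then 1 else 0) ∧
      (∀ i : Fin 4, ∑ k, c i k • φ (w k) = e i.castSucc - e i.succ) ∧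
      ∀ x ∈ F, P x fun i => φ x ⬝ᵥ e i := by
    intro F hF hBF
    obtain ⟨ι, _, φ, hφ⟩ := hrep F hF
    obtain ⟨e, he, hev⟩ := exists_sub_eq_four (v := fun i => ∑ k, c i k • φ (w k)) (by
      intro i j
      rw [← hw i j]
      simp only [sum_dotProduct, dotProduct_sum, smul_dotProduct, dotProduct_smul, smul_eq_mul,
        Finset.mul_sum]
      rw [Finset.sum_comm]
      refine Finset.sum_congr rfl fun k _ => Finset.sum_congr rfl fun l _ => ?_
      rw [hφ _ (hBF (hwB k)) _ (hBF (hwB l))]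
      ring)
    refine ⟨ι, inferInstance, φ, e, hφ, he, hev, fun x hx => ⟨fun i => ?_, ?_⟩⟩
    · rw [← dotProduct_sub, ← hev]
      simp only [dotProduct_sum, dotProduct_smul, smul_eq_mul]
      exact Finset.sum_congr rfl fun k _ => by rw [hφ x hx _ (hBF (hwB k))]
    · refine (sum_sq_fin_dotProduct_le he (φ x)).trans ?_
      rw [hφ x hx x hx]
      simp [rootGram, hA.diag]
  have hent : ∀ x, s x = -1 ∨ s x = 0 ∨ s x = 1 := by
    intro x
    obtain ⟨ι, _, φ, e, hφ, he, hev, hPx⟩ := key (insert x B)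
      ((Finset.card_insert_le _ _).trans (by omega)) (Finset.subset_insert _ _)
    have h1 := hPx x (by simp)
    have h2 := hsP x (fun i => φ x ⬝ᵥ e i) h1
    have h3 : s x ^ 2 ≤ 2 := by
      rw [h2]
      exact (Finset.single_le_sum (f := fun i => (φ x ⬝ᵥ e i) ^ 2) (fun i _ => sq_nonneg _)
        (Finset.mem_univ 0)).trans h1.2
    have h4 : s x ≤ 1 := by nlinarith
    have h5 : -1 ≤ s x := by nlinarith
    omega
  have hgood : ∀ X : Finset V, X.card ≤ M + 6 → RootGood A lam kap X s := by
    intro X hX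
    obtain ⟨ι, _, φ, e, hφ, he, hev, hPx⟩ := key (X ∪ B)
      ((Finset.card_union_le _ _).trans (by omega)) Finset.subset_union_right
    refine RootGood.mono (F := X ∪ B) ?_ Finset.subset_union_left
    exact rootGood_of_unit hφ (e := e 0) (by simp [he]) (fun x hx => hsP x (fun i => φ x ⬝ᵥ e i) (hPx x hx)) hb.two_le
      hb.kap_le
  have hne : ∃ k, s (w k) ≠ 0 := by
    by_contra! h0
    obtain ⟨ι, _, φ, e, hφ, he, hev, hPx⟩ := key B (by omega) subset_rfl
    have h1 := congrArg (fun z => z ⬝ᵥ e 0) (hev 0)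
    simp only [sum_dotProduct, smul_dotProduct, sub_dotProduct, he] at h1
    rw [Finset.sum_eq_zero fun k _ => by rw [← hsP (w k) (fun i => φ (w k) ⬝ᵥ e i) (hPx _ (hwB k)),
        h0, smul_zero]] at h1
    simp at h1
  obtain ⟨k, hk⟩ := hne
  have hroot := rootClass_localRootGood hA hb (R := M + 6) hM le_rfl
    fun X hX => (hrep X (by omega)).good hb.two_le
  refine (RootClass.rootRep hA hroot (s := s) ⟨fun x _ => hent x, 0, trivial,
    fun X _ hX => hgood X hX⟩ ?_).zero_root
  intro Y hY hYne hout
  have := hconn Y hY hYne fun y hy z hz hzY h => h (hout y hy z hz hzY)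
  exact ⟨w k, by simp [this], hk⟩

/-- Large connected signed graphs all of whose small subgraphs are good are represented by integer
vectors. -/
theorem exists_rootRep_univ_of_card {lam kap : ℝ} (hb : RootBound lam kap) :
    ∃ N R : ℕ, ∀ {V : Type} [Fintype V] {A : V → V → ℤ}, IsSignedAdj A →
      RelConn (fun x y => A x y ≠ 0) (Finset.univ : Finset V) → N ≤ Fintype.card V →
      (∀ X : Finset V, X.card ≤ R → Good A lam X) → RootRep A 0 Finset.univ := by
  obtain ⟨M, hM⟩ := exists_le_pathWeight hb.two_le hb.unstable hb.kap_le
  obtain ⟨N, R, h⟩ := exists_rootRep_of_card hb (M + 18)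
  refine ⟨max N (18 ^ 3 + 1), R, ?_⟩
  intro V _ A hA hconn hcard hgood
  have hrep := h hA hconn (le_trans (le_max_left _ _) hcard) hgood
  have hcard' : 18 ^ 3 < Fintype.card V := le_trans (le_max_right _ _) hcard
  have hpos : 0 < Fintype.card V := by omega
  obtain ⟨x⟩ := Fintype.card_pos_iff.1 hpos
  obtain ⟨w, c, hw⟩ : ∃ w c, CartanBase A w c := by
    rcases exists_geodesic_or_degree hconn (F := {x}) (Finset.singleton_nonempty x) (M := 3)
      (D := 17) (by simpa using hcard') with ⟨w, hw0, hw⟩ | ⟨v, -, hdeg⟩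
    · have hb : ∀ i ≤ 3, w i ∈ relBall (fun x y => A x y ≠ 0) {x} i := by
        intro i hi
        cases i with
        | zero => exact hw0
        | succ i => exact (hw i (by omega)).2.1
      refine exists_cartanBase_of_path hA (fun i hi => (hw i hi).1) ?_ ?_
      · intro i j hij hj
        obtain ⟨j, rfl⟩ : ∃ l, j = l + 1 := ⟨j - 1, by omega⟩
        by_contra hne
        have h1 : w (j + 1) ∈ relBall (fun x y => A x y ≠ 0) {x} (i + 1) :=
          mem_relBall_succ.2 (Or.inr ⟨w i, hb i (by omega), hne⟩)
        exact (hw j (by omega)).2.2 (relBall_mono (by omega) h1)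
      · intro i j hij hj e
        obtain ⟨j, rfl⟩ : ∃ l, j = l + 1 := ⟨j - 1, by omega⟩
        exact (hw j (by omega)).2.2 (e ▸ relBall_mono (by omega) (hb i (by omega)))
    · obtain ⟨U, hU, hUc⟩ := Finset.exists_subset_card_eq hdeg.le
      refine exists_cartanBase_of_degree hA (v := v) (U := U)
        (fun u hu => by have := hU hu; simpa using this) hUc.ge (hrep _ ?_)
      exact (Finset.card_insert_le _ _).trans (by omega)
  exact RootRep.of_cartanBase hA hb hM hconn hw fun F hF => hrep F (by omega)

end Form


section Coordinates

variable {ι : Type*} [Fintype ι]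

/-- An integer vector of norm two has two nonzero coordinates, both of them units. -/
lemma exists_coords_of_norm_two {a : ι → ℤ} (h : a ⬝ᵥ a = 2) :
    ∃ j k, j ≠ k ∧ a j ^ 2 = 1 ∧ a k ^ 2 = 1 ∧ ∀ l, l ≠ j → l ≠ k → a l = 0 := by
  have hsq : ∀ l, a l ^ 2 = if a l ≠ 0 then 1 else 0 := by
    intro l
    have h1 : a l * a l ≤ 2 := by
      rw [← h, dotProduct]
      exact Finset.single_le_sum (f := fun l => a l * a l) (fun _ _ => mul_self_nonneg _)
        (Finset.mem_univ l)
    have h2 : a l ≤ 1 := by nlinarith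
    have h3 : -1 ≤ a l := by nlinarith
    obtain e | e | e : a l = -1 ∨ a l = 0 ∨ a l = 1 := by omega
    all_goals simp [e]
  have hcard : (Finset.univ.filter fun l => a l ≠ 0).card = 2 := by
    have : ((Finset.univ.filter fun l => a l ≠ 0).card : ℤ) = 2 := by
      rw [← h, dotProduct, Finset.card_filter]
      push_cast
      exact Finset.sum_congr rfl fun l _ => by rw [← sq, hsq]
    exact_mod_cast this
  obtain ⟨j, k, hjk, he⟩ := Finset.card_eq_two.1 hcard
  have hmem : ∀ l, a l ≠ 0 ↔ l = j ∨ l = k := fun l => by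
    have := Finset.ext_iff.1 he l
    simpa using this
  refine ⟨j, k, hjk, ?_, ?_, fun l h1 h2 => ?_⟩
  · rw [hsq, if_pos ((hmem j).2 (Or.inl rfl))]
  · rw [hsq, if_pos ((hmem k).2 (Or.inr rfl))]
  · by_contra h3
    exact ((hmem l).1 h3).elim h1 h2

lemma exists_coord_of_norm_two {a : ι → ℤ} (h : a ⬝ᵥ a = 2) {j : ι} (hj : a j ≠ 0) :
    ∃ k, j ≠ k ∧ a j ^ 2 = 1 ∧ a k ^ 2 = 1 ∧ ∀ l, l ≠ j → l ≠ k → a l = 0 := by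
  obtain ⟨i, k, hik, hi, hk, h0⟩ := exists_coords_of_norm_two h
  rcases eq_or_ne j i with rfl | hji
  · exact ⟨k, hik, hi, hk, h0⟩
  · rcases eq_or_ne j k with rfl | hjk
    · exact ⟨i, hik.symm, hk, hi, fun l h1 h2 => h0 l h2 h1⟩
    · exact absurd (h0 j hji hjk) hj

lemma card_support_of_norm_two {a : ι → ℤ} (h : a ⬝ᵥ a = 2) :
    (Finset.univ.filter fun l => a l ≠ 0).card ≤ 2 := by
  obtain ⟨i, k, -, -, -, h0⟩ := exists_coords_of_norm_two h
  refine (Finset.card_le_card (t := {i, k}) fun l hl => ?_).trans Finset.card_le_two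
  have hl' : a l ≠ 0 := by simpa using hl
  by_contra h1
  simp only [Finset.mem_insert, Finset.mem_singleton, not_or] at h1
  exact hl' (h0 l h1.1 h1.2)

variable {V : Type*} [Fintype V] {A : V → V → ℤ} {φ : V → ι → ℤ}

lemma card_common_coords_le (hA : IsSignedAdj A)
    (hφ : ∀ x y, φ x ⬝ᵥ φ y = rootGram A 0 x y) {h k : ι} (hhk : h ≠ k) :
    (Finset.univ.filter fun u => φ u h ≠ 0 ∧ φ u k ≠ 0).card ≤ 2 := by
  have hnorm : ∀ x, φ x ⬝ᵥ φ x = 2 := fun x => by simp [hφ, rootGram, hA.diag]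
  have hsupp : ∀ u, φ u h ≠ 0 → φ u k ≠ 0 →
      φ u h ^ 2 = 1 ∧ φ u k ^ 2 = 1 ∧ ∀ l, l ≠ h → l ≠ k → φ u l = 0 := by
    intro u h1 h2
    obtain ⟨i, hi, h3, h4, h5⟩ := exists_coord_of_norm_two (hnorm u) h1
    obtain rfl : k = i := by
      by_contra hne
      exact h2 (h5 k hhk.symm hne)
    exact ⟨h3, h4, h5⟩
  refine (Finset.card_le_card_of_injOn (t := {1, -1}) (fun u => φ u h * φ u k) ?_ ?_).trans
    Finset.card_le_two
  · intro u hu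
    obtain ⟨h1, h2, -⟩ := hsupp u (by simpa using (Finset.mem_filter.1 hu).2.1)
      (by simpa using (Finset.mem_filter.1 hu).2.2)
    have : (φ u h * φ u k) ^ 2 = 1 := by rw [mul_pow, h1, h2]; rfl
    simpa using sq_eq_one_iff.1 this
  · intro u hu v hv huv
    obtain ⟨h1, h2, h3⟩ := hsupp u (by simpa using (Finset.mem_filter.1 hu).2.1)
      (by simpa using (Finset.mem_filter.1 hu).2.2)
    obtain ⟨h4, h5, h6⟩ := hsupp v (by simpa using (Finset.mem_filter.1 hv).2.1)
      (by simpa using (Finset.mem_filter.1 hv).2.2)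
    by_contra hne
    have hdot : φ u ⬝ᵥ φ v = φ u h * φ v h + φ u k * φ v k := by
      rw [dotProduct, ← Finset.sum_pair (f := fun l => φ u l * φ v l) hhk]
      refine (Finset.sum_subset (Finset.subset_univ _) fun l _ hl => ?_).symm
      simp only [Finset.mem_insert, Finset.mem_singleton, not_or] at hl
      rw [h3 l hl.1 hl.2, zero_mul]
    have hA2 : φ u ⬝ᵥ φ v = A u v := by rw [hφ]; simp [rootGram, hne]
    simp only at huv
    have := hA.entries u v
    rw [← hA2, hdot] at this
    rcases sq_eq_one_iff.1 h1 with e1 | e1 <;> rcases sq_eq_one_iff.1 h2 with e2 | e2 <;>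
      rcases sq_eq_one_iff.1 h4 with e3 | e3 <;>
      rcases sq_eq_one_iff.1 h5 with e4 | e4 <;> simp [e1, e2, e3, e4] at this huv

lemma exists_fresh_of_coord (hA : IsSignedAdj A) (hφ : ∀ x y, φ x ⬝ᵥ φ y = rootGram A 0 x y)
    (F : Finset V) {h : ι} (j : ι) {S : Finset V} (hS : ∀ u ∈ S, φ u h ≠ 0) {m : ℕ}
    (hcard : 5 * F.card + 2 + 2 * m ≤ S.card) :
    ∃ U ⊆ S, U.card = m ∧ Disjoint F U ∧
      (∃ σ : ℤ, σ ^ 2 = 1 ∧ ∀ u ∈ U, ∀ x ∈ F, A u x = σ * φ x h) ∧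
      (j ≠ h → ∀ u ∈ U, φ u j = 0) := by
  have hnorm : ∀ x, φ x ⬝ᵥ φ x = 2 := fun x => by simp [hφ, rootGram, hA.diag]
  set K : Finset ι := insert j (F.biUnion fun x => Finset.univ.filter fun l => φ x l ≠ 0) with hK
  have hKc : K.card ≤ 2 * F.card + 1 := by
    refine (Finset.card_insert_le _ _).trans (Nat.succ_le_succ ?_)
    rw [mul_comm]
    exact Finset.card_biUnion_le_card_mul _ _ 2 fun x _ => card_support_of_norm_two (hnorm x)
  set T : Finset V := (K.erase h).biUnion fun k =>
    Finset.univ.filter fun u => φ u h ≠ 0 ∧ φ u k ≠ 0 with hT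
  have hTc : T.card ≤ 2 * K.card := by
    refine (Finset.card_biUnion_le_card_mul _ _ 2 fun k hk => ?_).trans ?_
    · exact card_common_coords_le hA hφ (Finset.ne_of_mem_erase hk).symm
    · rw [mul_comm]
      exact Nat.mul_le_mul_left _ (Finset.card_le_card (Finset.erase_subset _ _))
  set S' : Finset V := S \ (F ∪ T) with hS'
  have hS'c : 2 * m ≤ S'.card := by
    have h1 : S.card - (F ∪ T).card ≤ S'.card := Finset.le_card_sdiff (F ∪ T) S
    have h2 := Finset.card_union_le F T
    omega
  have hsq : ∀ u ∈ S', φ u h = 1 ∨ φ u h = -1 := by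
    intro u hu
    obtain ⟨-, -, h1, -⟩ := exists_coord_of_norm_two (hnorm u) (hS u (Finset.mem_sdiff.1 hu).1)
    exact sq_eq_one_iff.1 h1
  obtain ⟨σ, hσ, hσm⟩ : ∃ σ : ℤ, σ ^ 2 = 1 ∧ m ≤ (S'.filter fun u => φ u h = σ).card := by
    have h1 := Finset.card_filter_add_card_filter_not (s := S') (fun u => φ u h = 1)
    have h2 : (S'.filter fun u => ¬ φ u h = 1).card ≤ (S'.filter fun u => φ u h = -1).card :=
      Finset.card_le_card fun u hu => by
        rw [Finset.mem_filter] at hu ⊢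
        exact ⟨hu.1, (hsq u hu.1).resolve_left hu.2⟩
    by_cases h3 : m ≤ (S'.filter fun u => φ u h = 1).card
    · exact ⟨1, by norm_num, h3⟩
    · exact ⟨-1, by norm_num, by omega⟩
  obtain ⟨U, hU, hUm⟩ := Finset.exists_subset_card_eq hσm
  have hUS : ∀ u ∈ U, u ∈ S ∧ u ∉ F ∧ u ∉ T ∧ φ u h = σ := by
    intro u hu
    have := Finset.mem_filter.1 (hU hu)
    have h1 := Finset.mem_sdiff.1 this.1
    rw [Finset.mem_union, not_or] at h1
    exact ⟨h1.1, h1.2.1, h1.2.2, this.2⟩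
  have hUK : ∀ u ∈ U, ∀ k ∈ K, k ≠ h → φ u k = 0 := by
    intro u hu k hk hkh
    by_contra h0
    exact (hUS u hu).2.2.1 (Finset.mem_biUnion.2 ⟨k, Finset.mem_erase.2 ⟨hkh, hk⟩,
      by simpa using ⟨hS u (hUS u hu).1, h0⟩⟩)
  refine ⟨U, fun u hu => (hUS u hu).1, hUm,
    Finset.disjoint_right.2 fun u hu => (hUS u hu).2.1, ⟨σ, hσ, fun u hu x hx => ?_⟩,
    fun hj u hu => hUK u hu j (Finset.mem_insert_self _ _) hj⟩
  have hne : u ≠ x := fun e => (hUS u hu).2.1 (e ▸ hx)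
  have h1 : A u x = φ u ⬝ᵥ φ x := by rw [hφ]; simp [rootGram, hne]
  rw [h1, dotProduct, Finset.sum_eq_single h, (hUS u hu).2.2.2]
  · intro k _ hk
    by_cases hkx : φ x k = 0
    · rw [hkx, mul_zero]
    · rw [hUK u hu k (Finset.mem_insert_of_mem (Finset.mem_biUnion.2 ⟨x, hx, by simpa using hkx⟩))
        hk, zero_mul]
  · simp

variable {F : Finset V} {lam : ℝ}

lemma sum_mul_sq_of_sq_eq_one {σ : ℤ} (hσ : σ ^ 2 = 1) (s x : V → ℝ) :
    (∑ v, (σ * s v) * x v) ^ 2 = (∑ v, s v * x v) ^ 2 := by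
  have : (σ : ℝ) ^ 2 = 1 := by exact_mod_cast hσ
  simp only [mul_assoc, ← Finset.mul_sum]
  rw [mul_pow, this, one_mul]

/-- A coordinate occurring in many vertices is a root. -/
lemma rootGood_of_coord (hA : IsSignedAdj A) (hφ : ∀ x y, φ x ⬝ᵥ φ y = rootGram A 0 x y)
    (hl : 0 ≤ lam) {h : ι} {S : Finset V} (hS : ∀ u ∈ S, φ u h ≠ 0) {m : ℕ} (hm : 0 < m)
    (hcard : 5 * F.card + 2 + 2 * m ≤ S.card)
    (hgood : ∀ X : Finset V, X.card ≤ F.card + m → Good A lam X) :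
    RootGood A lam (1 / (1 + lam / m)) F fun x => φ x h := by
  obtain ⟨U, -, rfl, hFU, ⟨σ, hσ, hs⟩, -⟩ := exists_fresh_of_coord hA hφ F h hS hcard
  have h1 := RootGood.of_many hA hl (Finset.card_pos.1 hm) hFU hs
    (hgood _ (Finset.card_union_le _ _))
  intro x hx
  have h2 := h1 x hx
  push_cast at h2
  rwa [sum_mul_sq_of_sq_eq_one hσ] at h2

/-- Two coordinates occurring in many vertices are orthogonal roots. -/
lemma two_rootGood_of_coords (hA : IsSignedAdj A) (hφ : ∀ x y, φ x ⬝ᵥ φ y = rootGram A 0 x y)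
    (hl : 0 ≤ lam) {h j : ι} (hjh : j ≠ h) {S T : Finset V} (hS : ∀ u ∈ S, φ u h ≠ 0)
    (hT : ∀ u ∈ T, φ u j ≠ 0) {m : ℕ} (hm : 0 < m) (hScard : 5 * F.card + 2 + 2 * m ≤ S.card)
    (hTcard : 5 * (F.card + m) + 2 + 2 * m ≤ T.card)
    (hgood : ∀ X : Finset V, X.card ≤ F.card + m + m → Good A lam X) {x : V → ℝ}
    (hx : ∀ v, v ∉ F → x v = 0) :
    1 / (1 + lam / m) * (∑ v, (φ v j : ℝ) * x v) ^ 2 +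
      1 / (1 + lam / m) * (∑ v, (φ v h : ℝ) * x v) ^ 2 ≤ shiftBilin A lam x x := by
  obtain ⟨U, -, hUm, hFU, ⟨σ, hσ, hs⟩, hU0⟩ := exists_fresh_of_coord hA hφ F j hS hScard
  have hc : (F ∪ U).card = F.card + m := by rw [Finset.card_union_of_disjoint hFU, hUm]
  have h1 := rootGood_of_coord (F := F ∪ U) hA hφ hl hT hm (by rwa [hc])
    fun X hX => hgood X (by rwa [hc] at hX)
  have h2 := RootGood.add_root_of_many hA hl (Finset.card_pos.1 (hUm ▸ hm)) hFU hs
    (fun u hu => hU0 hjh u hu) h1 hx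
  rw [hUm] at h2
  push_cast at h2
  rwa [sum_mul_sq_of_sq_eq_one hσ] at h2

/-- Telescoping: along a connected set any two occurring coordinates are equal up to sign modulo
the span of the set. -/
lemma exists_comb_of_relConn (hA : IsSignedAdj A) (hφ : ∀ x y, φ x ⬝ᵥ φ y = rootGram A 0 x y)
    (hF : RelConn (fun x y => A x y ≠ 0) F) {v z : V} (hv : v ∈ F) (hz : z ∈ F) {j h : ι}
    (hj : φ v j ≠ 0) (hh : φ z h ≠ 0) :
    ∃ (x : V → ℤ) (σ : ℤ), (∀ w, w ∉ F → x w = 0) ∧ σ ^ 2 = 1 ∧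
      ∀ k, ∑ w, x w * φ w k = (if k = j then 1 else 0) - σ * (if k = h then 1 else 0) := by
  have hnorm : ∀ x, φ x ⬝ᵥ φ x = 2 := fun x => by simp [hφ, rootGram, hA.diag]
  set C : ι → Prop := fun l => ∃ (x : V → ℤ) (σ : ℤ), (∀ w, w ∉ F → x w = 0) ∧ σ ^ 2 = 1 ∧
      ∀ k, ∑ w, x w * φ w k = (if k = j then 1 else 0) - σ * (if k = l then 1 else 0) with hC
  have hCj : C j := ⟨0, 1, fun _ _ => rfl, by norm_num, fun k => by simp⟩
  have hstep : ∀ w ∈ F, ∀ k, φ w k ≠ 0 → C k → ∀ l, φ w l ≠ 0 → C l := by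
    rintro w hw k hk ⟨x, σ, hx, hσ, hxk⟩ l hl
    obtain ⟨i, hki, h1, h2, h3⟩ := exists_coord_of_norm_two (hnorm w) hk
    rcases eq_or_ne l k with rfl | hlk
    · exact ⟨x, σ, hx, hσ, hxk⟩
    obtain rfl : l = i := by
      by_contra hne
      exact hl (h3 l hlk hne)
    refine ⟨x + (σ * φ w k) • Pi.single w 1, -(σ * φ w k * φ w l), fun y hy => ?_, ?_, fun i => ?_⟩
    · have : y ≠ w := fun e => hy (e ▸ hw)
      simp [hx y hy, this]
    · rw [neg_sq, mul_pow, mul_pow, hσ, h1, h2]; rfl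
    · simp only [Pi.add_apply, Pi.smul_apply, smul_eq_mul, add_mul, Finset.sum_add_distrib, hxk,
        Pi.single_apply]
      simp only [mul_ite, mul_one, mul_zero, ite_mul, zero_mul, Finset.sum_ite_eq',
        Finset.mem_univ, if_true]
      rcases eq_or_ne i k with rfl | hik
      · rw [if_neg hki]
        simp only [if_true]
        linear_combination σ * h1
      · rcases eq_or_ne i l with rfl | hil
        · rw [if_neg hik]
          simp only [if_true]
          ring
        · simp [hik, hil, h3 i hik hil]
  have hall : (F.filter fun w => ∀ k, φ w k ≠ 0 → C k) = F := by
    refine hF _ (Finset.filter_subset _ _) ⟨v, ?_⟩ ?_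
    · exact Finset.mem_filter.2 ⟨hv, hstep v hv j hj hCj⟩
    · intro y hy u hu huy hne
      refine huy (Finset.mem_filter.2 ⟨hu, ?_⟩)
      have hyu : y ≠ u := fun e => huy (e ▸ hy)
      have h1 : φ y ⬝ᵥ φ u ≠ 0 := by rw [hφ]; simpa [rootGram, hyu] using hne
      obtain ⟨k, -, hk⟩ := Finset.exists_ne_zero_of_sum_ne_zero h1
      exact hstep u hu k (right_ne_zero_of_mul hk)
        ((Finset.mem_filter.1 hy).2 k (left_ne_zero_of_mul hk))
  have := hall.symm ▸ hz
  exact (Finset.mem_filter.1 this).2 h hh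

end Coordinates


section Geodesics

variable {V : Type*} {r : V → V → Prop} {F : Finset V}

lemma RelConn.subtype (h : RelConn r F) :
    RelConn (fun x y : F => r x y) (Finset.univ : Finset F) := by
  intro Y _ hne hout
  have h1 : Y.map (Function.Embedding.subtype _) = F := by
    refine h _ ?_ (hne.map) ?_
    · intro x hx
      obtain ⟨y, -, rfl⟩ := Finset.mem_map.1 hx
      exact y.2
    · intro x hx z hz hzY
      obtain ⟨y, hy, rfl⟩ := Finset.mem_map.1 hx
      refine hout y hy ⟨z, hz⟩ (Finset.mem_univ _) fun hz' => hzY ?_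
      exact Finset.mem_map.2 ⟨⟨z, hz⟩, hz', rfl⟩
  refine Finset.eq_univ_of_forall fun x => ?_
  have h2 : (x : V) ∈ Y.map (Function.Embedding.subtype _) := by rw [h1]; exact x.2
  obtain ⟨y, hy, hyx⟩ := Finset.mem_map.1 h2
  have : y = x := Subtype.ext hyx
  exact this ▸ hy

variable [Fintype V]

lemma geodesic_induced {M : ℕ} {w : ℕ → V} (h0 : w 0 ∈ F)
    (hw : ∀ i < M, r (w i) (w (i + 1)) ∧ w (i + 1) ∈ relBall r F (i + 1) ∧
      w (i + 1) ∉ relBall r F i) :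
    (∀ i j, i + 1 < j → j ≤ M → ¬ r (w i) (w j)) ∧ ∀ i j, i < j → j ≤ M → w i ≠ w j := by
  have hb : ∀ i ≤ M, w i ∈ relBall r F i := by
    intro i hi
    cases i with
    | zero => exact h0
    | succ i => exact (hw i (by omega)).2.1
  refine ⟨fun i j hij hj hne => ?_, fun i j hij hj e => ?_⟩
  all_goals obtain ⟨j, rfl⟩ : ∃ l, j = l + 1 := ⟨j - 1, by omega⟩
  · exact (hw j (by omega)).2.2 (relBall_mono (by omega)
      (mem_relBall_succ.2 (Or.inr ⟨w i, hb i (by omega), hne⟩) : w (j + 1) ∈ relBall r F (i + 1)))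
  · exact (hw j (by omega)).2.2 (e ▸ relBall_mono (by omega) (hb i (by omega)))

/-- If there are no geodesics of length `M + 1` then balls of radius `M` exhaust connected sets. -/
lemma RelConn.relBall_eq_univ (hconn : RelConn r (Finset.univ : Finset V)) (hF : F.Nonempty)
    {M : ℕ} (h : ¬ ∃ w : ℕ → V, w 0 ∈ F ∧ ∀ i < M + 1, r (w i) (w (i + 1)) ∧
      w (i + 1) ∈ relBall r F (i + 1) ∧ w (i + 1) ∉ relBall r F i) :
    relBall r F M = Finset.univ := by
  refine hconn _ (Finset.subset_univ _) (hF.mono (relBall_mono (Nat.zero_le M))) ?_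
  intro y hy z _ hz hyz
  obtain ⟨j, hj, w, h0, hwj, hw⟩ :=
    exists_geodesic (mem_relBall_succ.2 (Or.inr ⟨y, hy, hyz⟩) : z ∈ relBall r F (M + 1))
  have : j = M + 1 := by
    by_contra hne
    refine hz (relBall_mono (by omega : j ≤ M) ?_)
    cases j with
    | zero => exact hwj ▸ h0
    | succ j => exact hwj ▸ (hw j (by omega)).2.1
  subst this
  exact h ⟨w, h0, hw⟩

variable {A : V → V → ℤ} {s : V → ℤ} {lam : ℝ}

/-- Induced paths for the form of `lam + A - s sᵀ` are short when `lam < 2`. -/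
lemma path_length_le (hA : IsSignedAdj A) (h : RootGood A lam 1 F s) {M : ℕ} {w : ℕ → V}
    (hwF : ∀ i ≤ M, w i ∈ F) (h1 : ∀ i < M, A (w i) (w (i + 1)) ≠ s (w i) * s (w (i + 1)))
    (h0 : ∀ i j, i + 1 < j → j ≤ M → A (w i) (w j) = s (w i) * s (w j))
    (hne : ∀ i j, i < j → j ≤ M → w i ≠ w j) : (2 - lam) * (M + 1) ≤ 2 := by
  set q : (V → ℝ) → ℝ := fun x => shiftBilin A lam x x - (∑ v, (s v : ℝ) * x v) ^ 2 with hq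
  suffices key : ∀ k ≤ M, ∃ x : V → ℝ, (∀ v, (∀ i ≤ k, v ≠ w i) → x v = 0) ∧
      (x (w k) = 1 ∨ x (w k) = -1) ∧ q x ≤ 2 - (2 - lam) * (k + 1) by
    obtain ⟨x, hx, -, hxq⟩ := key M le_rfl
    have := h x fun v hv => hx v fun i hi e => hv (e ▸ hwF i hi)
    simp only [hq] at hxq
    linarith
  intro k
  induction k with
  | zero =>
    intro _
    refine ⟨Pi.single (w 0) 1, fun v hv => ?_, Or.inl (by simp), ?_⟩
    · simp [hv 0 le_rfl]
    · simp only [hq, shiftBilin_single_single, hA.diag, if_true]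
      have := sq_nonneg (∑ v, (s v : ℝ) * (Pi.single (w 0) (1 : ℝ) : V → ℝ) v)
      push_cast
      linarith
  | succ k ih =>
    intro hk
    obtain ⟨x, hx, hxk, hxq⟩ := ih (by omega)
    set z := w (k + 1) with hz
    have hxz : x z = 0 := hx z fun i hi e => hne i (k + 1) (by omega) hk e.symm
    set S : ℝ := ∑ v, (s v : ℝ) * x v with hS
    set d : ℤ := A (w k) z - s (w k) * s z with hd
    have hd0 : d ≠ 0 := sub_ne_zero.2 (h1 k (by omega))
    have hd1 : (1 : ℝ) ≤ (d : ℝ) ^ 2 := by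
      have : 1 ≤ d ^ 2 := by have := sq_pos_of_ne_zero hd0; omega
      exact_mod_cast this
    have hb : shiftBilin A lam (Pi.single z 1) x - s z * S = d * x (w k) := by
      rw [shiftBilin_single_left, hxz, mul_zero, zero_add, hS, Finset.mul_sum,
        ← Finset.sum_sub_distrib, Finset.sum_eq_single (w k)]
      · rw [hA.symm z, hd]; push_cast; ring
      · intro v _ hv
        by_cases hv' : ∃ i ≤ k, v = w i
        · obtain ⟨i, hi, rfl⟩ := hv'
          have hik : i ≠ k := fun e => hv (e ▸ rfl)
          rw [hA.symm z, hz, h0 i (k + 1) (by omega) hk]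
          push_cast; ring
        · push Not at hv'
          rw [hx v fun i hi => hv' i hi]; ring
      · simp
    have hss : ∑ v, (s v : ℝ) * (Pi.single z (1 : ℝ) : V → ℝ) v = s z := by
      simp [Pi.single_apply]
    have hexp : ∀ c : ℝ, q (x + c • Pi.single z 1) =
        q x + 2 * c * (d * x (w k)) + c ^ 2 * (lam - (s z) ^ 2) := by
      intro c
      have hlin : ∑ v, (s v : ℝ) * (x + c • (Pi.single z 1 : V → ℝ)) v = S + c * s z := by
        rw [hS, ← hss, Finset.mul_sum, ← Finset.sum_add_distrib]
        exact Finset.sum_congr rfl fun v _ => by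
          rw [Pi.add_apply, Pi.smul_apply, smul_eq_mul]; ring
      simp only [hq]
      rw [hlin, shiftBilin_add_left, shiftBilin_add_right, shiftBilin_add_right,
        shiftBilin_smul_right, shiftBilin_smul_left, shiftBilin_smul_left, shiftBilin_smul_right,
        shiftBilin_comm hA x (Pi.single z 1), shiftBilin_single_single, if_pos rfl, hA.diag, ← hb,
            ← hS]
      push_cast
      ring
    have hxx : x (w k) ^ 2 = 1 := by rcases hxk with e | e <;> rw [e] <;> norm_num
    obtain ⟨c, hc, hcd⟩ : ∃ c : ℝ, (c = 1 ∨ c = -1) ∧ c * (d * x (w k)) ≤ -1 := by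
      have h2 : 1 ≤ (d * x (w k)) ^ 2 := by rw [mul_pow, hxx]; linarith
      rcases le_or_gt (d * x (w k)) 0 with h3 | h3
      · exact ⟨1, Or.inl rfl, by nlinarith⟩
      · exact ⟨-1, Or.inr rfl, by nlinarith⟩
    refine ⟨x + c • Pi.single z 1, fun v hv => ?_, ?_, ?_⟩
    · have h3 : v ≠ z := hv (k + 1) le_rfl
      simp [hx v fun i hi => hv i (by omega), h3]
    · rcases hc with e | e <;> simp [hxz, e]
    · rw [hexp]
      have : c ^ 2 = 1 := by rcases hc with e | e <;> rw [e] <;> norm_num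
      rw [this]
      push_cast
      nlinarith [sq_nonneg (s z : ℝ)]

end Geodesics

section Transfer

variable {V W : Type*} [Fintype V] [Fintype W] {A : V → V → ℤ} {lam : ℝ}

/-- The form of an induced signed subgraph is the restriction of the form. -/
lemma shiftBilin_comp {f : W → V} (hf : Function.Injective f) {x : V → ℝ}
    (hx : ∀ v, v ∉ Set.range f → x v = 0) :
    shiftBilin (fun i j => A (f i) (f j)) lam (x ∘ f) (x ∘ f) = shiftBilin A lam x x := by
  have h1 : ∀ g : V → ℝ, (∀ v, v ∉ Set.range f → g v = 0) → ∑ i, g (f i) = ∑ v, g v :=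
    fun g hg => Fintype.sum_of_injective f hf _ _ hg fun _ => rfl
  simp only [shiftBilin, Function.comp]
  rw [h1 (fun v => x v * x v) fun v hv => by simp [hx v hv]]
  congr 1
  rw [← h1 (fun v => ∑ w, (A v w : ℝ) * x v * x w) fun v hv => by simp [hx v hv]]
  exact Finset.sum_congr rfl fun i _ =>
    h1 (fun w => (A (f i) w : ℝ) * x (f i) * x w) fun w hw => by simp [hx w hw]

lemma rootGood_comp {f : W → V} (hf : Function.Injective f) {F : Finset V}
    (hF : ∀ v, v ∈ F ↔ v ∈ Set.range f) {kap : ℝ} {s : V → ℤ} :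
    RootGood (fun i j => A (f i) (f j)) lam kap Finset.univ (fun i => s (f i)) ↔
      RootGood A lam kap F s := by
  have hsum : ∀ x : V → ℝ, (∀ v, v ∉ Set.range f → x v = 0) →
      ∑ i, (s (f i) : ℝ) * x (f i) = ∑ v, (s v : ℝ) * x v :=
    fun x hx => Fintype.sum_of_injective f hf _ _ (fun v hv => by simp [hx v hv]) fun _ => rfl
  constructor
  · intro h x hx
    have hx' : ∀ v, v ∉ Set.range f → x v = 0 := fun v hv => hx v fun h' => hv ((hF v).1 h')
    have := h (x ∘ f) (by simp)
    rw [shiftBilin_comp hf hx'] at this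
    rw [← hsum x hx']
    exact this
  · intro h y _
    set x : V → ℝ := Function.extend f y 0 with hxdef
    have hx' : ∀ v, v ∉ Set.range f → x v = 0 := fun v hv => Function.extend_apply' _ _ _ hv
    have hxf : ∀ i, x (f i) = y i := fun i => hf.extend_apply _ _ _
    have hxc : x ∘ f = y := funext hxf
    have := h x fun v hv => hx' v fun h' => hv ((hF v).2 h')
    rw [← shiftBilin_comp hf hx', hxc, ← hsum x hx'] at this
    simpa only [hxf] using this

/-- There are finitely many signed graphs with a root on a bounded number of vertices, so that a
root of weight close to one has weight one. -/
lemma exists_rootGood_one (lam : ℝ) (n : ℕ) : ∃ kap₀ < (1 : ℝ), ∀ kap, kap₀ ≤ kap → kap < 1 →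
    ∀ {V : Type} [Fintype V] {A : V → V → ℤ} {s : V → ℤ} {F : Finset V}, IsSignedAdj A →
      (∀ v ∈ F, s v = -1 ∨ s v = 0 ∨ s v = 1) → F.card ≤ n → RootGood A lam kap F s →
      RootGood A lam 1 F s := by
  have h1 : ∀ t : (c : Fin (n + 1)) × ((Fin c → Fin c → SignType) × (Fin c → SignType)),
      ∀ᶠ kap in 𝓝[<] (1 : ℝ), RootGood (fun i j => (t.2.1 i j : ℤ)) lam kap Finset.univ
        (fun i => (t.2.2 i : ℤ)) →
        RootGood (fun i j => (t.2.1 i j : ℤ)) lam 1 Finset.univ (fun i => (t.2.2 i : ℤ)) := by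
    rintro ⟨c, B, u⟩
    by_cases hg : RootGood (fun i j => (B i j : ℤ)) lam 1 Finset.univ (fun i => (u i : ℤ))
    · exact Filter.Eventually.of_forall fun _ _ => hg
    · rw [RootGood] at hg
      push Not at hg
      obtain ⟨x, hx, hlt⟩ := hg
      have hcont : Filter.Tendsto (fun kap : ℝ => kap * (∑ v, ((u v : ℤ) : ℝ) * x v) ^ 2)
          (𝓝[<] 1) (𝓝 (1 * (∑ v, ((u v : ℤ) : ℝ) * x v) ^ 2)) :=
        ((continuous_id.mul continuous_const).tendsto 1).mono_left nhdsWithin_le_nhds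
      filter_upwards [hcont.eventually (lt_mem_nhds hlt)] with kap hk hgood
      exact absurd (hgood x hx) (not_le.2 hk)
  obtain ⟨kap₀, hk0, hk⟩ := (mem_nhdsLT_iff_exists_Ico_subset).1 (Filter.eventually_all.2 h1)
  refine ⟨kap₀, hk0, fun kap hk1 hk2 V _ A s F hA hs hF h => ?_⟩
  set f : Fin F.card → V := fun i => (F.equivFin.symm i : V) with hf
  have hfi : Function.Injective f := Subtype.val_injective.comp F.equivFin.symm.injective
  have hfF : ∀ v, v ∈ F ↔ v ∈ Set.range f := fun v =>
    ⟨fun hv => ⟨F.equivFin ⟨v, hv⟩, by simp [hf]⟩, by rintro ⟨i, rfl⟩; exact (F.equivFin.symm i).2⟩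
  have hsign : ∀ a : ℤ, (a = -1 ∨ a = 0 ∨ a = 1) → ((SignType.sign a : SignType) : ℤ) = a := by
    rintro a (rfl | rfl | rfl) <;> rfl
  have key := hk ⟨hk1, hk2⟩ ⟨⟨F.card, by omega⟩, fun i j => SignType.sign (A (f i) (f j)),
    fun i => SignType.sign (s (f i))⟩
  simp only [hsign _ (hA.entries _ _), hsign _ (hs _ ((hfF _).2 ⟨_, rfl⟩))] at key
  exact (rootGood_comp hfi hfF).1 (key ((rootGood_comp hfi hfF).2 h))

end Transfer


section Split

variable {V : Type*} [Fintype V] {A : V → V → ℤ} {lam : ℝ} {s : V → ℤ}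

/-- The form of `lam + A - s sᵀ` is block diagonal. -/
lemma RootGood.of_split (hA : IsSignedAdj A) {Y G : Finset V}
    (hout : ∀ y ∈ Y, ∀ z ∈ G, z ∉ Y → A y z = s y * s z) (hY : RootGood A lam 1 Y s)
    (hG : RootGood A lam 1 (G \ Y) s) : RootGood A lam 1 G s := by
  intro x hx
  set y : V → ℝ := fun v => if v ∈ Y then x v else 0 with hy
  set z : V → ℝ := fun v => if v ∈ Y then 0 else x v with hz
  have hxyz : x = y + z := by
    funext v
    by_cases hv : v ∈ Y <;> simp [hy, hz, hv]
  have h1 := hY y fun v hv => by simp [hy, hv]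
  have h2 := hG z fun v hv => by
    by_cases hvY : v ∈ Y
    · simp [hz, hvY]
    · simp only [hz, if_neg hvY]
      exact hx v fun h => hv (Finset.mem_sdiff.2 ⟨h, hvY⟩)
  have h3 : shiftBilin A lam y z = (∑ v, (s v : ℝ) * y v) * ∑ v, (s v : ℝ) * z v := by
    have h4 : ∑ v, y v * z v = 0 := Finset.sum_eq_zero fun v _ => by
      by_cases hv : v ∈ Y <;> simp [hy, hz, hv]
    rw [shiftBilin, h4, mul_zero, zero_add, Finset.sum_mul_sum]
    refine Finset.sum_congr rfl fun v _ => Finset.sum_congr rfl fun w _ => ?_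
    by_cases hv : v ∈ Y
    · by_cases hw : w ∈ Y
      · simp [hz, hw]
      · by_cases hwG : w ∈ G
        · rw [hout v hv w hwG hw]; push_cast; ring
        · simp [hz, hw, hx w hwG]
    · simp [hy, hv]
  have h5 : ∑ v, (s v : ℝ) * x v = ∑ v, (s v : ℝ) * y v + ∑ v, (s v : ℝ) * z v := by
    rw [← Finset.sum_add_distrib]
    exact Finset.sum_congr rfl fun v _ => by rw [hxyz, Pi.add_apply]; ring
  rw [h5, hxyz, shiftBilin_add_left, shiftBilin_add_right, shiftBilin_add_right,
    shiftBilin_comm hA z y, h3]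
  nlinarith

lemma Good.rootGood_zero {F : Finset V} {kap : ℝ} (h : Good A lam F) : RootGood A lam kap F 0 :=
  fun x hx => by simpa using h x hx

lemma exists_coord_of_card {ι : Type*} [Fintype ι] {φ : V → ι → ℤ} {D : ℕ} {K : Finset ι}
    (hK : K.card ≤ 2) {T : Finset V} (hT : 2 * D < T.card)
    (h : ∀ u ∈ T, ∃ k ∈ K, φ u k ≠ 0) :
    ∃ k ∈ K, D < (Finset.univ.filter fun u => φ u k ≠ 0).card := by
  by_contra! hk
  have h1 : T ⊆ K.biUnion fun k => Finset.univ.filter fun u => φ u k ≠ 0 := by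
    intro u hu
    obtain ⟨k, hk, hne⟩ := h u hu
    exact Finset.mem_biUnion.2 ⟨k, hk, by simpa using hne⟩
  have h2 := (Finset.card_le_card h1).trans (Finset.card_biUnion_le_card_mul _ _ D hk)
  have h3 : K.card * D ≤ 2 * D := Nat.mul_le_mul_right _ hK
  omega

end Split

lemma exists_nat_weight (lam : ℝ) {kap : ℝ} (hk : kap < 1) :
    ∃ m : ℕ, 0 < m ∧ kap ≤ 1 / (1 + lam / m) := by
  have h1 : Filter.Tendsto (fun m : ℕ => 1 / (1 + lam / (m : ℝ))) Filter.atTop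
      (𝓝 (1 / (1 + 0))) :=
    tendsto_const_nhds.div (tendsto_const_nhds.add (tendsto_const_div_atTop_nhds_zero_nat lam))
      (by norm_num)
  rw [add_zero, div_one] at h1
  obtain ⟨m, hm⟩ := ((h1.eventually (lt_mem_nhds hk)).and (Filter.eventually_gt_atTop 0)).exists
  exact ⟨m, hm.2, hm.1.le⟩

/-- Large connected signed graphs all of whose small subgraphs are good for `lam < 2` are good. -/
theorem exists_good_univ_of_lt_two {lam kap : ℝ} (hl : 0 ≤ lam) (h2 : lam < 2)
    (hb : RootBound 2 kap) : ∃ N R : ℕ, ∀ {V : Type} [Fintype V] {A : V → V → ℤ}, IsSignedAdj A →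
      RelConn (fun x y => A x y ≠ 0) (Finset.univ : Finset V) → N ≤ Fintype.card V →
      (∀ X : Finset V, X.card ≤ R → Good A lam X) → Good A lam Finset.univ := by
  obtain ⟨N₁, R₁, hrep⟩ := exists_rootRep_univ_of_card hb
  obtain ⟨M, hM⟩ : ∃ M : ℕ, 2 < (2 - lam) * (M + 1) := by
    obtain ⟨M, hM⟩ := exists_nat_gt (2 / (2 - lam))
    refine ⟨M, ?_⟩
    rw [div_lt_iff₀ (by linarith)] at hM
    nlinarith
  obtain ⟨m₁, hm₁, hk₁⟩ := exists_nat_weight lam (kap := (lam / 2 + 1) / 2) (by linarith)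
  obtain ⟨D, hD⟩ : ∃ D, D = 5 * (M + 1 + m₁) + 2 + 2 * m₁ := ⟨_, rfl⟩
  obtain ⟨n, hn⟩ : ∃ n, n = (2 * D + 1) ^ M + M + 1 := ⟨_, rfl⟩
  obtain ⟨kap₀, hkap₀, hone⟩ := exists_rootGood_one lam n
  obtain ⟨m₂, hm₂, hk₂⟩ := exists_nat_weight lam hkap₀
  obtain ⟨D', hD'⟩ : ∃ D', D' = D + 5 * n + 2 + 2 * m₂ := ⟨_, rfl⟩
  refine ⟨N₁ + (2 * D' + 1) ^ M + 1, R₁ + (M + 2) + 2 * m₁ + n + m₂, ?_⟩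
  intro V _ A hA hconn hcard hgood
  obtain ⟨ι, _, φ, hφ'⟩ := hrep hA hconn (by omega)
    fun X hX => (hgood X (by omega)).mono_lam h2.le
  have hφ : ∀ x y, φ x ⬝ᵥ φ y = rootGram A 0 x y :=
    fun x y => hφ' x (Finset.mem_univ x) y (Finset.mem_univ y)
  have hnorm : ∀ x, φ x ⬝ᵥ φ x = 2 := fun x => by simp [hφ, rootGram, hA.diag]
  have hsign : ∀ x k, φ x k = -1 ∨ φ x k = 0 ∨ φ x k = 1 := by
    intro x k
    by_cases h0 : φ x k = 0
    · exact Or.inr (Or.inl h0)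
    · obtain ⟨-, -, h1, -⟩ := exists_coord_of_norm_two (hnorm x) h0
      rcases sq_eq_one_iff.1 h1 with e | e <;> simp [e]
  -- There are no long induced paths.
  have hpath : ∀ {L : ℕ}, M ≤ L → L ≤ M + 1 → ∀ x, ¬ ∃ w : ℕ → V, w 0 ∈ ({x} : Finset V) ∧
      ∀ i < L, A (w i) (w (i + 1)) ≠ 0 ∧
        w (i + 1) ∈ relBall (fun x y => A x y ≠ 0) {x} (i + 1) ∧
        w (i + 1) ∉ relBall (fun x y => A x y ≠ 0) {x} i := by
    rintro L hL hL' x ⟨w, hw0, hw⟩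
    obtain ⟨h0, hne⟩ := geodesic_induced (r := fun x y => A x y ≠ 0) hw0 hw
    have h1 : Good A lam ((Finset.range (L + 1)).image w) :=
      hgood _ (Finset.card_image_le.trans (by rw [Finset.card_range]; omega))
    have h3 := path_length_le hA h1.rootGood_zero (M := L) (w := w)
      (fun i hi => Finset.mem_image_of_mem w (Finset.mem_range.2 (by omega)))
      (fun i hi => by simpa using (hw i hi).1) (fun i j hij hj => by simpa using h0 i j hij hj) hne
    have h4 : (M : ℝ) ≤ L := by exact_mod_cast hL
    nlinarith
  -- There is only one coordinate occurring often.
  have huniq : ∀ h j, j ≠ h → D ≤ (Finset.univ.filter fun u => φ u h ≠ 0).card →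
      D < (Finset.univ.filter fun u => φ u j ≠ 0).card → False := by
    intro h j hjh hh hj
    obtain ⟨v, hv⟩ := Finset.card_pos.1 (show 0 < _ from lt_of_le_of_lt (Nat.zero_le _) hj)
    obtain ⟨z, hz⟩ := Finset.card_pos.1 (show 0 < _ from lt_of_lt_of_le (by omega) hh)
    have hball := hconn.relBall_eq_univ (F := {v}) (Finset.singleton_nonempty v)
      (hpath (Nat.le_succ M) le_rfl v)
    have hsing : RelConn (fun x y => A x y ≠ 0) ({v} : Finset V) := fun Y hY hne _ =>
      (Finset.Nonempty.subset_singleton_iff hne).1 hY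
    obtain ⟨F, hvF, hFconn, hzF, hFc⟩ := hsing.exists_mem (fun x y => by rw [hA.symm]; exact id)
      (hball ▸ Finset.mem_univ z)
    rw [Finset.card_singleton] at hFc
    obtain ⟨x, σ, hx, hσ, hxk⟩ := exists_comb_of_relConn hA hφ hFconn
      (hvF (Finset.mem_singleton_self v)) hzF (by simpa using hv) (by simpa using hz) (j := j)
      (h := h)
    have hx' : ∀ v, v ∉ F → (x v : ℝ) = 0 := fun v hv => by rw [hx v hv]; simp
    have h3 := two_rootGood_of_coords (F := F) hA hφ hl hjh
      (S := Finset.univ.filter fun u => φ u h ≠ 0) (T := Finset.univ.filter fun u => φ u j ≠ 0)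
      (fun u hu => by simpa using hu) (fun u hu => by simpa using hu) hm₁ (by omega) (by omega)
      (fun X hX => hgood X (by omega)) hx'
    have hxk' : ∀ k, ∑ w, (x w : ℝ) * φ w k =
        (if k = j then 1 else 0) - σ * (if k = h then 1 else 0) := by
      intro k
      have := congrArg (Int.cast : ℤ → ℝ) (hxk k)
      push_cast at this
      exact this
    have hσ' : (σ : ℝ) ^ 2 = 1 := by exact_mod_cast hσ
    have h4 : shiftBilin A 2 (fun v => (x v : ℝ)) (fun v => (x v : ℝ)) = 2 := by
      rw [shiftBilin_two_of_rep (F := Finset.univ) hφ' (by simp)]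
      simp only [hxk']
      rw [← Finset.sum_subset (Finset.subset_univ {j, h}), Finset.sum_pair hjh]
      · simp only [if_true, if_neg hjh, if_neg hjh.symm]
        linear_combination hσ'
      · intro k _ hk
        simp only [Finset.mem_insert, Finset.mem_singleton, not_or] at hk
        simp [hk.1, hk.2]
    have h5 : shiftBilin A lam (fun v => (x v : ℝ)) (fun v => (x v : ℝ)) =
        2 - (2 - lam) * ∑ v, (x v : ℝ) * x v := by
      simp only [shiftBilin] at h4 ⊢
      linear_combination h4
    have h6 : (1 : ℝ) ≤ ∑ v, (x v : ℝ) * x v := by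
      obtain ⟨u, hu⟩ : ∃ u, x u ≠ 0 := by
        by_contra! h0
        have := hxk j
        simp [h0, hjh] at this
      have h7 : 1 ≤ x u * x u := by have := mul_self_pos.2 hu; omega
      have h8 : (1 : ℝ) ≤ (x u : ℝ) * x u := by exact_mod_cast h7
      exact h8.trans (Finset.single_le_sum (f := fun v => (x v : ℝ) * x v)
        (fun v _ => mul_self_nonneg _) (Finset.mem_univ u))
    have h7 : ∀ k, ∑ w, (φ w k : ℝ) * x w = ∑ w, (x w : ℝ) * φ w k :=
      fun k => Finset.sum_congr rfl fun _ _ => mul_comm _ _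
    rw [h7, h7, hxk', hxk', h5] at h3
    simp only [if_true, if_neg hjh, if_neg hjh.symm] at h3
    nlinarith
  -- A coordinate occurring often.
  obtain ⟨h, hh⟩ : ∃ h, D' < (Finset.univ.filter fun u => φ u h ≠ 0).card := by
    obtain ⟨x⟩ := Fintype.card_pos_iff.1 (show 0 < Fintype.card V by omega)
    rcases exists_geodesic_or_degree hconn (Finset.singleton_nonempty x) (M := M) (D := 2 * D')
      (by rw [Finset.card_singleton]; omega) with hw | ⟨v, -, hdeg⟩
    · exact absurd hw (hpath le_rfl (Nat.le_succ M) x)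
    · obtain ⟨k, -, hk⟩ := exists_coord_of_card (φ := φ) (card_support_of_norm_two (hnorm v))
        (T := (Finset.univ.filter fun z => A v z ≠ 0).erase v) (D := D') (by
          rw [Finset.erase_eq_of_notMem (by simp [hA.diag])]
          convert hdeg) (by
          intro u hu
          have h1 : φ v ⬝ᵥ φ u ≠ 0 := by
            rw [hφ]
            simpa [rootGram, (Finset.ne_of_mem_erase hu).symm] using Finset.mem_of_mem_erase hu
          obtain ⟨k, -, hk⟩ := Finset.exists_ne_zero_of_sum_ne_zero h1
          exact ⟨k, by simpa using left_ne_zero_of_mul hk, right_ne_zero_of_mul hk⟩)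
      exact ⟨k, hk⟩
  set s : V → ℤ := fun x => φ x h with hs
  have hroot : ∀ F : Finset V, F.card ≤ n → RootGood A lam 1 F s := by
    intro F hF
    have h3 := rootGood_of_coord (F := F) hA hφ hl
      (S := Finset.univ.filter fun u => φ u h ≠ 0) (fun u hu => by simpa using hu) hm₂ (by omega)
      fun X hX => hgood X (by omega)
    exact hone kap₀ le_rfl hkap₀ hA (fun v _ => hsign v h) hF (h3.mono_param le_rfl hk₂)
  refine RootGood.good (kap := 1) (s := s) ?_ zero_le_one
  refine relConn_induction (P := fun F => RootGood A lam 1 F s) (fun x y => A x y ≠ s x * s y)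
    Finset.univ (hroot ∅ (by simp)) (fun G _ _ hG => hroot G ?_) ?_
  · by_contra! hGn
    obtain ⟨x, hx⟩ := Finset.card_pos.1 (show 0 < G.card by omega)
    rcases exists_geodesic_or_degree hG.subtype (Finset.singleton_nonempty ⟨x, hx⟩) (M := M)
      (D := 2 * D) (by rw [Finset.card_singleton, Fintype.card_coe]; omega) with
      ⟨w, hw0, hw⟩ | ⟨v, -, hdeg⟩
    · obtain ⟨h0, hne⟩ := geodesic_induced (r := fun x y : G => A x y ≠ s x * s y) hw0 hw
      have h1 : RootGood A lam 1 ((Finset.range (M + 1)).image fun i => (w i : V)) s :=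
        hroot _ (Finset.card_image_le.trans (by rw [Finset.card_range]; omega))
      have h3 := path_length_le hA h1 (M := M) (w := fun i => (w i : V))
        (fun i hi => Finset.mem_image_of_mem _ (Finset.mem_range.2 (by omega)))
        (fun i hi => (hw i hi).1) (fun i j hij hj => not_not.1 (h0 i j hij hj))
        (fun i j hij hj e => hne i j hij hj (Subtype.ext e))
      linarith
    · obtain ⟨k, hkK, hk⟩ := exists_coord_of_card (φ := φ) (D := D)
        (K := (Finset.univ.filter fun l => φ v l ≠ 0).erase h)
        ((Finset.card_le_card (Finset.erase_subset _ _)).trans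
          (card_support_of_norm_two (hnorm v)))
        (T := (Finset.univ.filter fun z : G => A v z ≠ s v * s z).map
          (Function.Embedding.subtype _)) (by rw [Finset.card_map]; convert hdeg) (by
          intro u hu
          obtain ⟨z, hz, rfl⟩ := Finset.mem_map.1 hu
          have hz' : A v z ≠ s v * s z := by simpa using hz
          by_contra! h0
          by_cases hvz : (v : V) = z
          · have h1 : φ v h ≠ 0 := by
              intro h1
              exact hz' (by simp [← hvz, hA.diag, hs, h1])
            obtain ⟨l, hl, -, h3, -⟩ := exists_coord_of_norm_two (hnorm v) h1
            have h4 : φ v l ≠ 0 := fun e => by simp [e] at h3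
            exact h4 (hvz ▸ h0 l (Finset.mem_erase.2 ⟨hl.symm, by simpa using h4⟩))
          · refine hz' ?_
            have h1 : A v z = φ v ⬝ᵥ φ z := by rw [hφ]; simp [rootGram, hvz]
            rw [h1, dotProduct, Finset.sum_eq_single h]
            · intro l _ hl
              by_cases hvl : φ v l = 0
              · rw [hvl, zero_mul]
              · have := h0 l (Finset.mem_erase.2 ⟨hl, by simpa using hvl⟩)
                simp only [Function.Embedding.subtype_apply] at this
                rw [this, mul_zero]
            · simp)
      exact huniq h k (Finset.ne_of_mem_erase hkK) (by omega) hk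
  · intro Y G _ _ hout hY hG
    exact RootGood.of_split hA (fun y hy z hz hzY => not_not.1 (hout y hy z hz hzY)) hY hG


section Characterization

variable {m n : ℕ} {lam : ℝ}

/-- The signed adjacency matrix over the integers. -/
noncomputable def SignedGraph.intMat (G : SignedGraph n) (i j : Fin n) : ℤ :=
  if G.mat i j = 1 then 1 else if G.mat i j = -1 then -1 else 0

lemma SignedGraph.intMat_cast (G : SignedGraph n) (i j : Fin n) :
    (G.intMat i j : ℝ) = G.mat i j := by
  rcases G.entries i j with h | h | h <;> norm_num [intMat, h]

lemma SignedGraph.isSignedAdj (G : SignedGraph n) : IsSignedAdj G.intMat where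
  symm x y := by
    have h := G.isSymm.apply x y
    simp only [intMat, h]
  diag x := by simp [intMat, G.diag_zero]
  entries x y := by
    simp only [intMat]
    split_ifs <;> simp

lemma SignedGraph.shiftBilin_eq (G : SignedGraph n) (x : Fin n → ℝ) :
    shiftBilin G.intMat lam x x = lam * (x ⬝ᵥ x) + x ⬝ᵥ G.mat.mulVec x := by
  simp only [shiftBilin, dotProduct, Matrix.mulVec, G.intMat_cast, Finset.mul_sum]
  congr 1
  exact Finset.sum_congr rfl fun _ _ => Finset.sum_congr rfl fun _ _ => by ring

lemma SignedGraph.good_iff (G : SignedGraph n) :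
    Good G.intMat lam Finset.univ ↔ ∀ μ : ℝ, IsEigenvalue G.mat μ → -lam ≤ μ := by
  constructor
  · rintro h μ ⟨v, hv, hμ⟩
    have h1 := h v (by simp)
    rw [G.shiftBilin_eq, hμ, dotProduct_smul, smul_eq_mul] at h1
    have h2 : 0 < v ⬝ᵥ v := by
      rcases (Finset.sum_nonneg fun i _ => mul_self_nonneg (v i) : 0 ≤ v ⬝ᵥ v).lt_or_eq with h | h
      · exact h
      · exact absurd (dotProduct_self_eq_zero.1 h.symm) hv
    by_contra! h3
    nlinarith
  · intro h x _
    have hA : G.mat.IsHermitian := by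
      rw [Matrix.IsHermitian, Matrix.conjTranspose_eq_transpose_of_trivial]
      exact G.isSymm
    set B : Matrix (Fin n) (Fin n) ℝ := lam • 1 + G.mat with hB
    have hBh : B.IsHermitian := by
      refine Matrix.IsHermitian.add ?_ hA
      rw [Matrix.IsHermitian, Matrix.conjTranspose_eq_transpose_of_trivial, Matrix.transpose_smul,
        Matrix.transpose_one]
    have hpos : B.PosSemidef := by
      refine hBh.posSemidef_iff_eigenvalues_nonneg.2 fun i => ?_
      have h1 := hBh.mulVec_eigenvectorBasis i
      have h2 : -lam ≤ hBh.eigenvalues i - lam := by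
        refine h _ ⟨⇑(hBh.eigenvectorBasis i), ?_, ?_⟩
        · intro h0
          exact hBh.eigenvectorBasis.orthonormal.ne_zero i (by ext j; exact congrFun h0 j)
        · have h3 : ∀ v, B.mulVec v = lam • v + G.mat.mulVec v := fun v => by
            rw [hB, Matrix.add_mulVec, Matrix.smul_mulVec, Matrix.one_mulVec]
          rw [h3] at h1
          rw [sub_smul, ← h1, add_sub_cancel_left]
      simpa using h2
    have h1 := hpos.dotProduct_mulVec_nonneg x
    rw [G.shiftBilin_eq]
    simpa [hB, Matrix.add_mulVec, Matrix.smul_mulVec, dotProduct_add, dotProduct_smul] using h1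

/-- The signed graph pulled back along a map. -/
def SignedGraph.comap (G : SignedGraph n) (f : Fin m → Fin n) : SignedGraph m where
  mat i j := G.mat (f i) (f j)
  isSymm := Matrix.IsSymm.ext fun _ _ => G.isSymm.apply _ _
  diag_zero _ := G.diag_zero _
  entries _ _ := G.entries _ _

lemma SignedGraph.good_of_embeds {F : SignedGraph m} {G : SignedGraph n} (h : SignedEmbeds F G)
    (hG : Good G.intMat lam Finset.univ) : Good F.intMat lam Finset.univ := by
  obtain ⟨f, hf, hFG⟩ := h
  have h1 : F.intMat = fun i j => G.intMat (f i) (f j) := by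
    funext i j
    simp only [intMat, hFG]
  have h2 := (rootGood_comp (A := G.intMat) (lam := lam) hf (F := Finset.univ.image f) (kap := 0)
    (s := 0) (by simp)).2 ((hG.mono (Finset.subset_univ _)).rootGood 0)
  rw [h1]
  exact h2.good le_rfl

lemma SignedGraph.finite (n : ℕ) : Finite (SignedGraph n) := by
  have h0 : ∀ G : SignedGraph n, ∀ i j, G.intMat i j ∈ ({-1, 0, 1} : Finset ℤ) := fun G i j => by
    simp only [intMat]
    split_ifs <;> simp
  refine Finite.of_injective (β := Fin n → Fin n → ({-1, 0, 1} : Finset ℤ))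
    (fun G i j => ⟨G.intMat i j, h0 G i j⟩) fun G H h => ?_
  have h1 : ∀ i j, G.mat i j = H.mat i j := by
    intro i j
    have h2 := congrArg Subtype.val (congrFun (congrFun h i) j)
    rw [← G.intMat_cast, ← H.intMat_cast]
    exact congrArg Int.cast h2
  cases G; cases H
  congr
  exact Matrix.ext h1

/-- The family has a finite forbidden characterization if large connected signed graphs belong to
it as soon as their small subgraphs do. -/
theorem hasFiniteForbidden_of_local
    (h : ∃ N R : ℕ, ∀ {V : Type} [Fintype V] {A : V → V → ℤ}, IsSignedAdj A →
      RelConn (fun x y => A x y ≠ 0) (Finset.univ : Finset V) → N ≤ Fintype.card V →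
      (∀ X : Finset V, X.card ≤ R → Good A lam X) → Good A lam Finset.univ) :
    HasFiniteForbiddenCharacterizationSigned
      (fun _ G => ∀ μ : ℝ, IsEigenvalue G.mat μ → -lam ≤ μ) := by
  obtain ⟨N, R, h⟩ := h
  have hfin : ∀ m, Finite (SignedGraph m) := SignedGraph.finite
  set T := (m : Fin (N + R + 1)) × {F : SignedGraph m // ¬ Good F.intMat lam Finset.univ}
  obtain ⟨k, ⟨e⟩⟩ := Finite.exists_equiv_fin T
  refine ⟨k, fun i => (e.symm i).1, fun i => (e.symm i).2.1, fun n G => ?_⟩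
  refine (G.good_iff (lam := lam)).symm.trans ?_
  constructor
  · intro hG i hi
    exact (e.symm i).2.2 (SignedGraph.good_of_embeds hi hG)
  · intro hG
    by_contra hbad
    have hex : ∃ m, ∃ F : SignedGraph m, SignedEmbeds F G ∧ ¬ Good F.intMat lam Finset.univ :=
      ⟨n, G, ⟨id, Function.injective_id, fun _ _ => rfl⟩, hbad⟩
    obtain ⟨m, ⟨F, hFG, hF⟩, hmin⟩ : ∃ m, (∃ F : SignedGraph m, SignedEmbeds F G ∧
        ¬ Good F.intMat lam Finset.univ) ∧ ∀ l < m, ¬ ∃ F : SignedGraph l, SignedEmbeds F G ∧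
        ¬ Good F.intMat lam Finset.univ :=
      ⟨Nat.find hex, Nat.find_spec hex, fun _ => Nat.find_min hex⟩
    have hsub : ∀ X : Finset (Fin m), X ≠ Finset.univ → Good F.intMat lam X := by
      intro X hX
      set f : Fin X.card → Fin m := fun i => (X.equivFin.symm i : Fin m) with hf
      have hfi : Function.Injective f := Subtype.val_injective.comp X.equivFin.symm.injective
      have hfX : ∀ v, v ∈ X ↔ v ∈ Set.range f := fun v =>
        ⟨fun hv => ⟨X.equivFin ⟨v, hv⟩, by simp [hf]⟩,
          by rintro ⟨i, rfl⟩; exact (X.equivFin.symm i).2⟩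
      have hlt : X.card < m := by
        have := Finset.card_lt_univ_of_notMem
          (Classical.not_forall.1 fun h' => hX (Finset.eq_univ_of_forall h')).choose_spec
        simpa using this
      have h1 : Good (F.comap f).intMat lam Finset.univ := by
        by_contra h2
        obtain ⟨g, hg, hFg⟩ := hFG
        exact hmin _ hlt ⟨F.comap f, ⟨g ∘ f, hg.comp hfi, fun i j => hFg _ _⟩, h2⟩
      exact ((rootGood_comp (A := F.intMat) (s := 0) hfi hfX).1 (h1.rootGood 0)).good le_rfl
    by_cases hmK : m < N + R + 1
    · refine hG (e ⟨⟨m, hmK⟩, F, hF⟩) ?_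
      show SignedEmbeds (e.symm (e ⟨⟨m, hmK⟩, F, hF⟩)).2.1 G
      rw [e.symm_apply_apply]
      exact hFG
    · refine hF (h F.isSignedAdj ?_ (by rw [Fintype.card_fin]; omega) fun X hX => hsub X ?_)
      · intro Y _ hYne hout
        by_contra hY
        have h1 := hsub Y hY
        have h2 : Good F.intMat lam (Finset.univ \ Y) := by
          refine hsub _ fun h3 => ?_
          obtain ⟨y, hy⟩ := hYne
          have := h3 ▸ Finset.mem_univ y
          exact (Finset.mem_sdiff.1 this).2 hy
        refine hF (RootGood.good (kap := 1) (s := 0) (RootGood.of_split F.isSignedAdj (Y := Y) ?_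
          h1.rootGood_zero (by convert h2.rootGood_zero)) zero_le_one)
        intro y hy z hz hzY
        simpa using not_not.1 (hout y hy z hz hzY)
      · rintro rfl
        rw [Finset.card_univ, Fintype.card_fin] at hX
        omega

theorem hasFiniteForbidden_of_lt {βs lamStar : ℝ} (hβs : βs ^ 3 = βs + 1)
    (hstar : lamStar = Real.sqrt βs + (Real.sqrt βs)⁻¹) (hlt : lam < lamStar) :
    HasFiniteForbiddenCharacterizationSigned
      (fun _ G => ∀ μ : ℝ, IsEigenvalue G.mat μ → -lam ≤ μ) := by
  apply hasFiniteForbidden_of_local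
  have h2 := (lamStar_mem hβs hstar).1
  rcases lt_or_ge lam 0 with h0 | h0
  · refine ⟨1, 1, fun {V _ A} hA _ hcard hgood => ?_⟩
    obtain ⟨x⟩ := Fintype.card_pos_iff.1 (show 0 < Fintype.card V by omega)
    have := hgood {x} (by simp) (Pi.single x 1) fun v hv => by
      simp only [Finset.mem_singleton] at hv
      simp [hv]
    rw [shiftBilin_single_single, if_pos rfl, hA.diag] at this
    push_cast at this
    linarith
  rcases lt_or_ge lam 2 with h | h
  · obtain ⟨kap, hb⟩ := exists_rootBound hβs hstar le_rfl (by linarith)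
    exact exists_good_univ_of_lt_two h0 h hb
  · obtain ⟨kap, hb⟩ := exists_rootBound hβs hstar h hlt
    obtain ⟨N, R, hN⟩ := exists_rootRep_univ_of_card hb
    exact ⟨N, R, fun hA hconn hcard hgood => (hN hA hconn hcard hgood).good h⟩

end Characterization


section Glue

variable {V W : Type} {A : V → V → ℤ} {B : W → W → ℤ}
  {u : V → ℤ} {w : W → ℤ} {lam : ℝ}

/-- Block matrix with diagonal blocks `A`, `B` and off-diagonal block `c • u wᵀ`. -/
def glueAdj (A : V → V → ℤ) (B : W → W → ℤ) (u : V → ℤ) (w : W → ℤ) (c : ℤ) :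
    V ⊕ W → V ⊕ W → ℤ
  | .inl i, .inl j => A i j
  | .inr i, .inr j => B i j
  | .inl i, .inr j => c * (u i * w j)
  | .inr i, .inl j => c * (u j * w i)

lemma isSignedAdj_glueAdj (hA : IsSignedAdj A) (hB : IsSignedAdj B)
    (hu : ∀ v, u v = 0 ∨ u v = 1) (hw : ∀ v, w v = 0 ∨ w v = 1) {c : ℤ} (hc : c = 0 ∨ c = 1) :
    IsSignedAdj (glueAdj A B u w c) where
  symm x y := by
    rcases x with x | x <;> rcases y with y | y <;> simp only [glueAdj]
    · exact hA.symm x y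
    · exact hB.symm x y
  diag x := by rcases x with x | x <;> simp [glueAdj, hA.diag, hB.diag]
  entries x y := by
    rcases x with x | x <;> rcases y with y | y <;> simp only [glueAdj]
    · exact hA.entries x y
    · rcases hc with rfl | rfl <;> rcases hu x with h | h <;> rcases hw y with h' | h' <;>
        simp [h, h']
    · rcases hc with rfl | rfl <;> rcases hu y with h | h <;> rcases hw x with h' | h' <;>
        simp [h, h']
    · exact hB.entries x y

variable [Fintype V] [Fintype W]

lemma shiftBilin_glueAdj (c : ℤ) (x : V ⊕ W → ℝ) :
    shiftBilin (glueAdj A B u w c) lam x x =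
      shiftBilin A lam (fun i => x (.inl i)) (fun i => x (.inl i)) +
      shiftBilin B lam (fun i => x (.inr i)) (fun i => x (.inr i)) +
      2 * c * ((∑ i, (u i : ℝ) * x (.inl i)) * ∑ j, (w j : ℝ) * x (.inr j)) := by
  have h1 : ∑ i, ∑ j, ((c * (u i * w j) : ℤ) : ℝ) * x (.inl i) * x (.inr j) =
      c * ((∑ i, (u i : ℝ) * x (.inl i)) * ∑ j, (w j : ℝ) * x (.inr j)) := by
    rw [Finset.sum_mul_sum, Finset.mul_sum]
    refine Finset.sum_congr rfl fun i _ => ?_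
    rw [Finset.mul_sum]
    exact Finset.sum_congr rfl fun j _ => by push_cast; ring
  have h2 : ∑ j, ∑ i, ((c * (u i * w j) : ℤ) : ℝ) * x (.inr j) * x (.inl i) =
      c * ((∑ i, (u i : ℝ) * x (.inl i)) * ∑ j, (w j : ℝ) * x (.inr j)) := by
    rw [← h1, Finset.sum_comm]
    exact Finset.sum_congr rfl fun i _ => Finset.sum_congr rfl fun j _ => by ring
  simp only [shiftBilin, Fintype.sum_sum_type, glueAdj, Finset.sum_add_distrib, h1, h2]
  ring

/-- The value `h` is the exact capacity of some signed graph with a distinguished vertex set `u`: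
the form of `lam + A`, bordered by `u` and `h`, is nonnegative and singular. -/
def IsCapacity (lam h : ℝ) : Prop :=
  ∃ (V : Type) (_ : Fintype V) (A : V → V → ℤ) (u : V → ℤ), IsSignedAdj A ∧
    (∀ v, u v = 0 ∨ u v = 1) ∧
    (∀ (x : V → ℝ) (t : ℝ), 0 ≤ shiftBilin A lam x x + 2 * t * ∑ v, (u v : ℝ) * x v + h * t ^ 2) ∧
    ∃ x : V → ℝ, ∑ v, (u v : ℝ) * x v = -h ∧ shiftBilin A lam x x = h

lemma shiftBilin_unit (y : Unit → ℝ) :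
    shiftBilin (fun _ _ : Unit => (0 : ℤ)) lam y y = lam * y () ^ 2 := by
  simp [shiftBilin, sq]

lemma isCapacity_zero (lam : ℝ) : IsCapacity lam 0 :=
  ⟨Empty, inferInstance, fun _ _ => 0, fun _ => 0, ⟨by simp, by simp, by simp⟩, by simp,
    by simp [shiftBilin], by simp [shiftBilin]⟩

lemma sum_elim_mul (x : V → ℝ) (y : W → ℝ) :
    ∑ v, ((Sum.elim u w v : ℤ) : ℝ) * Sum.elim x y v =
      ∑ v, (u v : ℝ) * x v + ∑ v, (w v : ℝ) * y v := by
  simp [Fintype.sum_sum_type]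

lemma IsCapacity.add {h₁ h₂ : ℝ} (H₁ : IsCapacity lam h₁) (H₂ : IsCapacity lam h₂) :
    IsCapacity lam (h₁ + h₂) := by
  obtain ⟨V, _, A, u, hA, hu, hQ, x, hx, hx'⟩ := H₁
  obtain ⟨W, _, B, w, hB, hw, hQ', y, hy, hy'⟩ := H₂
  refine ⟨V ⊕ W, inferInstance, glueAdj A B u w 0, Sum.elim u w,
    isSignedAdj_glueAdj hA hB hu hw (.inl rfl), ?_, fun z t => ?_, Sum.elim x y, ?_, ?_⟩
  · rintro (v | v)
    · exact hu v
    · exact hw v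
  · rw [shiftBilin_glueAdj]
    have h1 := hQ (fun i => z (.inl i)) t
    have h2 := hQ' (fun i => z (.inr i)) t
    simp only [Fintype.sum_sum_type, Sum.elim_inl, Sum.elim_inr]
    push_cast
    linarith
  · rw [sum_elim_mul, hx, hy]; ring
  · rw [shiftBilin_glueAdj]
    simp [hx', hy']

lemma IsCapacity.inv {h : ℝ} (H : IsCapacity lam h) (hlt : h < lam) :
    IsCapacity lam (1 / (lam - h)) := by
  obtain ⟨V, _, A, u, hA, hu, hQ, x, hx, hx'⟩ := H
  have hpos : 0 < lam - h := by linarith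
  refine ⟨V ⊕ Unit, inferInstance, glueAdj A (fun _ _ => 0) u (fun _ => 1) 1,
    Sum.elim (fun _ => 0) (fun _ => 1), isSignedAdj_glueAdj hA ⟨by simp, by simp, by simp⟩ hu
      (by simp) (.inr rfl), ?_, fun z t => ?_,
    Sum.elim ((-1 / (lam - h)) • x) (fun _ => -1 / (lam - h)), ?_, ?_⟩
  · rintro (v | v) <;> simp
  · rw [shiftBilin_glueAdj]
    have h1 := hQ (fun i => z (.inl i)) (z (.inr ()))
    have h3 : 0 ≤ (lam - h) * z (.inr ()) ^ 2 + 2 * t * z (.inr ()) + 1 / (lam - h) * t ^ 2 := by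
      have : (lam - h) * z (.inr ()) ^ 2 + 2 * t * z (.inr ()) + 1 / (lam - h) * t ^ 2 =
          ((lam - h) * z (.inr ()) + t) ^ 2 / (lam - h) := by field_simp; ring
      rw [this]
      positivity
    rw [shiftBilin_unit]
    simp only [Fintype.sum_sum_type, Sum.elim_inl, Sum.elim_inr, Finset.univ_unique,
      Finset.sum_singleton, Int.cast_zero, Int.cast_one, zero_mul, one_mul, Finset.sum_const_zero,
      zero_add, PUnit.default_eq_unit]
    nlinarith
  · rw [sum_elim_mul]; simp; ring
  · rw [shiftBilin_glueAdj]
    have h3 : ∑ i, (u i : ℝ) * ((-1 / (lam - h)) • x) i = (-1 / (lam - h)) * -h := by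
      rw [← hx, Finset.mul_sum]
      exact Finset.sum_congr rfl fun _ _ => by simp; ring
    simp only [Sum.elim_inl, Sum.elim_inr]
    rw [shiftBilin_unit, h3]
    change shiftBilin A lam ((-1 / (lam - h)) • x) ((-1 / (lam - h)) • x) + _ + _ = _
    rw [shiftBilin_smul_left, shiftBilin_smul_right, hx']
    simp
    field_simp
    ring

lemma IsCapacity.clique {k₁ k₂ : ℝ} (hk₁ : 0 ≤ k₁) (hk₂ : 0 ≤ k₂)
    (H₁ : IsCapacity lam (k₁ / (1 + k₁))) (H₂ : IsCapacity lam (k₂ / (1 + k₂))) :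
    IsCapacity lam ((k₁ + k₂) / (1 + (k₁ + k₂))) := by
  obtain ⟨V, _, A, u, hA, hu, hQ, x, hx, hx'⟩ := H₁
  obtain ⟨W, _, B, w, hB, hw, hQ', y, hy, hy'⟩ := H₂
  have hp : 0 < 1 + (k₁ + k₂) := by linarith
  have hp₁ : 0 < 1 + k₁ := by linarith
  have hp₂ : 0 < 1 + k₂ := by linarith
  set c₁ := (1 + k₁) / (1 + (k₁ + k₂)) with hc₁
  set c₂ := (1 + k₂) / (1 + (k₁ + k₂)) with hc₂
  have hsx : ∑ i, (u i : ℝ) * (c₁ • x) i = c₁ * -(k₁ / (1 + k₁)) := by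
    rw [← hx, Finset.mul_sum]
    exact Finset.sum_congr rfl fun _ _ => by simp; ring
  have hsy : ∑ i, (w i : ℝ) * (c₂ • y) i = c₂ * -(k₂ / (1 + k₂)) := by
    rw [← hy, Finset.mul_sum]
    exact Finset.sum_congr rfl fun _ _ => by simp; ring
  refine ⟨V ⊕ W, inferInstance, glueAdj A B u w 1, Sum.elim u w,
    isSignedAdj_glueAdj hA hB hu hw (.inr rfl), ?_, fun z t => ?_,
    Sum.elim (c₁ • x) (c₂ • y), ?_, ?_⟩
  · rintro (v | v)
    · exact hu v
    · exact hw v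
  · rw [shiftBilin_glueAdj]
    simp only [Fintype.sum_sum_type, Sum.elim_inl, Sum.elim_inr]
    push_cast
    set s := ∑ i, (u i : ℝ) * z (.inl i)
    set r := ∑ i, (w i : ℝ) * z (.inr i)
    set σ := t / (1 + (k₁ + k₂)) with hσ
    have h1 := hQ (fun i => z (.inl i)) (σ - s)
    have h2 := hQ' (fun i => z (.inr i)) (σ - r)
    have e1 : ∀ k a : ℝ, 0 < 1 + k → -(2 * (σ - a) * a) - k / (1 + k) * (σ - a) ^ 2 =
        a ^ 2 - 2 * σ * a - k * σ ^ 2 + (k * σ + a) ^ 2 / (1 + k) := by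
      intro k a hk
      field_simp
      ring
    have e2 : (s + r) ^ 2 - 2 * σ * (s + r) - (k₁ + k₂) * σ ^ 2 + 2 * t * (s + r) +
        (k₁ + k₂) / (1 + (k₁ + k₂)) * t ^ 2 =
        ((s + r) + (k₁ + k₂) / (1 + (k₁ + k₂)) * t) ^ 2 := by
      rw [hσ]
      field_simp
      ring
    have e3 := e1 k₁ s hp₁
    have e4 := e1 k₂ r hp₂
    have p1 : 0 ≤ (k₁ * σ + s) ^ 2 / (1 + k₁) := by positivity
    have p2 : 0 ≤ (k₂ * σ + r) ^ 2 / (1 + k₂) := by positivity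
    have p3 := sq_nonneg ((s + r) + (k₁ + k₂) / (1 + (k₁ + k₂)) * t)
    rw [← e2] at p3
    have h1' : 0 ≤ shiftBilin A lam (fun i => z (.inl i)) (fun i => z (.inl i)) +
      2 * (σ - s) * s + k₁ / (1 + k₁) * (σ - s) ^ 2 := h1
    have h2' : 0 ≤ shiftBilin B lam (fun i => z (.inr i)) (fun i => z (.inr i)) +
      2 * (σ - r) * r + k₂ / (1 + k₂) * (σ - r) ^ 2 := h2
    nlinarith only [h1', h2', p1, p2, p3, e3, e4]
  · rw [sum_elim_mul, hsx, hsy, hc₁, hc₂]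
    field_simp
    ring
  · rw [shiftBilin_glueAdj]
    simp only [Sum.elim_inl, Sum.elim_inr]
    rw [hsx, hsy]
    change shiftBilin A lam (c₁ • x) (c₁ • x) + shiftBilin B lam (c₂ • y) (c₂ • y) + _ = _
    rw [shiftBilin_smul_left, shiftBilin_smul_right, hx', shiftBilin_smul_left,
      shiftBilin_smul_right, hy', hc₁, hc₂]
    push_cast
    field_simp
    ring

/-- A signed graph on an arbitrary finite type, relabelled by `Fin`. -/
lemma IsSignedAdj.exists_signedGraph (hA : IsSignedAdj A) : ∃ G : SignedGraph (Fintype.card V),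
    ∀ lam, Good G.intMat lam Finset.univ ↔ Good A lam Finset.univ := by
  set e := Fintype.equivFin V
  set G : SignedGraph (Fintype.card V) :=
    { mat := fun i j => A (e.symm i) (e.symm j)
      isSymm := Matrix.IsSymm.ext fun i j => by rw [hA.symm]
      diag_zero := fun i => by simp [hA.diag]
      entries := fun i j => by
        rcases hA.entries (e.symm i) (e.symm j) with h | h | h <;> simp [h] } with hG
  refine ⟨G, fun lam => ?_⟩
  have h1 : G.intMat = fun i j => A (e.symm i) (e.symm j) := by
    funext i j
    exact Int.cast_injective (α := ℝ) (G.intMat_cast i j)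
  have h2 := rootGood_comp (A := A) (lam := lam) (f := e.symm) e.symm.injective
    (F := Finset.univ) (kap := 0) (s := 0) (by simp)
  rw [h1]
  exact ⟨fun h => (h2.1 (h.rootGood 0)).good le_rfl, fun h => (h2.2 (h.rootGood 0)).good le_rfl⟩

/-- A capacity just below `lam` gives a signed graph whose smallest eigenvalue is just above
`-lam`. -/
lemma IsCapacity.exists_signedGraph {h η : ℝ} (H : IsCapacity lam h) (hle : h ≤ lam)
    (hlt : lam - η < h) : ∃ (n : ℕ) (G : SignedGraph n), Good G.intMat lam Finset.univ ∧
      ¬ Good G.intMat (lam - η) Finset.univ := by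
  obtain ⟨V, _, A, u, hA, hu, hQ, x, hx, hx'⟩ := H
  obtain ⟨G, hG⟩ := (isSignedAdj_glueAdj (w := fun _ : Unit => 1) (B := fun _ _ => 0) hA
    ⟨by simp, by simp, by simp⟩ hu (by simp) (.inr rfl)).exists_signedGraph
  refine ⟨_, G, (hG _).2 fun z _ => ?_, fun hgood => ?_⟩
  · rw [shiftBilin_glueAdj]
    have h1 := hQ (fun i => z (.inl i)) (z (.inr ()))
    rw [shiftBilin_unit]
    simp
    nlinarith [sq_nonneg (z (.inr ()))]
  · have h1 := (hG _).1 hgood (Sum.elim x fun _ => 1) (by simp)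
    rw [shiftBilin_glueAdj] at h1
    have h3 : shiftBilin A (lam - η) x x = h - η * ∑ v, x v * x v := by
      rw [← hx']; simp only [shiftBilin]; ring
    simp only [Sum.elim_inl, Sum.elim_inr, Int.cast_one, Finset.univ_unique,
      Finset.sum_singleton] at h1
    rw [shiftBilin_unit, hx] at h1
    change 0 ≤ shiftBilin A (lam - η) x x + _ + _ at h1
    rw [h3] at h1
    have h4 : 0 ≤ ∑ v, x v * x v := Finset.sum_nonneg fun v _ => mul_self_nonneg _
    nlinarith

end Glue


section Density

variable {lam η : ℝ}

/-- Approximation from below by an additive set which is stable under an increasing contraction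
with inverse `ψ`. -/
lemma exists_mem_near {K : Set ℝ} (h0 : (0 : ℝ) ∈ K) (hadd : ∀ x ∈ K, ∀ y ∈ K, x + y ∈ K)
    {a m M c : ℝ} (ha : a ∈ K) (ha0 : 0 < a) (hm : 0 ≤ m) (hc0 : 0 ≤ c) (hc : c < 1)
    {ψ : ℝ → ℝ} (hψ : ∀ T, m ≤ T → T ≤ m + a → m ≤ ψ T ∧ ψ T ≤ M)
    (hφ : ∀ T, m ≤ T → T ≤ m + a → ∀ k ∈ K, k ≤ ψ T → ∃ k' ∈ K, k' ≤ T ∧ T - k' ≤ c * (ψ T - k))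
    {T : ℝ} (hT : m ≤ T) (hη : 0 < η) : ∃ k ∈ K, k ≤ T ∧ T - η < k := by
  set M' := max M T with hM'
  have hM0 : 0 ≤ M' := hm.trans (hT.trans (le_max_right _ _))
  have hmul : ∀ p : ℕ, p * a ∈ K := fun p => by
    induction p with
    | zero => simpa using h0
    | succ p ih => push_cast; rw [add_mul, one_mul]; exact hadd _ ih _ ha
  have key : ∀ n : ℕ, ∀ T, m ≤ T → T ≤ M' → ∃ k ∈ K, k ≤ T ∧ T - k ≤ c ^ n * M' := by
    intro n
    induction n with
    | zero => exact fun T h1 h2 => ⟨0, h0, hm.trans h1, by simpa using h2⟩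
    | succ n ih =>
      intro T h1 _
      set p := ⌊(T - m) / a⌋₊
      have hp1 : p * a ≤ T - m :=
        (le_div_iff₀ ha0).1 (Nat.floor_le (div_nonneg (by linarith) ha0.le))
      have hp2 : T - m < (p + 1) * a := (div_lt_iff₀ ha0).1 (Nat.lt_floor_add_one _)
      have h3 : m ≤ T - p * a := by linarith
      have h4 : T - p * a ≤ m + a := by linarith
      obtain ⟨k, hk, hk1, hk2⟩ := ih _ (hψ _ h3 h4).1 ((hψ _ h3 h4).2.trans (le_max_left _ _))
      obtain ⟨k', hk', h5, h6⟩ := hφ _ h3 h4 k hk hk1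
      refine ⟨k' + p * a, hadd _ hk' _ (hmul p), by linarith, ?_⟩
      have := mul_le_mul_of_nonneg_left hk2 hc0
      rw [pow_succ']
      linarith
  have hlim : Filter.Tendsto (fun n : ℕ => c ^ n * M') Filter.atTop (𝓝 (0 * M')) :=
    (tendsto_pow_atTop_nhds_zero_of_lt_one hc0 hc).mul_const _
  rw [zero_mul] at hlim
  obtain ⟨n, hn⟩ := (hlim.eventually (gt_mem_nhds hη)).exists
  obtain ⟨k, hk, h1, h2⟩ := key n T hT (le_max_right _ _)
  exact ⟨k, hk, h1, by linarith⟩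

lemma isCapacity_inv_lam (h : 0 < lam) : IsCapacity lam (1 / lam) := by
  simpa using (isCapacity_zero lam).inv h

/-- Capacities of forests are dense in a half-line if `lam` is large. -/
lemma exists_isCapacity_of_large (hlam : 47 / 20 ≤ lam) (hη : 0 < η) :
    ∃ h, IsCapacity lam h ∧ h ≤ lam ∧ lam - η < h := by
  have hl : 0 < lam := by linarith
  set D := Real.sqrt (lam ^ 2 - 4) with hD
  have hD2 : D ^ 2 = lam ^ 2 - 4 := Real.sq_sqrt (by nlinarith)
  have hD0 : 0 ≤ D := Real.sqrt_nonneg _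
  set r := (lam - D) / 2 with hr
  have hr2 : r * (lam - r) = 1 := by rw [hr]; nlinarith
  have hDl : D < lam := by nlinarith
  have hr0 : 0 < r := by rw [hr]; linarith
  have hD1 : lam - 2 + 2 / lam < D := by
    refine lt_of_pow_lt_pow_left₀ 2 hD0 ?_
    rw [hD2]
    have : lam ^ 2 - 4 - (lam - 2 + 2 / lam) ^ 2 =
        4 * (lam ^ 3 - 3 * lam ^ 2 + 2 * lam - 1) / lam ^ 2 := by
      field_simp; ring
    have h2 : 0 < lam ^ 3 - 3 * lam ^ 2 + 2 * lam - 1 := by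
      nlinarith [mul_nonneg (sub_nonneg.2 hlam) (sub_nonneg.2 hlam),
        mul_nonneg (mul_nonneg (sub_nonneg.2 hlam) (sub_nonneg.2 hlam)) hl.le]
    have h3 : 0 < 4 * (lam ^ 3 - 3 * lam ^ 2 + 2 * lam - 1) / lam ^ 2 := by positivity
    linarith
  have hr1 : r + 1 / lam < 1 := by
    have : 2 / lam = 2 * (1 / lam) := by ring
    rw [hr]; linarith
  have hrl : r ≤ lam := by rw [hr]; linarith
  have hla : 0 < 1 / lam := by positivity
  refine exists_mem_near (K := {h | IsCapacity lam h}) (isCapacity_zero lam)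
    (fun x hx y hy => hx.add hy) (a := 1 / lam) (m := r) (M := lam) (c := (r + 1 / lam) ^ 2)
    (isCapacity_inv_lam hl) hla hr0.le (by positivity) (by nlinarith)
    (ψ := fun T => lam - 1 / T) (fun T h1 h2 => ?_) (fun T h1 h2 k hk hkT => ?_) hrl hη
  · have hT : 0 < T := hr0.trans_le h1
    have h3 : 1 / T ≤ 1 / r := one_div_le_one_div_of_le hr0 h1
    have h4 : 1 / r = lam - r := by rw [← hr2]; field_simp
    have h5 : 0 < 1 / T := by positivity
    constructor <;> linarith
  · have hT : 0 < T := hr0.trans_le h1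
    have h5 : 0 < 1 / T := by positivity
    have hkT' : 1 / T ≤ lam - k := by linarith
    have hkl : 0 < lam - k := by linarith
    refine ⟨1 / (lam - k), hk.inv (by linarith), ?_, ?_⟩
    · exact (one_div_le_one_div_of_le h5 hkT').trans_eq (one_div_one_div T)
    · have h6 : 1 / (lam - k) ≤ T := (one_div_le_one_div_of_le h5 hkT').trans_eq (one_div_one_div T)
      have h7 : T - 1 / (lam - k) = T * (1 / (lam - k)) * (lam - 1 / T - k) := by
        field_simp
        ring
      rw [h7]
      refine mul_le_mul_of_nonneg_right ?_ (by linarith)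
      have h8 : 0 < 1 / (lam - k) := by positivity
      nlinarith

/-- Capacities below `1` of cliques of forests are dense in a half-open interval. -/
lemma exists_isCapacity_near (hlam : 2 < lam) (hlam' : lam ≤ 12 / 5) {h : ℝ} (hh1 : h < 1)
    (hh : h ^ 2 - lam * h + 1 ≤ 0) (hη : 0 < η) :
    ∃ h', IsCapacity lam h' ∧ h' ≤ h ∧ h - η < h' := by
  obtain ⟨ε, hε⟩ : ∃ ε, ε = lam - 2 := ⟨_, rfl⟩
  have hε0 : 0 < ε := by linarith
  have hε1 : ε ≤ 2 / 5 := by linarith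
  set D := Real.sqrt (1 + 4 / ε) with hD
  have hD2 : D ^ 2 = 1 + 4 / ε := Real.sq_sqrt (by positivity)
  have hD1 : 1 < D := by
    have : 0 < 4 / ε := by positivity
    nlinarith [Real.sqrt_nonneg (1 + 4 / ε)]
  set m := (D - 1) / 2 with hm
  have hm0 : 0 < m := by rw [hm]; linarith
  have hmm : ε * (m * (m + 1)) = 1 := by
    have : m * (m + 1) = (D ^ 2 - 1) / 4 := by rw [hm]; ring
    rw [this, hD2]; field_simp; ring
  have hmε : ε < m := by
    by_contra! h1
    have h2 : m * (m + 1) ≤ ε * (ε + 1) := by nlinarith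
    have h3 : ε * (m * (m + 1)) ≤ ε * (ε * (ε + 1)) := mul_le_mul_of_nonneg_left h2 hε0.le
    have h4 : ε * ε ≤ 2 / 5 * (2 / 5) := mul_le_mul hε1 hε1 hε0.le (by norm_num)
    nlinarith
  have hem : ε * m = 1 / (m + 1) := by
    rw [eq_div_iff (by linarith)]; linarith
  have hbd : ε * (m + 1 / (1 + ε)) < 1 := by
    rw [mul_add, hem]
    have h1 : 1 / (m + 1) < 1 / (1 + ε) := one_div_lt_one_div_of_lt (by linarith) (by linarith)
    have h2 : ε * (1 / (1 + ε)) = 1 - 1 / (1 + ε) := by field_simp; ring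
    linarith
  have hh0 : 0 < h := by nlinarith [sq_nonneg h]
  set T := h / (1 - h) with hT
  have h1h : 0 < 1 - h := by linarith
  have hT0 : 0 < T := by positivity
  have hTm : m ≤ T := by
    by_contra! h1
    have h2 : T * (T + 1) < m * (m + 1) := by nlinarith
    have h3 : T * (T + 1) = h / (1 - h) ^ 2 := by rw [hT]; field_simp; ring
    have h4 : ε * (h / (1 - h) ^ 2) < 1 := by
      rw [← h3]; exact (mul_lt_mul_of_pos_left h2 hε0).trans_eq hmm
    rw [← mul_div_assoc, div_lt_one (by positivity), hε] at h4
    nlinarith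
  have hc1 : 1 / (1 + ε) ^ 2 < 1 := by
    rw [div_lt_one (by positivity)]; nlinarith
  have hcap : ∀ k, 0 ≤ k → IsCapacity lam (k / (1 + k)) →
      IsCapacity lam ((1 / (ε + 1 / (1 + k))) / (1 + 1 / (ε + 1 / (1 + k)))) := by
    intro k hk H
    have h1 : k / (1 + k) < lam := by
      rw [div_lt_iff₀ (by linarith)]; nlinarith
    convert H.inv h1 using 1
    have : lam = ε + 2 := by linarith
    rw [this]
    have h2 : ε + 2 - k / (1 + k) = ε + 1 + 1 / (1 + k) := by field_simp; ring
    have h3 : 0 < 1 / (1 + k) := by positivity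
    rw [h2]
    field_simp
    ring
  suffices ∃ k ∈ {k | 0 ≤ k ∧ IsCapacity lam (k / (1 + k))}, k ≤ T ∧ T - η < k by
    obtain ⟨k, ⟨hk0, hk⟩, hkT, hkη⟩ := this
    refine ⟨_, hk, ?_, ?_⟩
    · rw [div_le_iff₀ (by linarith)]
      rw [hT, le_div_iff₀ h1h] at hkT
      linarith
    · have h1 : h = T / (1 + T) := by rw [hT]; field_simp; ring
      have h2 : T / (1 + T) - k / (1 + k) = (T - k) / ((1 + T) * (1 + k)) := by field_simp; ring
      have h3 : (T - k) / ((1 + T) * (1 + k)) ≤ T - k :=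
        div_le_self (by linarith) (by nlinarith)
      rw [h1]; linarith
  refine exists_mem_near
    (K := {k | 0 ≤ k ∧ IsCapacity lam (k / (1 + k))})
    (by simpa using isCapacity_zero lam)
    (fun x hx y hy => ⟨add_nonneg hx.1 hy.1, hx.2.clique hx.1 hy.1 hy.2⟩) (a := 1 / (1 + ε))
    (m := m) (M := (m + 1 / (1 + ε)) / (1 - ε * (m + 1 / (1 + ε)))) (c := 1 / (1 + ε) ^ 2)
    ⟨by positivity, by
      have := hcap 0 le_rfl (by simpa using isCapacity_zero lam)
      simpa [add_comm] using this⟩ (by positivity) hm0.le (by positivity) hc1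
    (ψ := fun T => T / (1 - ε * T) - 1) (fun T h1 h2 => ?_) (fun T h1 h2 k hk hkT => ?_) hTm hη
  · have hT0 : 0 < T := hm0.trans_le h1
    have h3 : ε * T ≤ ε * (m + 1 / (1 + ε)) := mul_le_mul_of_nonneg_left h2 hε0.le
    have h4 : 0 < 1 - ε * (m + 1 / (1 + ε)) := by linarith
    have h5 : 0 < 1 - ε * T := by linarith
    constructor
    · rw [le_sub_iff_add_le, le_div_iff₀ h5]
      nlinarith
    · have : T / (1 - ε * T) ≤ (m + 1 / (1 + ε)) / (1 - ε * (m + 1 / (1 + ε))) :=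
        div_le_div₀ (by positivity) h2 h4 (by linarith)
      linarith
  · have hT0 : 0 < T := hm0.trans_le h1
    have h3 : ε * T ≤ ε * (m + 1 / (1 + ε)) := mul_le_mul_of_nonneg_left h2 hε0.le
    have h5 : 0 < 1 - ε * T := by linarith
    obtain ⟨hk0, hk⟩ := hk
    have hp : 0 < 1 / (1 + k) := by positivity
    have hkT' : (1 + k) * (1 - ε * T) ≤ T := by
      rw [← le_div_iff₀ h5]; linarith
    have e1 : 1 / (ε + 1 / (1 + k)) = (1 + k) / (ε * (1 + k) + 1) := by field_simp
    have e2 : T - (1 + k) / (ε * (1 + k) + 1) =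
        (T - (1 + k) * (1 - ε * T)) / (ε * (1 + k) + 1) := by field_simp; ring
    have e3 : T / (1 - ε * T) - 1 - k = (T - (1 + k) * (1 - ε * T)) / (1 - ε * T) := by
      rw [eq_div_iff h5.ne', sub_mul, sub_mul, div_mul_cancel₀ _ h5.ne']; ring
    have hq : 0 < ε * (1 + k) + 1 := by positivity
    refine ⟨_, ⟨by positivity, hcap k hk0 hk⟩, ?_, ?_⟩
    · rw [e1, div_le_iff₀ hq]; linarith
    · rw [e1, e2, e3, div_mul_div_comm, one_mul]
      refine div_le_div_of_nonneg_left (by linarith) (by positivity) ?_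
      have h6 : (1 + ε) * (1 - ε * T) ≤ 1 := by
        have h7 : ε * m < 1 := by rw [hem, div_lt_one (by linarith)]; linarith
        have h8 : ε * m ≤ ε * T := mul_le_mul_of_nonneg_left h1 hε0.le
        have h9 : (1 + ε) * (1 - ε * T) ≤ (1 + ε) * (1 - ε * m) :=
          mul_le_mul_of_nonneg_left (by linarith) (by linarith)
        have h10 : (1 + ε) * (1 - ε * m) = 1 - ε * m * (1 - ε * m) := by
          linear_combination (-ε) * hmm
        have h11 : 0 ≤ ε * m * (1 - ε * m) :=
          mul_nonneg (mul_pos hε0 hm0).le (by linarith)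
        linarith
      calc (1 + ε) ^ 2 * (1 - ε * T) = (1 + ε) * ((1 + ε) * (1 - ε * T)) := by ring
        _ ≤ (1 + ε) * 1 := mul_le_mul_of_nonneg_left h6 (by linarith)
        _ ≤ ε * (1 + k) + 1 := by linarith [mul_nonneg hε0.le hk0]

end Density


section Threshold

variable {βs lamStar lam η : ℝ}

lemma lamStar_sq (hβs : βs ^ 3 = βs + 1) (hstar : lamStar = Real.sqrt βs + (Real.sqrt βs)⁻¹) :
    0 < lamStar ∧ lamStar ^ 6 - 5 * lamStar ^ 4 + 4 * lamStar ^ 2 - 1 = 0 := by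
  have hβ : 0 < βs := by
    by_contra! h
    nlinarith [sq_nonneg (βs + 1), sq_nonneg βs, mul_nonneg (neg_nonneg.2 h) (sq_nonneg (βs + 1))]
  have hs : Real.sqrt βs ^ 2 = βs := Real.sq_sqrt hβ.le
  have hs0 : 0 < Real.sqrt βs := Real.sqrt_pos.2 hβ
  have h1 : lamStar ^ 2 = βs ^ 2 + βs + 1 := by
    have h2 : lamStar ^ 2 = βs + 2 + 1 / βs := by
      rw [hstar]
      have : (Real.sqrt βs + (Real.sqrt βs)⁻¹) ^ 2 =
        Real.sqrt βs ^ 2 + 2 + 1 / Real.sqrt βs ^ 2 := by field_simp; ring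
      rw [this, hs]
    have h3 : 1 / βs = βs ^ 2 - 1 := by
      rw [div_eq_iff hβ.ne']; linarith
    rw [h2, h3]; ring
  refine ⟨by rw [hstar]; positivity, ?_⟩
  have h4 : lamStar ^ 6 - 5 * lamStar ^ 4 + 4 * lamStar ^ 2 - 1 =
      (lamStar ^ 2) ^ 3 - 5 * (lamStar ^ 2) ^ 2 + 4 * lamStar ^ 2 - 1 := by ring
  rw [h4, h1]
  linear_combination (βs ^ 3 + 3 * βs ^ 2 + 2 * βs + 1) * hβs

lemma poly_nonneg_of_lamStar_le (hβs : βs ^ 3 = βs + 1)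
    (hstar : lamStar = Real.sqrt βs + (Real.sqrt βs)⁻¹) (h : lamStar ≤ lam) :
    0 ≤ lam ^ 6 - 5 * lam ^ 4 + 4 * lam ^ 2 - 1 := by
  obtain ⟨h0, h1⟩ := lamStar_sq hβs hstar
  have h2 := (lamStar_mem hβs hstar).1
  have h3 : 4 ≤ lamStar ^ 2 := by nlinarith
  have h4 : lamStar ^ 2 ≤ lam ^ 2 := by nlinarith
  have h5 : 0 ≤ (lam ^ 2 - lamStar ^ 2) * ((lam ^ 2) ^ 2 + lam ^ 2 * lamStar ^ 2 +
      (lamStar ^ 2) ^ 2 - 5 * (lam ^ 2 + lamStar ^ 2) + 4) := by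
    refine mul_nonneg (by linarith) ?_
    nlinarith [mul_nonneg (sub_nonneg.2 h3) (sub_nonneg.2 (h3.trans h4))]
  nlinarith

/-- Every number at least `lamStar` is approximated from below by its own capacities. -/
theorem exists_isCapacity_of_lamStar_le (hβs : βs ^ 3 = βs + 1)
    (hstar : lamStar = Real.sqrt βs + (Real.sqrt βs)⁻¹) (h : lamStar ≤ lam) (hη : 0 < η) :
    ∃ h, IsCapacity lam h ∧ h ≤ lam ∧ lam - η < h := by
  have h1 := (lamStar_mem hβs hstar).1
  have h2 : 2 < lam := by linarith
  have hl : 0 < lam := by linarith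
  have hla : 0 < 1 / lam := by positivity
  have hc1 := isCapacity_inv_lam hl
  have hla1 : 1 / lam < 1 := by rw [div_lt_one hl]; linarith
  rcases lt_or_ge lam (52 / 25) with hA | hA
  · have hp := poly_nonneg_of_lamStar_le hβs hstar h
    have hd : 0 < lam * (lam ^ 2 - 1) := mul_pos hl (by nlinarith)
    have hd' : 0 < lam ^ 2 - 1 := by nlinarith
    have e1 : lam - 1 / lam - 1 / (lam - 1 / lam) =
        (lam ^ 4 - 3 * lam ^ 2 + 1) / (lam * (lam ^ 2 - 1)) := by
      have : lam - 1 / lam = (lam ^ 2 - 1) / lam := by field_simp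
      rw [this, one_div_div]
      field_simp
      ring
    have h3 : lam - 1 / lam - 1 / (lam - 1 / lam) < 1 := by
      rw [e1, div_lt_one hd]
      nlinarith [mul_pos (sub_pos.2 h2) (sub_pos.2 hA)]
    have h4 : (lam - 1 / lam - 1 / (lam - 1 / lam)) ^ 2 -
        lam * (lam - 1 / lam - 1 / (lam - 1 / lam)) + 1 ≤ 0 := by
      rw [e1]
      have : ((lam ^ 4 - 3 * lam ^ 2 + 1) / (lam * (lam ^ 2 - 1))) ^ 2 -
          lam * ((lam ^ 4 - 3 * lam ^ 2 + 1) / (lam * (lam ^ 2 - 1))) + 1 =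
          -(lam ^ 6 - 5 * lam ^ 4 + 4 * lam ^ 2 - 1) / (lam * (lam ^ 2 - 1)) ^ 2 := by
        field_simp
        ring
      rw [this]
      exact div_nonpos_of_nonpos_of_nonneg (by linarith) (by positivity)
    obtain ⟨h', hh', hle, hgt⟩ := exists_isCapacity_near h2 (by linarith) h3 h4 hη
    exact ⟨h' + 1 / lam + 1 / (lam - 1 / lam), (hh'.add hc1).add (hc1.inv (by linarith)),
      by linarith, by linarith⟩
  rcases lt_or_ge lam (12 / 5) with hB | hB
  · have h3 : (lam - 1 / lam) / 2 < 1 := by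
      have : 5 / 12 < 1 / lam := by rw [lt_div_iff₀ hl]; linarith
      linarith
    have h4 : ((lam - 1 / lam) / 2) ^ 2 - lam * ((lam - 1 / lam) / 2) + 1 ≤ 0 := by
      have : ((lam - 1 / lam) / 2) ^ 2 - lam * ((lam - 1 / lam) / 2) + 1 =
          -(lam ^ 4 - 4 * lam ^ 2 - 1) / (4 * lam ^ 2) := by
        field_simp
        ring
      rw [this]
      refine div_nonpos_of_nonpos_of_nonneg ?_ (by positivity)
      have h5 : 43 / 10 ≤ lam ^ 2 := by nlinarith
      nlinarith
    obtain ⟨h', hh', hle, hgt⟩ := exists_isCapacity_near h2 hB.le h3 h4 (half_pos hη)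
    exact ⟨h' + h' + 1 / lam, (hh'.add hh').add hc1, by linarith, by linarith⟩
  · exact exists_isCapacity_of_large (by linarith) hη

theorem lt_lamStar_of_hasFiniteForbidden (hβs : βs ^ 3 = βs + 1)
    (hstar : lamStar = Real.sqrt βs + (Real.sqrt βs)⁻¹)
    (h : HasFiniteForbiddenCharacterizationSigned
      (fun _ G => ∀ μ : ℝ, IsEigenvalue G.mat μ → -lam ≤ μ)) : lam < lamStar := by
  by_contra! hle
  obtain ⟨k, N, F, hF⟩ := h
  have hbad : ∀ i, ∃ μ, IsEigenvalue (F i).mat μ ∧ μ < -lam := by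
    intro i
    have h1 := (hF _ (F i)).not.2 fun h' => h' i ⟨id, Function.injective_id, fun _ _ => rfl⟩
    push Not at h1
    exact h1
  choose μ hμ hlt using hbad
  obtain ⟨δ, hδ, hδμ⟩ : ∃ δ > 0, ∀ i, μ i < -(lam + δ) := by
    have h1 : ∀ i, ∀ᶠ δ in 𝓝[>] (0 : ℝ), μ i < -(lam + δ) := by
      intro i
      have h2 : ∀ᶠ δ in 𝓝 (0 : ℝ), δ < -lam - μ i := gt_mem_nhds (by linarith [hlt i])
      exact (h2.filter_mono nhdsWithin_le_nhds).mono fun δ hδ => by linarith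
    obtain ⟨δ, h2, h3⟩ := ((Filter.eventually_all.2 h1).and self_mem_nhdsWithin).exists
    exact ⟨δ, h3, h2⟩
  obtain ⟨c, hc, hc1, hc2⟩ := exists_isCapacity_of_lamStar_le (lam := lam + δ) hβs hstar
    (by linarith) hδ
  obtain ⟨n, G, hG, hG'⟩ := hc.exists_signedGraph hc1 hc2
  rw [add_sub_cancel_right, G.good_iff] at hG'
  have h1 := (hF n G).not.1 hG'
  push Not at h1
  obtain ⟨i, hi⟩ := h1
  have h2 := (F i).good_iff.1 (SignedGraph.good_of_embeds hi hG) _ (hμ i)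
  linarith [hδμ i]

end Threshold


/-- The family of signed graphs whose smallest eigenvalue is at least `-λ` has a finite
forbidden subgraph characterization iff `λ < λ*`. -/
theorem signed_forbidden_characterization_iff_lt_lamStar
    (βs lamStar : ℝ) (hβs : βs ^ 3 = βs + 1)
    (hstar : lamStar = Real.sqrt βs + (Real.sqrt βs)⁻¹) (lam : ℝ) :
    HasFiniteForbiddenCharacterizationSigned
      (fun _ G => ∀ μ : ℝ, IsEigenvalue G.mat μ → -lam ≤ μ) ↔ lam < lamStar :=
  ⟨lt_lamStar_of_hasFiniteForbidden hβs hstar, hasFiniteForbidden_of_lt hβs hstar⟩
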